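/- Let k be a field, A a commutative k-algebra, m ≥ 3 an integer, and n ≥ 0. Let φ be the natural k-algebra homomorphism A[t₁^{±1},…,tₙ^{±1}] → A ⊗_k k(t₁,…,tₙ) sending a ∈ A to a ⊗ 1 and t_i to 1 ⊗ t_i (where k(t₁,…,tₙ) is the rational function field in n variables over k). If g ∈ SL_m(A[t₁^{±1},…,tₙ^{±1}]) is such that φ(g) ∈ E_m(A ⊗_k k(t₁,…,tₙ)), then g ∈ E_m(A[t₁^{±1},…,tₙ^{±1}]). Equivalently, the natural map K1^{SL_m}(A[t₁^{±1},…,tₙ^{±1}]) → K1^{SL_m}(A ⊗_k k(t₁,…,tₙ)) is injective. -/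

import Mathlib

open Matrix
open scoped TensorProduct

/-- The elementary subgroup `E_m(S)` of `SL_m(S)`. -/
def ElemSubgroup (m : ℕ) (S : Type*) [CommRing S] :
    Subgroup (SpecialLinearGroup (Fin m) S) :=
  Subgroup.closure { g | ∃ i j : Fin m, ∃ a : S, i ≠ j ∧
    (g : Matrix (Fin m) (Fin m) S) = Matrix.transvection i j a }

namespace ElemGroup

/-- The special linear group of degree `m`. -/
abbrev SL (m : ℕ) (S : Type*) [CommRing S] := Matrix.SpecialLinearGroup (Fin m) S

/-- Entrywise application of a ring homomorphism. -/
abbrev mapSL {m : ℕ} {S S' : Type*} [CommRing S] [CommRing S'] (f : S →+* S') : SL m S →* SL m S' :=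
  Matrix.SpecialLinearGroup.map f

section Generators

variable {m : ℕ} {S : Type*} [CommRing S]

/-- The elementary matrix `1 + a E_{ij}`, with the junk value `1` for `i = j`. -/
def elm (i j : Fin m) (a : S) : SL m S :=
  if h : i = j then 1 else ⟨transvection i j a, det_transvection_of_ne i j h a⟩

theorem sl_ext {g h : SL m S}
    (H : (g : Matrix (Fin m) (Fin m) S) = h) : g = h := Subtype.ext H

theorem coe_mul (g h : SL m S) :
    ((g * h : SL m S) : Matrix (Fin m) (Fin m) S) = g.1 * h.1 := rfl

theorem coe_one : ((1 : SL m S) : Matrix (Fin m) (Fin m) S) = 1 := rfl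

theorem coe_mapSL {S' : Type*} [CommRing S'] (f : S →+* S') (g : SL m S) :
    (mapSL f g : Matrix (Fin m) (Fin m) S') = f.mapMatrix g.1 := rfl

@[simp] theorem mapSL_apply {S' : Type*} [CommRing S'] (f : S →+* S') (g : SL m S)
    (i j : Fin m) : (mapSL f g).1 i j = f (g.1 i j) := rfl

theorem coe_elm {i j : Fin m} (h : i ≠ j) (a : S) :
    (elm i j a : Matrix (Fin m) (Fin m) S) = 1 + single i j a := by
  simp [elm, h, transvection]

@[simp] theorem elm_self (i : Fin m) (a : S) : elm i i a = 1 := by simp [elm]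

@[simp] theorem elm_zero (i j : Fin m) : elm i j (0 : S) = 1 := by
  by_cases h : i = j
  · simp [elm, h]
  · apply sl_ext; simp [coe_elm h]

theorem elm_add (i j : Fin m) (a b : S) : elm i j (a + b) = elm i j a * elm i j b := by
  by_cases h : i = j
  · simp [elm, h]
  · apply sl_ext
    rw [coe_mul, coe_elm h, coe_elm h, coe_elm h]
    simp [add_mul, mul_add, Ne.symm h, single_add]
    abel

theorem elm_neg (i j : Fin m) (a : S) : elm i j (-a) = (elm i j a)⁻¹ := by
  rw [eq_inv_iff_mul_eq_one, ← elm_add]; simp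

theorem elm_comm {i j k l : Fin m} (h1 : j ≠ k) (h2 : l ≠ i) (a b : S) :
    elm i j a * elm k l b = elm k l b * elm i j a := by
  by_cases h : i = j
  · simp [elm, h]
  by_cases h' : k = l
  · simp [elm, h']
  apply sl_ext
  rw [coe_mul, coe_mul, coe_elm h, coe_elm h']
  simp [add_mul, mul_add, h1, h2]
  abel

theorem elm_mul_elm {i j k : Fin m} (hij : i ≠ j) (hjk : j ≠ k) (hik : i ≠ k) (a b : S) :
    elm i j a * elm j k b = elm j k b * elm i k (a * b) * elm i j a := by
  apply sl_ext
  simp only [coe_mul, coe_elm hij, coe_elm hjk, coe_elm hik]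
  simp [add_mul, mul_add, hik.symm]
  abel

theorem elm_conj_right {i j k : Fin m} (hij : i ≠ j) (hjk : j ≠ k) (hik : i ≠ k) (a b : S) :
    elm i j a * elm j k b * (elm i j a)⁻¹ = elm j k b * elm i k (a * b) := by
  rw [elm_mul_elm hij hjk hik, mul_inv_cancel_right]

theorem elm_conj_left {i j k : Fin m} (hij : i ≠ j) (hjk : j ≠ k) (hik : i ≠ k) (a b : S) :
    elm j k b * elm i j a * (elm j k b)⁻¹ = elm i j a * elm i k (-(a * b)) := by
  apply sl_ext
  rw [← elm_neg]
  simp only [coe_mul, coe_elm hij, coe_elm hjk, coe_elm hik]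
  simp [add_mul, mul_add, hij.symm, hjk.symm, hik.symm, ← single_neg]
  abel

theorem elm_commutator {i j k : Fin m} (hij : i ≠ j) (hjk : j ≠ k) (hik : i ≠ k) (a b : S) :
    elm i k (a * b) = elm i j a * elm j k b * (elm i j a)⁻¹ * (elm j k b)⁻¹ := by
  rw [elm_conj_right hij hjk hik, elm_comm hik.symm hjk.symm, mul_inv_cancel_right]

/-- The subgroup generated by the elementary matrices with entries in `J`. -/
def El (m : ℕ) (J : Set S) : Subgroup (SL m S) :=
  Subgroup.closure {g | ∃ i j : Fin m, ∃ a ∈ J, g = elm i j a}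

theorem elm_mem_El {J : Set S} {a : S} (ha : a ∈ J) (i j : Fin m) : elm i j a ∈ El m J :=
  Subgroup.subset_closure ⟨i, j, a, ha, rfl⟩

theorem El_le {J : Set S} {H : Subgroup (SL m S)}
    (h : ∀ i j : Fin m, i ≠ j → ∀ a ∈ J, elm i j a ∈ H) : El m J ≤ H := by
  rw [El, Subgroup.closure_le]
  rintro _ ⟨i, j, a, ha, rfl⟩
  by_cases hij : i = j
  · subst hij; simp
  · exact h i j hij a ha

theorem elemSubgroup_eq : ElemSubgroup m S = El m Set.univ := by
  apply le_antisymm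
  · rw [ElemSubgroup, Subgroup.closure_le]
    rintro g ⟨i, j, a, hij, h⟩
    have : g = elm i j a := Subtype.ext (by rw [coe_elm hij, h]; rfl)
    exact this ▸ elm_mem_El (Set.mem_univ a) i j
  · refine El_le fun i j hij a _ => Subgroup.subset_closure ⟨i, j, a, hij, ?_⟩
    exact coe_elm hij a

theorem map_elm {S' : Type*} [CommRing S'] (f : S →+* S') (i j : Fin m) (a : S) :
    mapSL f (elm i j a) = elm i j (f a) := by
  by_cases h : i = j
  · simp [elm, h]
  · apply sl_ext
    rw [coe_elm h, coe_mapSL, coe_elm h, map_add, map_one]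
    congr 1
    ext x y
    simp [single_apply, apply_ite f]

theorem map_El {S' : Type*} [CommRing S'] (f : S →+* S') (J : Set S) :
    (El m J).map (mapSL f) = El m (f '' J) := by
  rw [El, MonoidHom.map_closure, El]
  congr 1
  ext g
  constructor
  · rintro ⟨_, ⟨i, j, a, ha, rfl⟩, rfl⟩
    exact ⟨i, j, f a, ⟨a, ha, rfl⟩, map_elm f i j a⟩
  · rintro ⟨i, j, _, ⟨a, ha, rfl⟩, rfl⟩
    exact ⟨_, ⟨i, j, a, ha, rfl⟩, map_elm f i j a⟩

theorem map_mem_El {S' : Type*} [CommRing S'] (f : S →+* S')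
    {g : SL m S} (hg : g ∈ El m (Set.univ : Set S)) :
    mapSL f g ∈ El m (Set.univ : Set S') := by
  have : mapSL f g ∈ (El m Set.univ).map (mapSL f) :=
    ⟨g, hg, rfl⟩
  rw [map_El] at this
  exact El_le (fun i j _ a _ => elm_mem_El (Set.mem_univ a) i j) this

theorem map_injective {S' : Type*} [CommRing S'] {f : S →+* S'} (hf : Function.Injective f) :
    Function.Injective (mapSL (m := m) f) := by
  intro x y h
  ext i j
  apply hf
  exact congrFun (congrFun (congrArg Subtype.val h) i) j

/-- The matrix `1 + a bᵀ`, which has determinant one when `b · a = 0`. -/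
def rankOne (a b : Fin m → S) (h : b ⬝ᵥ a = 0) : SL m S :=
  ⟨1 + vecMulVec a b, by
    have := det_one_add_replicateCol_mul_replicateRow (ι := Unit) a b
    rw [h, add_zero] at this
    rw [← this]
    congr 2
    ext i j
    simp [vecMulVec_apply, Matrix.mul_apply]⟩

theorem coe_rankOne (a b : Fin m → S) (h : b ⬝ᵥ a = 0) :
    (rankOne a b h : Matrix (Fin m) (Fin m) S) = 1 + vecMulVec a b := rfl

theorem conj_rankOne (g : SL m S) (a b : Fin m → S) (h : b ⬝ᵥ a = 0)
    (h' : (b ᵥ* (g⁻¹ : SL m S).1) ⬝ᵥ (g.1 *ᵥ a) = 0) :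
    g * rankOne a b h * g⁻¹ = rankOne (g.1 *ᵥ a) (b ᵥ* (g⁻¹ : SL m S).1)
      h' := by
  have hg : (g : Matrix (Fin m) (Fin m) S) * (g⁻¹ : SL m S) = 1 := by
    rw [← coe_mul, mul_inv_cancel, coe_one]
  apply sl_ext
  simp only [coe_rankOne, coe_mul, mul_add, add_mul, mul_one, mul_vecMulVec,
    vecMulVec_mul, hg]

theorem elm_eq_rankOne {i j : Fin m} (h : i ≠ j) (a : S) :
    elm i j a = rankOne (Pi.single i a) (Pi.single j 1) (by simp [h]) := by
  apply sl_ext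
  rw [coe_elm h, coe_rankOne]
  congr 1
  ext x y
  simp only [single_apply, vecMulVec_apply, Pi.single_apply, mul_ite, mul_one, mul_zero]
  by_cases h1 : i = x <;> by_cases h2 : j = y <;> simp [h1, h2, Ne.symm]

theorem rankOne_add_left (a a' b : Fin m → S) (h : b ⬝ᵥ a = 0) (h' : b ⬝ᵥ a' = 0)
    (h'' : b ⬝ᵥ (a + a') = 0) :
    rankOne (a + a') b h'' = rankOne a b h * rankOne a' b h' := by
  apply sl_ext
  simp only [coe_rankOne, coe_mul, mul_add, add_mul, mul_one, one_mul,
    vecMulVec_mul_vecMulVec, h', add_vecMulVec, zero_smul]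
  simp [add_assoc]

theorem rankOne_add_right (a b b' : Fin m → S) (h : b ⬝ᵥ a = 0) (h' : b' ⬝ᵥ a = 0)
    (h'' : (b + b') ⬝ᵥ a = 0) :
    rankOne a (b + b') h'' = rankOne a b h * rankOne a b' h' := by
  apply sl_ext
  simp only [coe_rankOne, coe_mul, mul_add, add_mul, mul_one, one_mul,
    vecMulVec_mul_vecMulVec, h, vecMulVec_add, zero_smul]
  simp only [vecMulVec_zero, add_zero]
  abel

end Generators

section Gauss

variable {m : ℕ} {S : Type*} [CommRing S]

theorem elm_mul_apply {i j : Fin m} (h : i ≠ j) (a : S) (g : SL m S) (k l : Fin m) :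
    (elm i j a * g).1 k l = g.1 k l + if k = i then a * g.1 j l else 0 := by
  rw [coe_mul, coe_elm h, add_mul, one_mul, Matrix.add_apply]
  congr 1
  split_ifs with hk
  · subst hk; simp
  · simp [hk]

theorem mul_elm_apply {i j : Fin m} (h : i ≠ j) (a : S) (g : SL m S) (k l : Fin m) :
    (g * elm i j a).1 k l = g.1 k l + if l = j then g.1 k i * a else 0 := by
  rw [coe_mul, coe_elm h, mul_add, mul_one, Matrix.add_apply]
  congr 1
  split_ifs with hk
  · subst hk; simp
  · simp [hk]

/-- The matrix that agrees with the identity off the column `q`, whose entries off the diagonal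
are those of `v`. -/
def col (q : Fin m) (v : Fin m → S) : SL m S :=
  rankOne (Function.update v q 0) (Pi.single q 1) (by simp)

/-- The matrix that agrees with the identity off the row `p`, whose entries off the diagonal
are those of `v`. -/
def row (p : Fin m) (v : Fin m → S) : SL m S :=
  rankOne (Pi.single p 1) (Function.update v p 0) (by simp)

theorem col_mul_apply (q : Fin m) (v : Fin m → S) (g : SL m S) (i j : Fin m) :
    (col q v * g).1 i j = g.1 i j + if i = q then 0 else v i * g.1 q j := by
  rw [coe_mul, col, coe_rankOne, add_mul, one_mul, Matrix.add_apply, vecMulVec_mul]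
  congr 1
  split_ifs with hk
  · subst hk; simp [vecMulVec_apply]
  · simp [vecMulVec_apply, hk]

theorem mul_col_apply (q : Fin m) (v : Fin m → S) (g : SL m S) (i j : Fin m) :
    (g * col q v).1 i j = g.1 i j + if j = q then ∑ k, g.1 i k * Function.update v q 0 k else 0 := by
  rw [coe_mul, col, coe_rankOne, mul_add, mul_one, Matrix.add_apply, mul_vecMulVec]
  congr 1
  simp [vecMulVec_apply, mulVec, dotProduct, Pi.single_apply]

theorem mul_row_apply (p : Fin m) (v : Fin m → S) (g : SL m S) (i j : Fin m) :
    (g * row p v).1 i j = g.1 i j + if j = p then 0 else g.1 i p * v j := by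
  rw [coe_mul, row, coe_rankOne, mul_add, mul_one, Matrix.add_apply, mul_vecMulVec]
  congr 1
  split_ifs with hk
  · subst hk; simp [vecMulVec_apply]
  · simp [vecMulVec_apply, hk]

theorem rankOne_zero_left (b : Fin m → S) (h) : rankOne 0 b h = 1 := by
  apply sl_ext; simp [coe_rankOne]

theorem rankOne_zero_right (a : Fin m → S) (h) : rankOne a 0 h = 1 := by
  apply sl_ext; simp [coe_rankOne]

/-- `1 + (∑ aₖ) bᵀ` lies in a subgroup as soon as each `1 + aₖ bᵀ` does. -/
theorem rankOne_sum_left_mem (N : Subgroup (SL m S)) {ι : Type*} (s : Finset ι)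
    (a : ι → Fin m → S) (b : Fin m → S) (h : ∀ k ∈ s, b ⬝ᵥ a k = 0)
    (hN : ∀ k (hk : k ∈ s), rankOne (a k) b (h k hk) ∈ N) (h' : b ⬝ᵥ (∑ k ∈ s, a k) = 0) :
    rankOne (∑ k ∈ s, a k) b h' ∈ N := by
  classical
  induction s using Finset.induction_on with
  | empty => simp [rankOne_zero_left, N.one_mem]
  | insert x s hx ih =>
    have h1 : b ⬝ᵥ a x = 0 := h x (Finset.mem_insert_self x s)
    have h2 : b ⬝ᵥ (∑ k ∈ s, a k) = 0 := by
      rw [dotProduct_sum]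
      exact Finset.sum_eq_zero fun k hk => h k (Finset.mem_insert_of_mem hk)
    have : rankOne (∑ k ∈ insert x s, a k) b h' = rankOne (a x) b h1 * rankOne _ b h2 := by
      rw [← rankOne_add_left _ _ _ h1 h2 (by rw [dotProduct_add, h1, h2, add_zero])]
      congr 1
      exact Finset.sum_insert hx
    rw [this]
    exact N.mul_mem (hN x (Finset.mem_insert_self x s))
      (ih (fun k hk => h k (Finset.mem_insert_of_mem hk))
        (fun k hk => hN k (Finset.mem_insert_of_mem hk)) h2)

theorem rankOne_sum_right_mem (N : Subgroup (SL m S)) {ι : Type*} (s : Finset ι)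
    (a : Fin m → S) (b : ι → Fin m → S) (h : ∀ k ∈ s, b k ⬝ᵥ a = 0)
    (hN : ∀ k (hk : k ∈ s), rankOne a (b k) (h k hk) ∈ N) (h' : (∑ k ∈ s, b k) ⬝ᵥ a = 0) :
    rankOne a (∑ k ∈ s, b k) h' ∈ N := by
  classical
  induction s using Finset.induction_on with
  | empty => simp [rankOne_zero_right, N.one_mem]
  | insert x s hx ih =>
    have h1 : b x ⬝ᵥ a = 0 := h x (Finset.mem_insert_self x s)
    have h2 : (∑ k ∈ s, b k) ⬝ᵥ a = 0 := by
      rw [sum_dotProduct]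
      exact Finset.sum_eq_zero fun k hk => h k (Finset.mem_insert_of_mem hk)
    have : rankOne a (∑ k ∈ insert x s, b k) h' = rankOne a (b x) h1 * rankOne a _ h2 := by
      rw [← rankOne_add_right _ _ _ h1 h2 (by rw [add_dotProduct, h1, h2, add_zero])]
      congr 1
      exact Finset.sum_insert hx
    rw [this]
    exact N.mul_mem (hN x (Finset.mem_insert_self x s))
      (ih (fun k hk => h k (Finset.mem_insert_of_mem hk))
        (fun k hk => hN k (Finset.mem_insert_of_mem hk)) h2)

theorem sum_single_filter_ne (q : Fin m) (v : Fin m → S) :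
    Function.update v q 0 = ∑ k ∈ Finset.univ.filter (· ≠ q), Pi.single k (v k) := by
  ext i
  rw [Finset.sum_apply, Finset.sum_filter]
  by_cases hi : i = q
  · subst hi
    symm
    simpa using Finset.sum_eq_zero fun k _ => by
      by_cases hk : k = i
      · simp [hk]
      · simp [hk, Ne.symm hk]
  · rw [Finset.sum_eq_single i]
    · simp [hi]
    · intro k _ hk
      simp [Ne.symm hk]
    · simp

theorem col_mem (N : Subgroup (SL m S)) (q : Fin m) (v : Fin m → S)
    (h : ∀ k, k ≠ q → elm k q (v k) ∈ N) : col q v ∈ N := by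
  have h0 : ∀ k ∈ Finset.univ.filter (· ≠ q),
      (Pi.single q 1 : Fin m → S) ⬝ᵥ (Pi.single k (v k)) = 0 := fun k hk => by
    simp [Ne.symm (Finset.mem_filter.1 hk).2]
  have := rankOne_sum_left_mem N (Finset.univ.filter (· ≠ q)) (fun k => Pi.single k (v k))
    (Pi.single q 1) h0 (fun k hk => by
      have hk' := (Finset.mem_filter.1 hk).2
      have := h k hk'
      rwa [elm_eq_rankOne hk'] at this) (by rw [← sum_single_filter_ne]; simp)
  simpa only [col, sum_single_filter_ne q v] using this

theorem row_mem (N : Subgroup (SL m S)) (p : Fin m) (v : Fin m → S)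
    (h : ∀ k, k ≠ p → elm p k (v k) ∈ N) : row p v ∈ N := by
  have e : ∀ k, k ≠ p → ∀ h', rankOne (Pi.single p 1) (Pi.single k (v k)) h' = elm p k (v k) := by
    intro k hk h'
    rw [elm_eq_rankOne hk.symm]
    apply sl_ext
    rw [coe_rankOne, coe_rankOne]
    congr 1
    ext x y
    simp only [vecMulVec_apply, Pi.single_apply]
    split_ifs <;> simp
  have h0 : ∀ k ∈ Finset.univ.filter (· ≠ p),
      (Pi.single k (v k) : Fin m → S) ⬝ᵥ (Pi.single p 1) = 0 := fun k hk => by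
    simp [Ne.symm (Finset.mem_filter.1 hk).2]
  have := rankOne_sum_right_mem N (Finset.univ.filter (· ≠ p)) (Pi.single p 1)
    (fun k => Pi.single k (v k)) h0 (fun k hk => by
      have hk' := (Finset.mem_filter.1 hk).2
      rw [e k hk']
      exact h k hk') (by rw [← sum_single_filter_ne]; simp)
  simpa only [row, sum_single_filter_ne p v] using this

end Gauss

section Relative

variable {m : ℕ} {S : Type*} [CommRing S]

/-- The matrices of determinant one with entries in a subring. -/
def SLsub (m : ℕ) (T : Subring S) : Subgroup (SL m S) := (mapSL T.subtype).range

theorem mem_SLsub {T : Subring S} {x : SL m S} : x ∈ SLsub m T ↔ ∀ i j, x.1 i j ∈ T := by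
  constructor
  · rintro ⟨y, rfl⟩ i j
    exact (y.1 i j).2
  · intro h
    refine ⟨⟨Matrix.of fun i j => ⟨x.1 i j, h i j⟩, ?_⟩, ?_⟩
    · apply Subtype.coe_injective
      have := T.subtype.map_det (Matrix.of fun i j => (⟨x.1 i j, h i j⟩ : T))
      refine this.trans ?_
      exact x.2.trans T.subtype.map_one.symm
    · apply sl_ext
      ext i j
      rfl

theorem elm_mem_SLsub {T : Subring S} {a : S} (ha : a ∈ T) (i j : Fin m) :
    elm i j a ∈ SLsub m T :=
  ⟨elm i j ⟨a, ha⟩, map_elm _ _ _ _⟩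

/-- The principal congruence subgroup of an ideal. -/
def principal (m : ℕ) (I : Ideal S) : Subgroup (SL m S) := (mapSL (Ideal.Quotient.mk I)).ker

instance (I : Ideal S) : (principal m I).Normal := by
  unfold principal; infer_instance

theorem mem_principal {I : Ideal S} {x : SL m S} :
    x ∈ principal m I ↔ ∀ i j, x.1 i j - (1 : Matrix (Fin m) (Fin m) S) i j ∈ I := by
  rw [principal, MonoidHom.mem_ker]
  have e : ∀ i j, Ideal.Quotient.mk I ((1 : Matrix (Fin m) (Fin m) S) i j) =
      (1 : Matrix (Fin m) (Fin m) (S ⧸ I)) i j := fun i j => by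
    simp only [one_apply]; split_ifs <;> simp
  constructor
  · intro h i j
    rw [← Ideal.Quotient.mk_eq_mk_iff_sub_mem, e]
    exact congrFun (congrFun (congrArg Subtype.val h) i) j
  · intro h
    apply sl_ext
    ext i j
    rw [mapSL_apply, (Ideal.Quotient.mk_eq_mk_iff_sub_mem _ _).2 (h i j), e]
    rfl

theorem elm_mem_principal {I : Ideal S} {a : S} (ha : a ∈ I) (i j : Fin m) :
    elm i j a ∈ principal m I := by
  rw [principal, MonoidHom.mem_ker, map_elm, Ideal.Quotient.eq_zero_iff_mem.2 ha, elm_zero]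

theorem sub_one_mem_of_mem_principal {I : Ideal S} {x : SL m S} (hx : x ∈ principal m I)
    (i : Fin m) : x.1 i i - 1 ∈ I := by
  simpa using mem_principal.1 hx i i

theorem mem_of_mem_principal {I : Ideal S} {x : SL m S} (hx : x ∈ principal m I)
    {i j : Fin m} (h : i ≠ j) : x.1 i j ∈ I := by
  simpa [h] using mem_principal.1 hx i j

/-- A product of elementary matrices equal to the diagonal matrix with `1 + l` at `i` and `v` at
`j` when `(1 + l) v = 1`. -/
def diagElm (i j : Fin m) (l v : S) : SL m S :=
  elm j i (-(l * v)) * (elm i j 1 * elm j i l * (elm i j 1)⁻¹) * elm i j (l * v)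

theorem diagElm_mul_apply {i j : Fin m} (hij : i ≠ j) {l v : S} (h : (1 + l) * v = 1)
    (g : SL m S) (k x : Fin m) :
    (diagElm i j l v * g).1 k x =
      if k = i then (1 + l) * g.1 i x else if k = j then v * g.1 j x else g.1 k x := by
  have hji := hij.symm
  rw [diagElm, ← elm_neg]
  simp only [mul_assoc]
  simp only [elm_mul_apply hij, elm_mul_apply hji]
  by_cases h1 : k = i
  · subst h1
    simp only [hij, hij.symm, if_true, if_false]
    linear_combination (l * g.1 j x) * h
  · by_cases h2 : k = j
    · subst h2
      simp only [hij, hij.symm, if_true, if_false]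
      linear_combination (-l * g.1 i x + (-l^2 * v - 1 + l) * g.1 k x) * h
    · simp [h1, h2]

variable {T : Subring S} {I : Ideal S} {N : Subgroup (SL m S)}

theorem diagElm_mem (hN : ∀ i j, i ≠ j → ∀ a ∈ T, a ∈ I → elm i j a ∈ N)
    (hconj : ∀ i j, i ≠ j → ∀ x ∈ N, elm i j 1 * x * (elm i j 1)⁻¹ ∈ N)
    {i j : Fin m} (hij : i ≠ j) {l v : S} (hl : l ∈ T) (hl' : l ∈ I) (hv : v ∈ T) :
    diagElm i j l v ∈ N := by
  have h1 : l * v ∈ T := T.mul_mem hl hv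
  have h2 : l * v ∈ I := I.mul_mem_right _ hl'
  exact N.mul_mem (N.mul_mem (hN _ _ hij.symm _ (T.neg_mem h1) (I.neg_mem h2))
    (hconj _ _ hij _ (hN _ _ hij.symm _ hl hl'))) (hN _ _ hij _ h1 h2)

theorem diagElm_mem_inf {i j : Fin m} (hij : i ≠ j) {l v : S} (hl : l ∈ T) (hl' : l ∈ I)
    (hv : v ∈ T) : diagElm i j l v ∈ SLsub m T ⊓ principal m I := by
  refine diagElm_mem (T := T) (I := I) (N := SLsub m T ⊓ principal m I) (fun i j _ a h h' => ⟨elm_mem_SLsub h _ _,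
    elm_mem_principal h' _ _⟩) (fun i j _ x hx => ⟨?_, ?_⟩) hij hl hl' hv
  · have := elm_mem_SLsub T.one_mem i j
    exact (SLsub m T).mul_mem ((SLsub m T).mul_mem this hx.1) ((SLsub m T).inv_mem this)
  · exact Subgroup.Normal.conj_mem inferInstance _ hx.2 _

theorem eq_one_of_diagonal (y : SL m S) (hd : ∀ i j, i ≠ j → y.1 i j = 0)
    (h1 : ∀ i : Fin m, i.1 + 1 < m → y.1 i i = 1) : y = 1 := by
  have hy : y.1 = diagonal fun i => y.1 i i := by
    ext i j
    by_cases h : i = j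
    · subst h; simp
    · simp [h, hd i j h]
  have hdet := y.2
  rw [hy, det_diagonal] at hdet
  have : ∀ i, y.1 i i = 1 := by
    intro i
    by_cases hi : i.1 + 1 < m
    · exact h1 i hi
    · rw [Finset.prod_eq_single i] at hdet
      · exact hdet
      · intro j _ hj
        have : j.1 ≠ i.1 := fun h => hj (Fin.ext h)
        exact h1 j (by omega)
      · simp
  apply sl_ext
  rw [hy, coe_one]
  ext i j
  by_cases h : i = j
  · subst h; simp [this]
  · simp [h]

theorem diagonal_mem (hN : ∀ i j, i ≠ j → ∀ a ∈ T, a ∈ I → elm i j a ∈ N)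
    (hconj : ∀ i j, i ≠ j → ∀ x ∈ N, elm i j 1 * x * (elm i j 1)⁻¹ ∈ N) (d : ℕ) :
    ∀ y ∈ SLsub m T ⊓ principal m I, (∀ i, ∃ v ∈ T, v * y.1 i i = 1) →
      (∀ i j, i ≠ j → y.1 i j = 0) → (∀ i : Fin m, i.1 + 1 + d < m → y.1 i i = 1) → y ∈ N := by
  induction d with
  | zero =>
    intro y _ _ hd h1
    rw [eq_one_of_diagonal y hd h1]
    exact N.one_mem
  | succ d ih =>
    intro y hy hu hd h1
    by_cases hm : d + 2 ≤ m
    swap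
    · exact ih y hy hu hd fun i hi => by omega
    let c : Fin m := ⟨m - 2 - d, by omega⟩
    let c' : Fin m := ⟨m - 1 - d, by omega⟩
    have hcc : c ≠ c' := by
      intro h
      have := congrArg Fin.val h
      simp only [c, c'] at this
      omega
    obtain ⟨v, hv, hvu⟩ := hu c
    have hl : v - 1 ∈ T := T.sub_mem hv T.one_mem
    have hl' : v - 1 ∈ I := by
      have : v - 1 = -v * (y.1 c c - 1) := by linear_combination hvu
      rw [this]
      exact I.mul_mem_left _ (sub_one_mem_of_mem_principal hy.2 c)
    have hyT : y.1 c c ∈ T := mem_SLsub.1 hy.1 c c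
    have e : (1 + (v - 1)) * y.1 c c = 1 := by linear_combination hvu
    have key := diagElm_mul_apply hcc e y
    have hmem : diagElm c c' (v - 1) (y.1 c c) * y ∈ N := by
      apply ih _ (mul_mem (diagElm_mem_inf hcc hl hl' hyT) hy)
      · intro i
        rw [key]
        split_ifs with h h'
        · subst h; exact ⟨1, T.one_mem, by rw [one_mul]; exact e⟩
        · subst h'
          obtain ⟨w, hw, hwu⟩ := hu c'
          exact ⟨v * w, T.mul_mem hv hw, by
            linear_combination (w * y.1 c' c') * hvu + hwu⟩
        · exact hu i
      · intro i j hij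
        rw [key]
        split_ifs with h h'
        · subst h; rw [hd _ _ hij, mul_zero]
        · subst h'; rw [hd _ _ hij, mul_zero]
        · exact hd i j hij
      · intro i hi
        rw [key]
        split_ifs with h h'
        · subst h; exact e
        · subst h'
          simp only [c'] at hi
          omega
        · apply h1
          have : i.1 ≠ c.1 := fun hh => h (Fin.ext hh)
          simp only [c] at this
          omega
    exact (N.mul_mem_cancel_left (diagElm_mem hN hconj hcc hl hl' hyT)).1 hmem

/-- Gaussian elimination relative to an ideal. The proposition `tri` allows one to restrict to
upper triangular matrices. -/
theorem gauss (tri : Prop) (hN : ∀ i j, i ≠ j → ∀ a ∈ T, a ∈ I → elm i j a ∈ N)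
    (hconj : ∀ i j, i ≠ j → ∀ x ∈ N, elm i j 1 * x * (elm i j 1)⁻¹ ∈ N)
    (hu : ∀ z ∈ SLsub m T ⊓ principal m I, (tri → ∀ i j, j < i → z.1 i j = 0) →
      ∀ i, ∃ v ∈ T, v * z.1 i i = 1)
    {y : SL m S} (hy : y ∈ SLsub m T ⊓ principal m I)
    (ht : tri → ∀ i j, j < i → y.1 i j = 0) : y ∈ N := by
  suffices H : ∀ d, ∀ y ∈ SLsub m T ⊓ principal m I, (tri → ∀ i j, j < i → y.1 i j = 0) →
      (∀ i j : Fin m, j.1 + d < m → i ≠ j → y.1 i j = 0) → y ∈ N from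
    H m y hy ht fun i j h => by omega
  intro d
  induction d with
  | zero =>
    intro y hy ht hd
    exact diagonal_mem hN hconj m y hy (hu y hy ht) (fun i j hij => hd i j j.2 hij)
      fun i h => by omega
  | succ d ih =>
    intro y hy ht hd
    by_cases hm : d + 1 ≤ m
    swap
    · exact ih y hy ht fun i j h => by omega
    let c : Fin m := ⟨m - 1 - d, by omega⟩
    obtain ⟨v, hv, hvu⟩ := hu y hy ht c
    let w : Fin m → S := fun k => -(y.1 k c * v)
    have hwT : ∀ k, w k ∈ T := fun k => T.neg_mem (T.mul_mem (mem_SLsub.1 hy.1 k c) hv)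
    have hwI : ∀ k, k ≠ c → w k ∈ I := fun k hk =>
      I.neg_mem (I.mul_mem_right _ (mem_of_mem_principal hy.2 hk))
    have h1 : col c w ∈ N := col_mem _ _ _ fun k hk => hN _ _ hk _ (hwT k) (hwI k hk)
    have h2 : col c w ∈ SLsub m T ⊓ principal m I := col_mem _ _ _ fun k hk =>
      ⟨elm_mem_SLsub (hwT k) _ _, elm_mem_principal (hwI k hk) _ _⟩
    refine (N.mul_mem_cancel_left h1).1 (ih _ (mul_mem h2 hy) ?_ ?_)
    · intro t i j hij
      rw [col_mul_apply, ht t i j hij, zero_add]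
      split_ifs with h
      · rfl
      · by_cases hjc : j < c
        · rw [ht t c j hjc, mul_zero]
        · simp only [w, ht t i c (lt_of_le_of_lt (not_lt.1 hjc) hij)]
          ring
    · intro i j hj hij
      rw [col_mul_apply]
      by_cases hjc : j = c
      · subst hjc
        rw [if_neg hij]
        simp only [w]
        linear_combination (-y.1 i c) * hvu
      · have hj' : j.1 ≠ c.1 := fun h => hjc (Fin.ext h)
        simp only [c] at hj'
        rw [hd i j (by omega) hij, hd c j (by omega) (Ne.symm hjc)]
        simp

end Relative

section Scaling

variable {m : ℕ} {S : Type*} [CommRing S]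

theorem El_mono {J J' : Set S} (h : J ⊆ J') : El m J ≤ El m J' :=
  El_le fun i j _ _ ha => elm_mem_El (h ha) i j

theorem El_induction {J : Set S} (hJ : ∀ a ∈ J, -a ∈ J) {p : SL m S → Prop} (one : p 1)
    (mul : ∀ i j, i ≠ j → ∀ a ∈ J, ∀ g ∈ El m J, p g → p (elm i j a * g)) {g : SL m S}
    (hg : g ∈ El m J) : p g := by
  have mul' : ∀ i j, ∀ a ∈ J, ∀ g ∈ El m J, p g → p (elm i j a * g) := by
    intro i j a ha g hg h
    by_cases hij : i = j
    · subst hij; simpa using h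
    · exact mul i j hij a ha g hg h
  unfold El at hg
  induction hg using Subgroup.closure_induction_left with
  | one => exact one
  | mul_left x hx y hy h =>
    obtain ⟨i, j, a, ha, rfl⟩ := hx
    exact mul' i j a ha y hy h
  | inv_mul_cancel x hx y hy h =>
    obtain ⟨i, j, a, ha, rfl⟩ := hx
    rw [← elm_neg]
    exact mul' i j _ (hJ a ha) y hy h

/-- The multiples of `s` by elements of a subring. -/
def scaled (s : S) (T : Subring S) : Set S := {x | ∃ y ∈ T, x = s * y}

theorem scaled_one (T : Subring S) : scaled 1 T = T := by
  ext x; simp [scaled]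

theorem exists_third (hm : 3 ≤ m) (p q : Fin m) : ∃ l : Fin m, l ≠ p ∧ l ≠ q := by
  have : ({p, q} : Finset (Fin m)).card < (Finset.univ : Finset (Fin m)).card := by
    rw [Finset.card_univ, Fintype.card_fin]
    exact lt_of_le_of_lt Finset.card_le_two (by omega)
  obtain ⟨l, _, hl⟩ := Finset.exists_mem_notMem_of_card_lt_card this
  simp only [Finset.mem_insert, Finset.mem_singleton, not_or] at hl
  exact ⟨l, hl⟩

theorem conj_El_le {g : SL m S} {J : Set S} {H : Subgroup (SL m S)}
    (h : ∀ i j, i ≠ j → ∀ a ∈ J, g * elm i j a * g⁻¹ ∈ H) {x : SL m S} (hx : x ∈ El m J) :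
    g * x * g⁻¹ ∈ H := by
  have : El m J ≤ H.comap (MulAut.conj g).toMonoidHom :=
    El_le fun i j hij a ha => Subgroup.mem_comap.2 (h i j hij a ha)
  exact Subgroup.mem_comap.1 (this hx)

theorem conj_elm_scaled (hm : 3 ≤ m) {T : Subring S} {s' r c : S} (hs' : s' ∈ T) (hr : r ∈ T)
    (hrc : r * c ∈ T) {p q : Fin m} (hpq : p ≠ q) {i j : Fin m} (hij : i ≠ j) {y : S}
    (hy : y ∈ T) :
    elm p q c * elm i j ((r * s') ^ 2 * y) * (elm p q c)⁻¹ ∈ El m (scaled s' T) := by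
  have mem : ∀ (a b : Fin m) (z : S), (∃ w ∈ T, z = s' * w) → elm a b z ∈ El m (scaled s' T) :=
    fun a b z h => elm_mem_El (J := scaled s' T) h a b
  have hrs : r * s' ∈ T := T.mul_mem hr hs'
  by_cases hiq : i = q
  · subst hiq
    by_cases hjp : j = p
    · subst hjp
      obtain ⟨l, hlj, hli⟩ := exists_third hm j i
      have e : (r * s') ^ 2 * y = (r * s') * (r * s' * y) := by ring
      rw [e, elm_commutator hli.symm hlj hij]
      set a := elm i l (r * s') with ha
      set b := elm l j (r * s' * y) with hb
      have h1 : elm j i c * a * (elm j i c)⁻¹ ∈ El m (scaled s' T) := by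
        rw [ha, elm_conj_right hpq hli.symm hlj.symm]
        exact mul_mem (mem _ _ _ ⟨r, hr, by ring⟩) (mem _ _ _ ⟨r * c, hrc, by ring⟩)
      have h2 : elm j i c * b * (elm j i c)⁻¹ ∈ El m (scaled s' T) := by
        rw [hb, elm_conj_left hlj hpq hli]
        exact mul_mem (mem _ _ _ ⟨r * y, T.mul_mem hr hy, by ring⟩)
          (mem _ _ _ ⟨-(r * c * y), T.neg_mem (T.mul_mem hrc hy), by ring⟩)
      have : elm j i c * (a * b * a⁻¹ * b⁻¹) * (elm j i c)⁻¹ =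
          (elm j i c * a * (elm j i c)⁻¹) * (elm j i c * b * (elm j i c)⁻¹) *
          (elm j i c * a * (elm j i c)⁻¹)⁻¹ * (elm j i c * b * (elm j i c)⁻¹)⁻¹ := by group
      rw [this]
      exact mul_mem (mul_mem (mul_mem h1 h2) (inv_mem h1)) (inv_mem h2)
    · rw [elm_conj_right hpq hij (Ne.symm hjp)]
      exact mul_mem (mem _ _ _ ⟨r * (r * s') * y, T.mul_mem (T.mul_mem hr hrs) hy, by ring⟩)
        (mem _ _ _ ⟨(r * s') * (r * c) * y, T.mul_mem (T.mul_mem hrs hrc) hy, by ring⟩)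
  · by_cases hjp : j = p
    · subst hjp
      rw [elm_conj_left hij hpq hiq]
      exact mul_mem (mem _ _ _ ⟨r * (r * s') * y, T.mul_mem (T.mul_mem hr hrs) hy, by ring⟩)
        (mem _ _ _ ⟨-((r * s') * (r * c) * y), T.neg_mem (T.mul_mem (T.mul_mem hrs hrc) hy),
          by ring⟩)
    · rw [elm_comm (Ne.symm hiq) hjp, mul_inv_cancel_right]
      exact mem _ _ _ ⟨r * (r * s') * y, T.mul_mem (T.mul_mem hr hrs) hy, by ring⟩

/-- Conjugation by an elementary matrix over a localization is continuous for the topology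
defined by the denominators. -/
theorem exists_conj_scaled (hm : 3 ≤ m) {T : Subring S} {D : Submonoid S} (hD : ∀ s ∈ D, s ∈ T)
    (dens : ∀ x, ∃ s ∈ D, s * x ∈ T) {g : SL m S} (hg : g ∈ El m (Set.univ : Set S)) :
    ∀ s' ∈ D, ∃ s ∈ D, ∀ x ∈ El m (scaled s T), g * x * g⁻¹ ∈ El m (scaled s' T) := by
  refine El_induction (p := fun g => ∀ s' ∈ D, ∃ s ∈ D, ∀ x ∈ El m (scaled s T),
    g * x * g⁻¹ ∈ El m (scaled s' T)) (fun _ _ => Set.mem_univ _) ?_ ?_ hg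
  · exact fun s' hs' => ⟨s', hs', fun x hx => by simpa using hx⟩
  · intro p q hpq c _ g _ ih s' hs'
    obtain ⟨r, hr, hrc⟩ := dens c
    obtain ⟨s, hs, h⟩ := ih _ (D.pow_mem (D.mul_mem hr hs') 2)
    refine ⟨s, hs, fun x hx => ?_⟩
    have : elm p q c * g * x * (elm p q c * g)⁻¹ =
        elm p q c * (g * x * g⁻¹) * (elm p q c)⁻¹ := by group
    rw [this]
    refine conj_El_le ?_ (h x hx)
    rintro i j hij _ ⟨y, hy, rfl⟩
    exact conj_elm_scaled hm (hD _ hs') (hD _ hr) hrc hpq hij hy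

/-- Patching of elementary matrices. -/
theorem exists_mul_of_split (hm : 3 ≤ m) {T₁ T₂ : Subring S} {X : S} (hX : X ∈ T₂)
    (dens : ∀ x, ∃ n : ℕ, X ^ n * x ∈ T₂)
    (split : ∀ (M : ℕ) (x : S), ∃ y ∈ T₁, ∃ z ∈ T₂, x = y + X ^ M * z)
    {g : SL m S} (hg : g ∈ El m (Set.univ : Set S)) :
    ∃ a ∈ El m (T₁ : Set S), ∃ b ∈ El m (T₂ : Set S), g = a * b := by
  refine El_induction (p := fun g => ∃ a ∈ El m (T₁ : Set S), ∃ b ∈ El m (T₂ : Set S), g = a * b)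
    (fun _ _ => Set.mem_univ _) ?_ ?_ hg
  · exact ⟨1, one_mem _, 1, one_mem _, by simp⟩
  · intro p q hpq c _ g _ ih
    obtain ⟨a, ha, b, hb, rfl⟩ := ih
    have ha' : a⁻¹ ∈ El m (Set.univ : Set S) := inv_mem (El_mono (Set.subset_univ _) ha)
    obtain ⟨_, ⟨M, rfl⟩, hM⟩ := exists_conj_scaled hm (T := T₂) (D := Submonoid.powers X)
      (by rintro _ ⟨n, rfl⟩; exact T₂.pow_mem hX n)
      (fun x => by obtain ⟨n, hn⟩ := dens x; exact ⟨X ^ n, ⟨n, rfl⟩, hn⟩) ha' 1 (one_mem _)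
    obtain ⟨y, hy, z, hz, rfl⟩ := split M c
    refine ⟨elm p q y * a, mul_mem (elm_mem_El hy p q) ha,
      (a⁻¹ * elm p q (X ^ M * z) * a⁻¹⁻¹) * b, mul_mem ?_ hb, ?_⟩
    · rw [← scaled_one T₂]
      exact hM _ (elm_mem_El (J := scaled _ T₂) ⟨z, hz, rfl⟩ p q)
    · rw [elm_add]; group

end Scaling

section LocalGlobal

open Polynomial

variable {m : ℕ}

theorem mapSL_comp {R S T : Type*} [CommRing R] [CommRing S] [CommRing T] (f : R →+* S)
    (g : S →+* T) (x : SL m R) : mapSL g (mapSL f x) = mapSL (g.comp f) x := rfl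

/-- The normal closure in `E(R[X])` of the elementary matrices with entries divisible by `X`. -/
noncomputable def vanishing (m : ℕ) (R : Type*) [CommRing R] : Subgroup (SL m R[X]) :=
  Subgroup.closure {x | ∃ d ∈ El m (Set.univ : Set R), ∃ i j : Fin m, ∃ f : R[X], i ≠ j ∧
    x = mapSL C d * elm i j (X * f) * (mapSL C d)⁻¹}

theorem mul_inv_eval_mem_vanishing {R : Type*} [CommRing R] {x : SL m R[X]}
    (hx : x ∈ El m (Set.univ : Set R[X])) :
    x * (mapSL C (mapSL (evalRingHom 0) x))⁻¹ ∈ vanishing m R := by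
  refine El_induction (J := Set.univ)
    (p := fun x : SL m R[X] => x * (mapSL C (mapSL (evalRingHom 0) x))⁻¹ ∈ vanishing m R)
    (fun _ _ => Set.mem_univ _) ?_ ?_ hx
  · simp [one_mem]
  · intro i j hij a _ g _ ih
    obtain ⟨f, hf⟩ : ∃ f, a = X * f + C (a.eval 0) := by
      obtain ⟨f, hf⟩ := X_dvd_sub_C (p := a)
      exact ⟨f, by rw [← hf, coeff_zero_eq_eval_zero]; ring⟩
    set a0 := a.eval 0 with ha0
    have e0 : mapSL C (mapSL (evalRingHom 0) (elm i j a)) = (elm i j (C a0) : SL m R[X]) := by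
      rw [map_elm, map_elm]; rfl
    have e : elm i j a * g * (mapSL C (mapSL (evalRingHom 0) (elm i j a * g)))⁻¹ =
        elm i j (X * f) * (elm i j (C a0) * (g * (mapSL C (mapSL (evalRingHom 0) g))⁻¹) *
          (elm i j (C a0))⁻¹) := by
      rw [map_mul, map_mul, e0]
      nth_rewrite 1 [hf]
      rw [elm_add]
      group
    rw [e]
    refine mul_mem (Subgroup.subset_closure ⟨1, one_mem _, i, j, f, hij, by simp⟩) ?_
    have key : ∀ y ∈ vanishing m R,
        elm i j (C a0) * y * (elm i j (C a0))⁻¹ ∈ vanishing m R := by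
      intro y hy
      have : vanishing m R ≤ (vanishing m R).comap (MulAut.conj (elm i j (C a0))).toMonoidHom := by
        conv_lhs => rw [vanishing]
        rw [Subgroup.closure_le]
        rintro _ ⟨d, hd, i', j', f', hij', rfl⟩
        refine Subgroup.mem_comap.2 (Subgroup.subset_closure
          ⟨elm i j a0 * d, mul_mem (elm_mem_El (Set.mem_univ _) _ _) hd, i', j', f', hij', ?_⟩)
        simp only [MulEquiv.coe_toMonoidHom, MulAut.conj_apply]
        rw [(mapSL C).map_mul, map_elm]
        group
      exact Subgroup.mem_comap.1 (this hy)
    exact key _ ih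

/-- The substitution `X ↦ c X`. -/
noncomputable def scaleVar {R : Type*} [CommRing R] (c : R) : R[X] →+* R[X] :=
  eval₂RingHom C (C c * X)

@[simp] theorem scaleVar_X {R : Type*} [CommRing R] (c : R) : scaleVar c X = C c * X := by
  simp [scaleVar]

@[simp] theorem scaleVar_C {R : Type*} [CommRing R] (c r : R) : scaleVar c (C r) = C r := by
  simp [scaleVar]

theorem scaleVar_comp {R : Type*} [CommRing R] (c d : R) :
    (scaleVar c).comp (scaleVar d) = scaleVar (c * d) := by
  apply ringHom_ext'
  · ext r; simp
  · simp; ring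

theorem mapRingHom_comp_scaleVar {R S : Type*} [CommRing R] [CommRing S] (f : R →+* S) (c : R) :
    (mapRingHom f).comp (scaleVar c) = (scaleVar (f c)).comp (mapRingHom f) := by
  apply ringHom_ext'
  · ext r; simp
  · simp

theorem coeff_scaleVar {R : Type*} [CommRing R] (c : R) (p : R[X]) (n : ℕ) :
    (scaleVar c p).coeff n = c ^ n * p.coeff n := by
  induction p using Polynomial.induction_on' with
  | add p q hp hq => simp [hp, hq, mul_add]
  | monomial k a =>
    rw [← C_mul_X_pow_eq_monomial, map_mul, map_pow, scaleVar_C, scaleVar_X, mul_pow, ← C_pow,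
      ← mul_assoc, ← C_mul, coeff_C_mul_X_pow, coeff_C_mul_X_pow]
    split_ifs with h
    · rw [h, mul_comm]
    · simp

variable {R R' : Type*} [CommRing R] [CommRing R'] (f : R →+* R') (D : Submonoid R)

theorem exists_smul_mem_range_map (dens : ∀ x : R', ∃ s ∈ D, ∃ r, f s * x = f r) (p : R'[X]) :
    ∃ s ∈ D, C (f s) * p ∈ (mapRingHom f).range := by
  induction p using Polynomial.induction_on' with
  | add p q hp hq =>
    obtain ⟨s, hs, h⟩ := hp
    obtain ⟨s', hs', h'⟩ := hq
    refine ⟨s * s', D.mul_mem hs hs', ?_⟩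
    have : C (f (s * s')) * (p + q) =
      mapRingHom f (C s') * (C (f s) * p) + mapRingHom f (C s) * (C (f s') * q) := by
      simp; ring
    rw [this]
    exact add_mem (mul_mem ⟨_, rfl⟩ h) (mul_mem ⟨_, rfl⟩ h')
  | monomial k a =>
    obtain ⟨s, hs, r, h⟩ := dens a
    refine ⟨s, hs, monomial k r, ?_⟩
    simp [C_mul_monomial, h]

theorem exists_scaleVar_mem (hm : 3 ≤ m) (dens : ∀ x : R', ∃ s ∈ D, ∃ r, f s * x = f r)
    {x : SL m R'[X]} (hx : x ∈ vanishing m R') :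
    ∃ s ∈ D, mapSL (scaleVar (f s)) x ∈ El m ((mapRingHom f).range : Set R'[X]) := by
  set T := (mapRingHom f).range with hT
  have hmap : ∀ (x : SL m R'[X]) (t : R), x ∈ El m (T : Set R'[X]) →
      mapSL (scaleVar (f t)) x ∈ El m (T : Set R'[X]) := by
    intro x t hx
    have h : El m (T : Set R'[X]) ≤ (El m (T : Set R'[X])).comap (mapSL (scaleVar (f t))) := by
      refine El_le fun i j _ a ha => ?_
      obtain ⟨b, rfl⟩ := ha
      rw [Subgroup.mem_comap, map_elm]
      refine elm_mem_El (J := (T : Set R'[X])) ⟨scaleVar t b, ?_⟩ i j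
      exact congrArg (fun φ => φ b) (mapRingHom_comp_scaleVar f t)
    exact h hx
  unfold vanishing at hx
  induction hx using Subgroup.closure_induction with
  | mem x hx =>
    obtain ⟨d, hd, i, j, p, hij, rfl⟩ := hx
    obtain ⟨_, ⟨s, hs, rfl⟩, h⟩ := exists_conj_scaled hm (T := T)
      (D := D.map (C.comp f : R →+* R'[X]))
      (by rintro _ ⟨s, _, rfl⟩; exact ⟨C s, by simp⟩)
      (fun x => by
        obtain ⟨s, hs, h⟩ := exists_smul_mem_range_map f D dens x
        exact ⟨_, ⟨s, hs, rfl⟩, h⟩) (map_mem_El C hd) 1 (one_mem _)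
    rw [scaled_one] at h
    obtain ⟨s', hs', r, hr⟩ := exists_smul_mem_range_map f D dens p
    refine ⟨s * s', D.mul_mem hs hs', ?_⟩
    have e1 : mapSL (scaleVar (f (s * s'))) (mapSL C d) = (mapSL C d : SL m R'[X]) := by
      rw [mapSL_comp]
      congr 1
      ext r; simp
    rw [map_mul, map_mul, map_inv, e1, map_elm]
    refine h _ (elm_mem_El (J := scaled _ T) ?_ i j)
    refine ⟨mapRingHom f (X * scaleVar (s * s') r), ⟨_, rfl⟩, ?_⟩
    have e2 : mapRingHom f (scaleVar (s * s') r) =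
        C (f s') * scaleVar (f (s * s')) p := by
      have := congrArg (fun φ => φ r) (mapRingHom_comp_scaleVar f (s * s'))
      refine this.trans ?_
      rw [RingHom.comp_apply, hr, map_mul, scaleVar_C]
    rw [(mapRingHom f).map_mul, e2, (scaleVar (f (s * s'))).map_mul]
    simp
    ring
  | one => exact ⟨1, one_mem _, by simp [one_mem]⟩
  | mul x y _ _ hx hy =>
    obtain ⟨s, hs, h⟩ := hx
    obtain ⟨t, ht, h'⟩ := hy
    refine ⟨s * t, D.mul_mem hs ht, ?_⟩
    rw [map_mul]
    refine mul_mem ?_ ?_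
    · have := hmap _ t h
      rwa [mapSL_comp, scaleVar_comp, ← map_mul, mul_comm] at this
    · have := hmap _ s h'
      rwa [mapSL_comp, scaleVar_comp, ← map_mul] at this
  | inv x _ hx =>
    obtain ⟨s, hs, h⟩ := hx
    exact ⟨s, hs, by rw [map_inv]; exact inv_mem h⟩


theorem exists_smul_eq_zero {ι : Type*} [Finite ι] (torsion : ∀ x y : R, f x = f y → ∃ s ∈ D, s * x = s * y)
    (a b : ι → R) (h : ∀ i, f (a i) = f (b i)) : ∃ s ∈ D, ∀ i, s * a i = s * b i := by
  have := Fintype.ofFinite ι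
  choose s hs h using fun i => torsion _ _ (h i)
  refine ⟨∏ i, s i, D.prod_mem fun i _ => hs i, fun i => ?_⟩
  obtain ⟨c, hc⟩ := Finset.dvd_prod_of_mem s (Finset.mem_univ i)
  rw [hc, mul_right_comm, h, mul_right_comm]

theorem exists_scaleVar_eq (torsion : ∀ x y : R, f x = f y → ∃ s ∈ D, s * x = s * y)
    {p q : R[X]} (h0 : p.eval 0 = q.eval 0) (h : p.map f = q.map f) :
    ∃ s ∈ D, ∀ t, scaleVar (s * t) p = scaleVar (s * t) q := by
  obtain ⟨s, hs, H⟩ := exists_smul_eq_zero (ι := Fin (max p.natDegree q.natDegree + 1)) f D torsion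
    (fun i => p.coeff i) (fun i => q.coeff i) (fun i => by
      rw [← coeff_map, h, coeff_map])
  refine ⟨s, hs, fun t => ?_⟩
  ext n
  rw [coeff_scaleVar, coeff_scaleVar]
  rcases n with _ | n
  · simpa [coeff_zero_eq_eval_zero] using h0
  · by_cases hn : n + 1 < max p.natDegree q.natDegree + 1
    · have := H ⟨n + 1, hn⟩
      simp only at this
      rw [mul_pow, pow_succ s]
      linear_combination s ^ n * t ^ (n + 1) * this
    · rw [coeff_eq_zero_of_natDegree_lt, coeff_eq_zero_of_natDegree_lt]
      · have := le_max_right p.natDegree q.natDegree; omega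
      · have := le_max_left p.natDegree q.natDegree; omega

theorem exists_lift_of_mem_El_range {S S' : Type*} [CommRing S] [CommRing S'] (g : S →+* S')
    {x : SL m S'} (hx : x ∈ El m (g.range : Set S')) :
    ∃ y ∈ El m (Set.univ : Set S), mapSL g y = x := by
  have : (g.range : Set S') = g '' Set.univ := by simp
  rw [this, ← map_El] at hx
  exact hx

theorem exists_scaleVar_mem_of_map (hm : 3 ≤ m) (dens : ∀ x : R', ∃ s ∈ D, ∃ r, f s * x = f r)
    (torsion : ∀ x y : R, f x = f y → ∃ s ∈ D, s * x = s * y) {γ : SL m R[X]}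
    (h0 : mapSL (evalRingHom 0) γ = 1)
    (hγ : mapSL (mapRingHom f) γ ∈ El m (Set.univ : Set R'[X])) :
    ∃ s ∈ D, mapSL (scaleVar s) γ ∈ El m (Set.univ : Set R[X]) := by
  have hv := mul_inv_eval_mem_vanishing hγ
  have e0 : mapSL (evalRingHom 0) (mapSL (mapRingHom f) γ) = 1 := by
    have : (evalRingHom 0).comp (mapRingHom f) = f.comp (evalRingHom 0) := by
      apply ringHom_ext'
      · ext r; simp
      · simp
    rw [mapSL_comp, this, ← mapSL_comp, h0, map_one]
  rw [e0, map_one, inv_one, mul_one] at hv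
  obtain ⟨s, hs, h⟩ := exists_scaleVar_mem f D hm dens hv
  obtain ⟨ε, hε, he⟩ := exists_lift_of_mem_El_range _ h
  set η := ε * (mapSL C (mapSL (evalRingHom 0) ε))⁻¹ with hη
  have hηE : η ∈ El m (Set.univ : Set R[X]) :=
    mul_mem hε (inv_mem (map_mem_El _ (map_mem_El _ hε)))
  have hη0 : mapSL (evalRingHom 0) η = 1 := by
    have : (evalRingHom (0 : R)).comp C = RingHom.id R := by ext; simp
    rw [hη, map_mul, map_inv, mapSL_comp, this]
    exact mul_inv_cancel _
  have hs0 : mapSL (evalRingHom 0) (mapSL (scaleVar s) γ) = 1 := by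
    have : (evalRingHom 0).comp (scaleVar s) = evalRingHom 0 := by
      apply ringHom_ext'
      · ext r; simp
      · simp
    rw [mapSL_comp, this, h0]
  have e1 : mapSL (mapRingHom f) (mapSL (scaleVar s) γ) = mapSL (mapRingHom f) ε := by
    rw [he, mapSL_comp, mapSL_comp, mapRingHom_comp_scaleVar]
  have e2 : mapSL (mapRingHom f) η = mapSL (mapRingHom f) ε := by
    have h1 : (mapRingHom f).comp (C.comp (evalRingHom 0)) =
        (C.comp (evalRingHom 0)).comp (mapRingHom f) := by
      apply ringHom_ext'
      · ext r; simp
      · simp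
    have h2 : mapSL (mapRingHom f) (mapSL C (mapSL (evalRingHom 0) ε)) =
        mapSL C (mapSL (evalRingHom 0) (mapSL (mapRingHom f) (mapSL (scaleVar s) γ))) := by
      rw [e1]
      exact congrArg (fun φ => mapSL φ ε) h1
    have h3 : mapSL C (mapSL (evalRingHom 0) (mapSL (mapRingHom f) (mapSL (scaleVar s) γ))) =
        mapSL (mapRingHom f) (mapSL C (mapSL (evalRingHom 0) (mapSL (scaleVar s) γ))) :=
      congrArg (fun φ => mapSL φ (mapSL (scaleVar s) γ)) h1.symm
    rw [hη, map_mul, map_inv, h2, h3, hs0]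
    simp
  have key : ∀ i j, ∃ s' ∈ D, ∀ t, scaleVar (s' * t) ((mapSL (scaleVar s) γ).1 i j) =
      scaleVar (s' * t) (η.1 i j) := by
    intro i j
    refine exists_scaleVar_eq f D torsion ?_ ?_
    · have := congrArg (fun x : SL m R => x.1 i j) (hs0.trans hη0.symm)
      exact this
    · have := congrArg (fun x : SL m R'[X] => x.1 i j) (e1.trans e2.symm)
      exact this
  choose s' hs' H using key
  refine ⟨(∏ i, ∏ j, s' i j) * s, D.mul_mem (D.prod_mem fun i _ => D.prod_mem fun j _ => hs' i j) hs,
    ?_⟩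
  have e3 : mapSL (scaleVar ((∏ i, ∏ j, s' i j) * s)) γ =
      mapSL (scaleVar (∏ i, ∏ j, s' i j)) η := by
    rw [← scaleVar_comp, ← mapSL_comp]
    apply sl_ext
    ext1 i j
    rw [mapSL_apply, mapSL_apply]
    have : s' i j ∣ ∏ i, ∏ j, s' i j :=
      (Finset.dvd_prod_of_mem (s' i) (Finset.mem_univ j)).trans
        (Finset.dvd_prod_of_mem (fun i => ∏ j, s' i j) (Finset.mem_univ i))
    obtain ⟨t, ht⟩ := this
    rw [ht]
    exact H i j t
  rw [e3]
  exact map_mem_El _ hηE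

end LocalGlobal

section LocalGlobal

open Polynomial

variable {m : ℕ} {B : Type*} [CommRing B]

/-- The substitution `X ↦ t + c z` into the polynomial ring in `z` over `B[t]`. -/
noncomputable def shift (c : B) : B[X] →+* B[X][X] :=
  eval₂RingHom (C.comp C) (C X + C (C c) * X)

@[simp] theorem shift_X (c : B) : shift c X = C X + C (C c) * X := by simp [shift]

@[simp] theorem shift_C (c b : B) : shift c (C b) = C (C b) := by simp [shift]

theorem shift_zero : shift (0 : B) = C := by
  apply ringHom_ext'
  · refine RingHom.ext fun r => ?_; simp
  · simp

theorem eval₂_shift_comp_shift (c d : B) :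
    (eval₂RingHom (shift c) X).comp (shift d) = shift (c + d) := by
  apply ringHom_ext'
  · refine RingHom.ext fun r => ?_; simp
  · simp; ring

theorem eval₂_shift_comp_C (c : B) : (eval₂RingHom (shift c) X).comp C = shift c := by
  refine RingHom.ext fun p => ?_; simp

theorem scaleVar_comp_shift (c d : B) : (scaleVar (C c)).comp (shift d) = shift (c * d) := by
  apply ringHom_ext'
  · refine RingHom.ext fun r => ?_; simp
  · simp; ring

theorem scaleVar_comp_C {R : Type*} [CommRing R] (c : R) : (scaleVar c).comp C = C := by
  refine RingHom.ext fun r => ?_; simp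

/-- The scalars `c` such that `α(t + c z) α(t)⁻¹` is elementary. -/
noncomputable def quillenIdeal (α : SL m B[X]) : Ideal B where
  carrier := {c | mapSL (shift c) α * (mapSL C α)⁻¹ ∈ El m (Set.univ : Set B[X][X])}
  zero_mem' := by simp [shift_zero, one_mem]
  add_mem' := by
    intro c d hc hd
    simp only [Set.mem_ofPred_eq] at hc hd ⊢
    have h := map_mem_El (eval₂RingHom (shift c) X) hd
    rw [map_mul, map_inv, mapSL_comp, mapSL_comp, eval₂_shift_comp_shift, eval₂_shift_comp_C] at h
    have := mul_mem h hc
    rwa [mul_assoc, inv_mul_cancel_left] at this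
  smul_mem' := by
    intro b c hc
    simp only [Set.mem_ofPred_eq] at hc ⊢
    have h := map_mem_El (scaleVar (C b)) hc
    rwa [map_mul, map_inv, mapSL_comp, mapSL_comp, scaleVar_comp_shift, scaleVar_comp_C] at h

theorem mem_quillenIdeal {α : SL m B[X]} {c : B} : c ∈ quillenIdeal α ↔
    mapSL (shift c) α * (mapSL C α)⁻¹ ∈ El m (Set.univ : Set B[X][X]) := Iff.rfl

theorem exists_mem_quillenIdeal (hm : 3 ≤ m) (α : SL m B[X]) {B' : Type*} [CommRing B']
    (f : B →+* B') (D : Submonoid B) (dens : ∀ x : B', ∃ s ∈ D, ∃ r, f s * x = f r)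
    (torsion : ∀ x y : B, f x = f y → ∃ s ∈ D, s * x = s * y)
    (h : mapSL (mapRingHom f) α ∈ El m (Set.univ : Set B'[X])) :
    ∃ c ∈ D, c ∈ quillenIdeal α := by
  have h1 : ∀ c : B, (mapRingHom (mapRingHom f)).comp (shift c) =
      (shift (f c)).comp (mapRingHom f) := by
    intro c
    apply ringHom_ext'
    · refine RingHom.ext fun r => ?_; simp
    · simp
  have h2 : (mapRingHom (mapRingHom f)).comp C = C.comp (mapRingHom f) := by
    refine RingHom.ext fun r => ?_; simp
  have : ∃ s ∈ D.map (C : B →+* B[X]), mapSL (scaleVar s) (mapSL (shift 1) α * (mapSL C α)⁻¹) ∈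
      El m (Set.univ : Set B[X][X]) := by
    refine exists_scaleVar_mem_of_map (mapRingHom f) _ hm ?_ ?_ ?_ ?_
    · intro p
      obtain ⟨s, hs, q, hq⟩ := exists_smul_mem_range_map f D dens p
      exact ⟨C s, ⟨s, hs, rfl⟩, q, by rw [hq]; simp⟩
    · intro p q hpq
      obtain ⟨s, hs, H⟩ := exists_smul_eq_zero
        (ι := Fin (max p.natDegree q.natDegree + 1)) f D torsion
        (fun i => p.coeff i) (fun i => q.coeff i) (fun i => by
          have := congrArg (fun r => r.coeff i) hpq
          simpa using this)
      refine ⟨C s, ⟨s, hs, rfl⟩, ?_⟩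
      ext n
      rw [coeff_C_mul, coeff_C_mul]
      by_cases hn : n < max p.natDegree q.natDegree + 1
      · exact H ⟨n, hn⟩
      · rw [coeff_eq_zero_of_natDegree_lt, coeff_eq_zero_of_natDegree_lt]
        · have := le_max_right p.natDegree q.natDegree; omega
        · have := le_max_left p.natDegree q.natDegree; omega
    · have e1 : (evalRingHom 0).comp (shift 1) = RingHom.id B[X] := by
        apply ringHom_ext'
        · refine RingHom.ext fun r => ?_; simp
        · simp
      have e2 : (evalRingHom (0 : B[X])).comp C = RingHom.id B[X] := by
        refine RingHom.ext fun r => ?_; simp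
      rw [map_mul, map_inv, mapSL_comp, mapSL_comp, e1, e2]
      exact mul_inv_cancel _
    · rw [map_mul, map_inv, mapSL_comp, mapSL_comp, h1, h2, ← mapSL_comp, ← mapSL_comp]
      exact mul_mem (map_mem_El _ h) (inv_mem (map_mem_El _ h))
  obtain ⟨_, ⟨c, hc, rfl⟩, H⟩ := this
  refine ⟨c, hc, ?_⟩
  rw [mem_quillenIdeal]
  rwa [map_mul, map_inv, mapSL_comp, mapSL_comp, scaleVar_comp_shift, scaleVar_comp_C,
    mul_one] at H

/-- Quillen's local-global principle for elementary matrices. -/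
theorem mem_El_of_local (hm : 3 ≤ m) {α : SL m B[X]}
    (h0 : mapSL (evalRingHom 0) α ∈ El m (Set.univ : Set B))
    (hloc : ∀ (M : Ideal B) [M.IsMaximal],
      mapSL (mapRingHom (algebraMap B (Localization.AtPrime M))) α ∈
        El m (Set.univ : Set (Localization.AtPrime M)[X])) :
    α ∈ El m (Set.univ : Set B[X]) := by
  have top : quillenIdeal α = ⊤ := by
    by_contra hne
    obtain ⟨M, hM, hle⟩ := Ideal.exists_le_maximal _ hne
    have : ∃ c ∈ M.primeCompl, c ∈ quillenIdeal α := by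
      refine exists_mem_quillenIdeal hm α
        (algebraMap B (Localization.AtPrime M)) M.primeCompl ?_ ?_ (hloc M)
      · intro x
        obtain ⟨⟨r, s⟩, h⟩ := IsLocalization.surj M.primeCompl x
        exact ⟨s, s.2, r, by rw [← h, mul_comm]⟩
      · intro x y h
        obtain ⟨s, hs⟩ := IsLocalization.exists_of_eq (M := M.primeCompl) h
        exact ⟨s, s.2, hs⟩
    obtain ⟨c, hc, hcQ⟩ := this
    exact hc (hle hcQ)
  have h1 : (1 : B) ∈ quillenIdeal α := top ▸ Submodule.mem_top
  rw [mem_quillenIdeal] at h1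
  have h := map_mem_El (eval₂RingHom (C.comp (evalRingHom (0 : B))) X) h1
  have e1 : (eval₂RingHom (C.comp (evalRingHom (0 : B))) X).comp (shift 1) = RingHom.id B[X] := by
    apply ringHom_ext'
    · refine RingHom.ext fun r => ?_; simp
    · simp
  have e2 : (eval₂RingHom (C.comp (evalRingHom (0 : B))) X).comp C =
      (C.comp (evalRingHom (0 : B))) := by
    refine RingHom.ext fun p => ?_; simp
  rw [map_mul, map_inv, mapSL_comp, mapSL_comp, e1, e2, ← mapSL_comp] at h
  have := mul_mem h (map_mem_El C h0)
  rwa [inv_mul_cancel_right] at this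

end LocalGlobal

section Euclidean

variable {m : ℕ} {S : Type*} [CommRing S]

theorem diag_isUnit_of_upper {z : SL m S} (hz : ∀ i j, j < i → z.1 i j = 0) (i : Fin m) :
    ∃ v, v * z.1 i i = 1 := by
  have h := det_of_isUpperTriangular (M := z.1) (fun i j h => hz i j h)
  rw [z.2] at h
  obtain ⟨c, hc⟩ := Finset.dvd_prod_of_mem (fun i => z.1 i i) (Finset.mem_univ i)
  exact ⟨c, by rw [mul_comm, ← hc, ← h]⟩

theorem upper_mem {I : Ideal S} {N : Subgroup (SL m S)}
    (hN : ∀ i j, i ≠ j → ∀ a ∈ I, elm i j a ∈ N)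
    (hconj : ∀ i j, i ≠ j → ∀ x ∈ N, elm i j 1 * x * (elm i j 1)⁻¹ ∈ N)
    {y : SL m S} (hy : y ∈ principal m I) (ht : ∀ i j, j < i → y.1 i j = 0) : y ∈ N := by
  refine gauss (T := ⊤) (I := I) True (fun i j hij a _ ha => hN i j hij a ha) hconj
    (fun z _ hz i => ?_) ⟨mem_SLsub.2 fun _ _ => trivial, hy⟩ (fun _ => ht)
  obtain ⟨v, hv⟩ := diag_isUnit_of_upper (hz trivial) i
  exact ⟨v, trivial, hv⟩

theorem conj_elm_one_mem_El (i j : Fin m) (x : SL m S) (hx : x ∈ El m (Set.univ : Set S)) :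
    elm i j 1 * x * (elm i j 1)⁻¹ ∈ El m (Set.univ : Set S) :=
  have h : elm i j (1 : S) ∈ El m Set.univ := elm_mem_El (Set.mem_univ _) i j
  mul_mem (mul_mem h hx) (inv_mem h)

theorem upper_mem_El {y : SL m S} (ht : ∀ i j, j < i → y.1 i j = 0) :
    y ∈ El m (Set.univ : Set S) := by
  refine upper_mem (I := ⊤) (fun i j _ a _ => elm_mem_El (Set.mem_univ _) i j)
    (fun i j _ x hx => conj_elm_one_mem_El i j x hx) ?_ ht
  exact mem_principal.2 fun _ _ => Submodule.mem_top

variable {D : Type*} [EuclideanDomain D]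

theorem exists_clear_entry {k l : Fin m} (hkl : k ≠ l) (p : SL m D → Prop)
    (h1 : ∀ a g, p g → p (elm k l a * g)) (h2 : ∀ a g, p g → p (elm l k a * g)) (a : D) :
    ∀ g, g.1 l k = a → p g → ∃ e ∈ El m (Set.univ : Set D), p (e * g) ∧ (e * g).1 l k = 0 := by
  induction a using (EuclideanDomain.r_wellFounded (R := D)).induction with
  | _ a ih =>
  intro g hg hp
  by_cases ha : a = 0
  · exact ⟨1, one_mem _, by simpa using hp, by simpa [ha] using hg⟩
  set q := g.1 k k / a
  have hr := EuclideanDomain.remainder_lt (g.1 k k) ha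
  set e : SL m D := elm l k 1 * (elm k l (-1) * (elm l k 1 * elm k l (-q))) with he
  have heg : e * g = elm l k 1 * (elm k l (-1) * (elm l k 1 * (elm k l (-q) * g))) := by
    simp only [he, mul_assoc]
  have heE : e ∈ El m (Set.univ : Set D) := by
    refine mul_mem ?_ (mul_mem ?_ (mul_mem ?_ ?_)) <;> exact elm_mem_El (Set.mem_univ _) _ _
  have hpe : p (e * g) := by
    rw [heg]; exact h2 _ _ (h1 _ _ (h2 _ _ (h1 _ _ hp)))
  have hx : (e * g).1 l k = g.1 k k % a := by
    rw [heg, EuclideanDomain.mod_eq_sub_mul_div]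
    simp only [elm_mul_apply hkl, elm_mul_apply hkl.symm, if_true, hkl, hkl.symm, if_false, hg]
    ring
  obtain ⟨e', he', hp', h0⟩ := ih _ hr (e * g) hx hpe
  exact ⟨e' * e, mul_mem he' heE, by rwa [mul_assoc], by rwa [mul_assoc]⟩

theorem exists_mul_upper (g : SL m D) :
    ∃ e ∈ El m (Set.univ : Set D), ∀ i j, j < i → (e * g).1 i j = 0 := by
  let Z : ℕ → ℕ → SL m D → Prop := fun k l g => ∀ i j : Fin m, j < i →
    (j.1 < k ∨ j.1 = k ∧ i.1 < l) → g.1 i j = 0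
  have step : ∀ k l : ℕ, (∃ e ∈ El m (Set.univ : Set D), Z k l (e * g)) →
      ∃ e ∈ El m (Set.univ : Set D), Z k (l + 1) (e * g) := by
    rintro k l ⟨e, he, h⟩
    by_cases hlm : k < l ∧ l < m
    · obtain ⟨hkl, hl⟩ := hlm
      set k' : Fin m := ⟨k, hkl.trans hl⟩
      set l' : Fin m := ⟨l, hl⟩
      have hne : k' ≠ l' := fun h => hkl.ne (congrArg Fin.val h)
      obtain ⟨e', he', hZ, h0⟩ := exists_clear_entry hne (Z k l)
        (fun a g hg i j hij hj => by
          rw [elm_mul_apply hne, hg i j hij hj]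
          split_ifs with hi
          · subst hi
            have : j.1 < k := hij
            rw [hg l' j (lt_trans hij hkl) (Or.inl this)]; simp
          · simp)
        (fun a g hg i j hij hj => by
          rw [elm_mul_apply hne.symm, hg i j hij hj]
          split_ifs with hi
          · subst hi
            have : j.1 < k := by
              rcases hj with hj | ⟨_, hj⟩
              · exact hj
              · exact absurd hj (lt_irrefl _)
            rw [hg k' j this (Or.inl this)]; simp
          · simp) _ (e * g) rfl h
      refine ⟨e' * e, mul_mem he' he, ?_⟩
      rw [mul_assoc]
      intro i j hij hj
      by_cases hc : j.1 = k ∧ i.1 = l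
      · rw [show i = l' from Fin.ext hc.2, show j = k' from Fin.ext hc.1, h0]
      · exact hZ i j hij (by omega)
    · refine ⟨e, he, fun i j hij hj => h i j hij ?_⟩
      have := i.2
      have : j.1 < i.1 := hij
      omega
  have H : ∀ k, ∃ e ∈ El m (Set.univ : Set D), Z k 0 (e * g) := by
    intro k
    induction k with
    | zero => exact ⟨1, one_mem _, fun i j _ h => by omega⟩
    | succ k ih =>
      have : ∀ l, ∃ e ∈ El m (Set.univ : Set D), Z k l (e * g) := by
        intro l
        induction l with
        | zero => exact ih
        | succ l ihl => exact step k l ihl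
      obtain ⟨e, he, h⟩ := this m
      refine ⟨e, he, fun i j hij hj => h i j hij ?_⟩
      have := i.2
      omega
  obtain ⟨e, he, h⟩ := H m
  exact ⟨e, he, fun i j hij => h i j hij (Or.inl j.2)⟩

/-- Over a Euclidean domain every matrix of determinant one is elementary. -/
theorem mem_El_of_euclidean (g : SL m D) : g ∈ El m (Set.univ : Set D) := by
  obtain ⟨e, he, h⟩ := exists_mul_upper g
  have := mul_mem (inv_mem he) (upper_mem_El h)
  rwa [inv_mul_cancel_left] at this

end Euclidean

section Bruhat

variable {m : ℕ} {S : Type*} [CommRing S]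

/-- Upper unitriangular matrices. -/
def IsUni (u : SL m S) : Prop := ∀ i j, j ≤ i → u.1 i j = (1 : Matrix (Fin m) (Fin m) S) i j

/-- Monomial matrices with underlying permutation `σ`. -/
def IsMon (σ : Equiv.Perm (Fin m)) (n : SL m S) : Prop := ∀ i j, j ≠ σ i → n.1 i j = 0

theorem IsUni.one : IsUni (1 : SL m S) := fun _ _ _ => rfl

theorem IsUni.mul {u v : SL m S} (hu : IsUni u) (hv : IsUni v) : IsUni (u * v) := by
  intro i j hij
  rw [coe_mul, Matrix.mul_apply, Finset.sum_eq_single i]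
  · rw [hu i i le_rfl, hv i j hij]; simp
  · intro k _ hk
    rcases lt_or_ge i k with h | h
    · rw [hv k j (hij.trans h.le), one_apply_ne (hij.trans_lt h).ne', mul_zero]
    · rw [hu i k h, one_apply_ne hk.symm, zero_mul]
  · simp

theorem IsUni.elm {p q : Fin m} (h : p < q) (a : S) : IsUni (elm p q a) := by
  intro i j hij
  rw [coe_elm h.ne, Matrix.add_apply, single_apply, if_neg, add_zero]
  rintro ⟨rfl, rfl⟩
  exact absurd h (not_lt.2 hij)

theorem IsUni.mem_El {u : SL m S} (hu : IsUni u) : u ∈ El m (Set.univ : Set S) :=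
  upper_mem_El fun i j h => by rw [hu i j h.le, one_apply_ne h.ne.symm]

/-- Conjugation by a simple lower elementary matrix preserves the unitriangular matrices whose
corresponding simple upper entry vanishes. -/
theorem IsUni.conj {p q : Fin m} (hpq : p.1 + 1 = q.1) {u : SL m S} (hu : IsUni u)
    (h0 : u.1 p q = 0) (l : S) : IsUni (ElemGroup.elm q p l * u * ElemGroup.elm q p (-l)) := by
  have hlt : p < q := Fin.lt_def.2 (by omega)
  intro i j hij
  rw [mul_elm_apply hlt.ne', elm_mul_apply hlt.ne', elm_mul_apply hlt.ne', hu i j hij]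
  by_cases hj : j = p
  · subst hj
    by_cases hi : i = q
    · subst hi
      simp [hu j j le_rfl, h0, hu i i le_rfl]
    · rcases eq_or_lt_of_le hij with h | h
      · subst h; simp [hi, h0]
      · have : q < i := lt_of_le_of_ne (Fin.le_def.2 (by have : j.1 < i.1 := h; omega)) (Ne.symm hi)
        simp [hi, hu i q this.le]
  · by_cases hi : i = q
    · subst hi
      rcases eq_or_lt_of_le hij with h | h
      · subst h; simp [hj, h0]
      · have : j < p := lt_of_le_of_ne (Fin.le_def.2 (by have : j.1 < i.1 := h; omega)) hj
        simp [hj, hu p j this.le, this.ne']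
    · simp [hj, hi]

theorem IsMon.unit {σ : Equiv.Perm (Fin m)} {n : SL m S} (hn : IsMon σ n) (i : Fin m) :
    ∃ v, v * n.1 i (σ i) = 1 := by
  have h : (n.1 * (n⁻¹ : SL m S).1) i i = 1 := by
    rw [← coe_mul, mul_inv_cancel, coe_one, one_apply_eq]
  rw [Matrix.mul_apply, Finset.sum_eq_single (σ i)] at h
  · exact ⟨_, by rw [mul_comm]; exact h⟩
  · intro k _ hk
    rw [hn i k hk, zero_mul]
  · simp

theorem IsMon.elm_mul {σ : Equiv.Perm (Fin m)} {n : SL m S} (hn : IsMon σ n) {i j : Fin m}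
    (hij : i ≠ j) (a : S) : ∃ b, elm i j a * n = n * elm (σ i) (σ j) b := by
  obtain ⟨v, hv⟩ := hn.unit i
  refine ⟨v * a * n.1 j (σ j), sl_ext ?_⟩
  ext k l
  rw [elm_mul_apply hij, mul_elm_apply (σ.injective.ne hij)]
  congr 1
  by_cases hk : k = i
  · subst hk
    by_cases hl : l = σ j
    · subst hl
      rw [if_pos rfl, if_pos rfl]
      linear_combination (-a * n.1 j (σ j)) * hv
    · rw [if_pos rfl, if_neg hl, hn j l hl, mul_zero]
  · rw [if_neg hk, hn k (σ i) (fun h => hk (σ.injective h.symm)), zero_mul, ite_self]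

/-- The Weyl element with entries `-v`, `u` where `u v = 1`. -/
theorem weyl_mul_apply {p q : Fin m} (hpq : p ≠ q) {u v : S} (h : u * v = 1) (n : SL m S)
    (k l : Fin m) : (elm p q (-v) * elm q p u * elm p q (-v) * n).1 k l =
      if k = p then -v * n.1 q l else if k = q then u * n.1 p l else n.1 k l := by
  simp only [mul_assoc, elm_mul_apply hpq, elm_mul_apply hpq.symm]
  by_cases hp : k = p
  · subst hp
    simp [hpq, hpq.symm]
    linear_combination (v * n.1 q l - n.1 k l) * h
  · by_cases hq : k = q
    · subst hq; simp [hp]; linear_combination (-n.1 k l) * h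
    · simp [hp, hq]

theorem IsMon.weyl_mul {σ : Equiv.Perm (Fin m)} {n : SL m S} (hn : IsMon σ n) {p q : Fin m}
    (hpq : p ≠ q) {u v : S} (h : u * v = 1) :
    IsMon (σ * Equiv.swap p q) (elm p q (-v) * elm q p u * elm p q (-v) * n) := by
  intro i j hj
  rw [weyl_mul_apply hpq h]
  rw [Equiv.Perm.mul_apply] at hj
  split_ifs with h1 h2
  · subst h1
    rw [Equiv.swap_apply_left] at hj
    rw [hn _ _ hj, mul_zero]
  · subst h2
    rw [Equiv.swap_apply_right] at hj
    rw [hn _ _ hj, mul_zero]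
  · rw [Equiv.swap_apply_of_ne_of_ne h1 h2] at hj
    exact hn _ _ hj

/-- `elm q p l * elm p q a = elm p q (a e) * diag(e, d) * elm q p (l e)` for `d = 1 + l a`. -/
theorem IsMon.torus_mul {σ : Equiv.Perm (Fin m)} {n : SL m S} (hn : IsMon σ n) {p q : Fin m}
    (hpq : p ≠ q) {l a e : S} (h : e * (1 + l * a) = 1) :
    IsMon σ (elm p q (-(a * e)) * elm q p l * elm p q a * elm q p (-(l * e)) * n) := by
  intro i j hj
  simp only [mul_assoc, elm_mul_apply hpq, elm_mul_apply hpq.symm]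
  by_cases hp : i = p
  · subst hp
    simp [hpq, hpq.symm, hn i j hj]
    linear_combination (-a * n.1 q j) * h
  · by_cases hq : i = q
    · subst hq; simp [hp, hpq, hn i j hj]
      linear_combination (-l * n.1 p j) * h
    · simp [hp, hq, hn i j hj]


/-- The set of products of an upper unitriangular, a monomial, an upper unitriangular matrix and
an element of `M`. -/
def cells (M : Subgroup (SL m S)) : Set (SL m S) :=
  {x | ∃ u n u' y, ∃ σ, IsUni u ∧ IsMon σ n ∧ n ∈ El m (Set.univ : Set S) ∧ IsUni u' ∧ y ∈ M ∧
    x = u * (n * (u' * y))}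

theorem uni_mul_mem_cells {M : Subgroup (SL m S)} {u x : SL m S} (hu : IsUni u)
    (hx : x ∈ cells M) : u * x ∈ cells M := by
  obtain ⟨v, n, u', y, σ, hv, hn, hnE, hu', hy, rfl⟩ := hx
  exact ⟨u * v, n, u', y, σ, hu.mul hv, hn, hnE, hu', hy, by simp only [mul_assoc]⟩

variable {I : Ideal S} {M : Subgroup (SL m S)}

theorem elm_mul_absorb (hM : ∀ i j, i ≠ j → ∀ a ∈ I, elm i j a ∈ M)
    (hn : ∀ e ∈ El m (Set.univ : Set S), ∀ x ∈ M, e * x * e⁻¹ ∈ M) {c : S} (hc : c ∈ I)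
    {i j : Fin m} (hij : i ≠ j) {x y : SL m S} (hx : x ∈ El m (Set.univ : Set S)) (hy : y ∈ M) :
    ∃ y' ∈ M, elm i j c * (x * y) = x * y' := by
  refine ⟨x⁻¹ * elm i j c * x * y, mul_mem ?_ hy, by group⟩
  simpa using hn x⁻¹ (inv_mem hx) _ (hM i j hij c hc)

theorem lower_mul_mem_cells (hI : ∀ l : S, l ∈ I ∨ ∃ u v, u * v = 1 ∧ l - u ∈ I)
    (hM : ∀ i j, i ≠ j → ∀ a ∈ I, elm i j a ∈ M)
    (hn : ∀ e ∈ El m (Set.univ : Set S), ∀ x ∈ M, e * x * e⁻¹ ∈ M)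
    {p q : Fin m} (hpq : p.1 + 1 = q.1) (l : S) {x : SL m S} (hx : x ∈ cells M) :
    elm q p l * x ∈ cells M := by
  have hlt : p < q := Fin.lt_def.2 (by omega)
  have absorb : ∀ {c : S} (_ : c ∈ I) {i j : Fin m} (_ : i ≠ j) {x : SL m S} (_ : x ∈ cells M),
      elm i j c * x ∈ cells M := by
    rintro c hc i j hij _ ⟨v, n, u', y, σ, hv, hn', hnE, hu', hy, rfl⟩
    obtain ⟨y', hy', e⟩ := elm_mul_absorb hM hn hc hij
      (mul_mem hv.mem_El (mul_mem hnE hu'.mem_El)) hy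
    refine ⟨v, n, u', y', σ, hv, hn', hnE, hu', hy', ?_⟩
    simpa only [mul_assoc] using e
  have univ : ∀ i j (a : S), elm i j a ∈ El m (Set.univ : Set S) :=
    fun i j a => elm_mem_El (Set.mem_univ _) i j
  obtain ⟨u, n, u', y, σ, hu, hmon, hnE, hu', hy, rfl⟩ := hx
  have huu : IsUni (u * elm p q (-u.1 p q)) := hu.mul (IsUni.elm hlt _)
  have h0 : (u * elm p q (-u.1 p q)).1 p q = 0 := by
    rw [mul_elm_apply hlt.ne, if_pos rfl, hu p p le_rfl]; simp
  have hconj := huu.conj hpq h0 l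
  generalize u.1 p q = a at *
  suffices H : elm q p l * (elm p q a * (n * (u' * y))) ∈ cells M by
    have := uni_mul_mem_cells hconj H
    convert this using 1
    simp only [elm_neg]
    group
  clear h0 hconj huu hu
  rcases lt_or_gt_of_ne (σ.injective.ne hlt.ne) with hσ | hσ
  · obtain ⟨b, hb⟩ := hmon.elm_mul hlt.ne a
    rw [← mul_assoc (elm p q a), hb, mul_assoc, ← mul_assoc _ u']
    generalize hw : elm (σ p) (σ q) b * u' = w
    have hwu : IsUni w := hw ▸ (IsUni.elm hσ b).mul hu'
    have hX : n * (w * y) ∈ cells M :=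
      ⟨1, n, w, y, σ, IsUni.one, hmon, hnE, hwu, hy, by simp⟩
    rcases hI l with hl | ⟨r, v, hrv, hl⟩
    · exact absorb hl hlt.ne' hX
    · rw [← sub_add_cancel l r, elm_add, mul_assoc]
      refine absorb hl hlt.ne' ?_
      obtain ⟨b', hb'⟩ := hmon.elm_mul hlt.ne v
      refine ⟨elm p q v, _, elm (σ p) (σ q) b' * w, y, _, IsUni.elm hlt _,
        hmon.weyl_mul hlt.ne hrv, ?_, (IsUni.elm hσ b').mul hwu, hy, ?_⟩
      · exact mul_mem (mul_mem (mul_mem (univ _ _ _) (univ _ _ _)) (univ _ _ _)) hnE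
      · rw [mul_assoc (elm _ _ b'), mul_assoc _ n, ← mul_assoc n (elm _ _ b'), ← hb', elm_neg]
        group
  · have hX : ∀ l, elm q p l * (n * (u' * y)) ∈ cells M := by
      intro l
      obtain ⟨b, hb⟩ := hmon.elm_mul hlt.ne' l
      refine ⟨1, n, elm (σ q) (σ p) b * u', y, σ, IsUni.one, hmon, hnE,
        (IsUni.elm hσ b).mul hu', hy, ?_⟩
      rw [← mul_assoc, hb]
      group
    rcases hI a with ha | ⟨r, b, hrb, ha⟩
    · obtain ⟨y', hy', e⟩ := elm_mul_absorb hM hn ha hlt.ne (mul_mem hnE hu'.mem_El) hy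
      have e' : elm p q a * (n * (u' * y)) = n * (u' * y') := by
        simpa only [mul_assoc] using e
      obtain ⟨b, hb⟩ := hmon.elm_mul hlt.ne' l
      refine ⟨1, n, elm (σ q) (σ p) b * u', y', σ, IsUni.one, hmon, hnE,
        (IsUni.elm hσ b).mul hu', hy', ?_⟩
      rw [e', ← mul_assoc, hb]
      group
    · obtain ⟨y', hy', e⟩ := elm_mul_absorb hM hn ha hlt.ne (mul_mem hnE hu'.mem_El) hy
      have e' : elm p q a * (n * (u' * y)) = elm p q r * (n * (u' * y')) := by
        rw [← sub_add_cancel a r, add_comm, elm_add, mul_assoc]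
        congr 1
        simpa only [mul_assoc] using e
      rw [e']
      rcases hI (1 + l * r) with hd | ⟨d, e, hde, hd⟩
      · have : l = (1 + l * r) * b + -b := by linear_combination (-l) * hrb
        rw [this, elm_add, mul_assoc]
        refine absorb (I.mul_mem_right _ hd) hlt.ne' ?_
        refine ⟨elm p q (-r), _, u', y', _, IsUni.elm hlt _,
          hmon.weyl_mul hlt.ne (u := -b) (v := -r) (by linear_combination hrb), ?_, hu', hy', ?_⟩
        · exact mul_mem (mul_mem (mul_mem (univ _ _ _) (univ _ _ _)) (univ _ _ _)) hnE
        · rw [neg_neg]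
          simp only [elm_neg]
          group
      · have h2 : l - (d - 1) * b ∈ I := by
          have : l - (d - 1) * b = (1 + l * r - d) * b := by linear_combination (-l) * hrb
          rw [this]; exact I.mul_mem_right _ hd
        rw [← sub_add_cancel l ((d - 1) * b), elm_add, mul_assoc]
        refine absorb h2 hlt.ne' ?_
        generalize hl' : (d - 1) * b = l'
        have h3 : e * (1 + l' * r) = 1 := by
          rw [← hl']; linear_combination e * (d - 1) * hrb + hde
        obtain ⟨b', hb'⟩ := hmon.elm_mul hlt.ne' (l' * e)
        refine ⟨elm p q (r * e), _, elm (σ q) (σ p) b' * u', y', σ, IsUni.elm hlt _,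
          hmon.torus_mul hlt.ne h3, ?_, (IsUni.elm hσ b').mul hu', hy', ?_⟩
        · exact mul_mem (mul_mem (mul_mem (mul_mem (univ _ _ _) (univ _ _ _)) (univ _ _ _))
            (univ _ _ _)) hnE
        · rw [mul_assoc (elm _ _ b'), mul_assoc _ n, ← mul_assoc n (elm _ _ b'), ← hb', elm_neg, elm_neg]
          group

theorem lower_mul_mem_cells' (hI : ∀ l : S, l ∈ I ∨ ∃ u v, u * v = 1 ∧ l - u ∈ I)
    (hM : ∀ i j, i ≠ j → ∀ a ∈ I, elm i j a ∈ M)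
    (hn : ∀ e ∈ El m (Set.univ : Set S), ∀ x ∈ M, e * x * e⁻¹ ∈ M) (d : ℕ) :
    ∀ {p q : Fin m}, p.1 + 1 + d = q.1 → ∀ (l : S) {x : SL m S}, x ∈ cells M →
    elm q p l * x ∈ cells M := by
  induction d with
  | zero => exact fun hpq l _ hx => lower_mul_mem_cells hI hM hn hpq l hx
  | succ d ih =>
    intro p q hpq l x hx
    have := q.2
    set r : Fin m := ⟨p.1 + 1, by omega⟩ with hr
    have hqr : q ≠ r := Fin.ne_of_val_ne (by simp only [hr]; omega)
    have hrp : r ≠ p := Fin.ne_of_val_ne (by simp only [hr]; omega)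
    have hqp : q ≠ p := Fin.ne_of_val_ne (by omega)
    have := elm_commutator hqr hrp hqp l 1
    rw [mul_one] at this
    rw [this, ← elm_neg, ← elm_neg]
    simp only [mul_assoc]
    have h1 : ∀ l {x : SL m S}, x ∈ cells M → elm r p l * x ∈ cells M := fun l _ hx =>
      lower_mul_mem_cells hI hM hn rfl l hx
    have h2 : ∀ l {x : SL m S}, x ∈ cells M → elm q r l * x ∈ cells M := fun l _ hx =>
      ih (by simp only [hr]; omega) l hx
    exact h2 _ (h1 _ (h2 _ (h1 _ hx)))

theorem El_subset_cells (hI : ∀ l : S, l ∈ I ∨ ∃ u v, u * v = 1 ∧ l - u ∈ I)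
    (hM : ∀ i j, i ≠ j → ∀ a ∈ I, elm i j a ∈ M)
    (hn : ∀ e ∈ El m (Set.univ : Set S), ∀ x ∈ M, e * x * e⁻¹ ∈ M) {x : SL m S}
    (hx : x ∈ El m (Set.univ : Set S)) : x ∈ cells M := by
  refine El_induction (J := Set.univ) (p := fun x : SL m S => x ∈ cells M)
    (fun _ _ => Set.mem_univ _) ?_ ?_ hx
  · exact ⟨1, 1, 1, 1, 1, IsUni.one, fun i j h => one_apply_ne (by simpa using h.symm), one_mem _,
      IsUni.one, one_mem _, by simp⟩
  · intro i j hij a _ g _ hg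
    rcases lt_or_gt_of_ne hij with h | h
    · exact uni_mul_mem_cells (IsUni.elm h a) hg
    · exact lower_mul_mem_cells' hI hM hn (i.1 - j.1 - 1) (by have : j.1 < i.1 := h; omega) a hg

theorem perm_eq_one_of_le {σ : Equiv.Perm (Fin m)} (h : ∀ i, i ≤ σ i) : σ = 1 := by
  have h1 : ∑ i, (i : Fin m).1 = ∑ i, (σ i).1 := (Equiv.sum_comp σ fun i => i.1).symm
  have := (Finset.sum_eq_sum_iff_of_le (fun i _ => Fin.le_def.1 (h i))).1 h1
  ext i
  exact (this i (Finset.mem_univ i)).symm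

theorem upper_inv {z : SL m S} (hz : ∀ i j, j < i → z.1 i j = 0) :
    ∀ i j, j < i → (z⁻¹ : SL m S).1 i j = 0 := by
  have h1 : z.1 * (z⁻¹ : SL m S).1 = 1 := by rw [← coe_mul, mul_inv_cancel, coe_one]
  have h2 : (z⁻¹ : SL m S).1 * z.1 = 1 := by rw [← coe_mul, inv_mul_cancel, coe_one]
  have := invertibleOfRightInverse _ _ h1
  have e := inv_eq_right_inv h1
  have h := blockTriangular_inv_of_blockTriangular (M := z.1) (b := id) (fun i j h => hz i j h)
  rw [e] at h
  exact fun i j hij => h hij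

theorem upper_mul {z w : SL m S} (hz : ∀ i j, j < i → z.1 i j = 0)
    (hw : ∀ i j, j < i → w.1 i j = 0) : ∀ i j, j < i → (z * w).1 i j = 0 := by
  intro i j hij
  exact BlockTriangular.mul (M := z.1) (N := w.1) (b := id) (fun i j h => hz i j h)
    (fun i j h => hw i j h) hij

/-- If `S / I` is a field all of whose units lift, a subgroup of the congruence subgroup containing
`elm i j I` and normalized by `E(S)` contains all elementary matrices congruent to `1`. -/
theorem mem_of_mem_principal_of_mem_El (hI1 : (1 : S) ∉ I) (hI : ∀ l : S, l ∈ I ∨ ∃ u v, u * v = 1 ∧ l - u ∈ I)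
    (hMI : M ≤ principal m I)
    (hM : ∀ i j, i ≠ j → ∀ a ∈ I, elm i j a ∈ M)
    (hn : ∀ e ∈ El m (Set.univ : Set S), ∀ x ∈ M, e * x * e⁻¹ ∈ M) {x : SL m S}
    (hx : x ∈ El m (Set.univ : Set S)) (hxI : x ∈ principal m I) : x ∈ M := by
  obtain ⟨u, n, u', y, σ, hu, hmon, hnE, hu', hy, rfl⟩ := El_subset_cells hI hM hn hx
  have hz : u * (n * u') ∈ principal m I := by
    have := mul_mem hxI (inv_mem (hMI hy))
    convert this using 1
    group
  suffices u * (n * u') ∈ M by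
    have := mul_mem this hy
    simpa only [mul_assoc] using this
  have up : ∀ {u : SL m S}, IsUni u → ∀ i j, j < i → u.1 i j = 0 := fun hu i j h => by
    rw [hu i j h.le, one_apply_ne h.ne.symm]
  have hσ : σ = 1 := by
    refine perm_eq_one_of_le fun i => ?_
    by_contra hlt
    rw [not_le] at hlt
    have hw := upper_mul (upper_inv (up hu)) (upper_inv (up hu'))
    have hmem : n * (u⁻¹ * u'⁻¹)⁻¹ ∈ principal m I := by
      have := Subgroup.Normal.conj_mem (inferInstance : (principal m I).Normal) _ hz u⁻¹
      convert this using 1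
      group
    rw [principal, MonoidHom.mem_ker, map_mul, map_inv, mul_inv_eq_one] at hmem
    have h := congrArg (fun z : SL m (S ⧸ I) => z.1 i (σ i)) hmem
    simp only [mapSL_apply] at h
    rw [hw _ _ hlt, map_zero, Ideal.Quotient.eq_zero_iff_mem] at h
    obtain ⟨v, hv⟩ := hmon.unit i
    exact hI1 (hv ▸ I.mul_mem_left v h)
  subst hσ
  refine upper_mem (I := I) hM (fun i j _ x hx => hn _ (elm_mem_El (Set.mem_univ _) i j) _ hx) hz ?_
  exact upper_mul (up hu) (upper_mul (fun i j h => hmon i j h.ne) (up hu'))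

end Bruhat

section Torus

variable {m : ℕ} {S : Type*} [CommRing S]

/-- Conjugation by the diagonal matrix with entries `c`, whose inverse has entries `d`. -/
def torusConj (c d : Fin m → S) (h : ∀ i, c i * d i = 1) : SL m S →* SL m S where
  toFun x := ⟨diagonal c * x.1 * diagonal d, by
    rw [det_mul, det_mul, x.2, mul_one, ← det_mul, diagonal_mul_diagonal]
    simp [h]⟩
  map_one' := sl_ext (by simp [h])
  map_mul' x y := sl_ext (by
    have e : diagonal d * diagonal c = (1 : Matrix (Fin m) (Fin m) S) := by
      rw [diagonal_mul_diagonal]; simp [mul_comm, h]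
    change diagonal c * (x.1 * y.1) * diagonal d =
      diagonal c * x.1 * diagonal d * (diagonal c * y.1 * diagonal d)
    simp only [mul_assoc]
    rw [← mul_assoc (diagonal d) (diagonal c), e, one_mul])

theorem torusConj_apply (c d : Fin m → S) (h) (x : SL m S) (i j : Fin m) :
    (torusConj c d h x).1 i j = c i * x.1 i j * d j := by
  change (diagonal c * x.1 * diagonal d) i j = _
  simp

theorem torusConj_elm (c d : Fin m → S) (h) (i j : Fin m) (a : S) :
    torusConj c d h (elm i j a) = elm i j (c i * a * d j) := by
  by_cases hij : i = j
  · subst hij; simp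
  apply sl_ext
  ext k l
  rw [torusConj_apply, coe_elm hij, coe_elm hij, Matrix.add_apply, Matrix.add_apply,
    single_apply, single_apply, mul_add, add_mul]
  congr 1
  · by_cases hk : k = l
    · subst hk; simp [h]
    · simp [hk]
  · split_ifs with hk
    · rw [hk.1, hk.2]
    · simp

theorem torusConj_mem_principal {c d : Fin m → S} {h} {I : Ideal S} {x : SL m S}
    (hx : x ∈ principal m I) : torusConj c d h x ∈ principal m I := by
  rw [mem_principal] at hx ⊢
  intro i j
  have : (torusConj c d h x).1 i j - (1 : Matrix (Fin m) (Fin m) S) i j =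
      c i * (x.1 i j - (1 : Matrix (Fin m) (Fin m) S) i j) * d j := by
    rw [torusConj_apply]
    by_cases hk : i = j
    · subst hk; simp [mul_sub, sub_mul, h]
    · simp [hk]
  rw [this]
  exact I.mul_mem_right _ (I.mul_mem_left _ (hx i j))

/-- Conjugation by the diagonal matrix with entry `t` at `p` and `1` elsewhere. -/
def dil (t s : S) (h : t * s = 1) (p : Fin m) : SL m S →* SL m S :=
  torusConj (Function.update 1 p t) (Function.update 1 p s) fun i => by
    by_cases hi : i = p
    · subst hi; simpa using h
    · simp [hi]

theorem dil_apply (t s : S) (h) (p : Fin m) (x : SL m S) (i j : Fin m) :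
    (dil t s h p x).1 i j = (if i = p then t else 1) * x.1 i j * (if j = p then s else 1) := by
  rw [dil, torusConj_apply, Function.update_apply, Function.update_apply]
  rfl

theorem dil_elm (t s : S) (h) (p i j : Fin m) (a : S) :
    dil t s h p (elm i j a) = elm i j ((if i = p then t else 1) * a * (if j = p then s else 1)) := by
  rw [dil, torusConj_elm, Function.update_apply, Function.update_apply]
  rfl

theorem dil_dil (t s : S) (h) (h') (p : Fin m) (x : SL m S) :
    dil s t h' p (dil t s h p x) = x := by
  apply sl_ext
  ext i j
  rw [dil_apply, dil_apply]
  split_ifs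
  · linear_combination (x.1 i j * (t * s + 1)) * h
  · linear_combination (x.1 i j) * h
  · linear_combination (x.1 i j) * h
  · ring

/-- A set stable under all the conjugations `dil t s h p` is stable under their inverses. -/
theorem dil_symm_mem {t s : S} {h : t * s = 1} {h' : s * t = 1} {N : Set (SL m S)}
    (hN : ∀ p, ∀ x ∈ N, dil t s h p x ∈ N) (p : Fin m) {x : SL m S} (hx : x ∈ N) :
    dil s t h' p x ∈ N := by
  have key : ∀ F : Finset (Fin m), ∃ y ∈ N, ∀ i j, y.1 i j =
      (if i ∈ F then t else 1) * x.1 i j * (if j ∈ F then s else 1) := by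
    intro F
    induction F using Finset.induction_on with
    | empty => exact ⟨x, hx, by simp⟩
    | insert q F hq ih =>
      obtain ⟨y, hy, e⟩ := ih
      refine ⟨dil t s h q y, hN q y hy, fun i j => ?_⟩
      rw [dil_apply, e]
      by_cases hi : i = q <;> by_cases hj : j = q
      · subst hi hj; simp [hq]
      · subst hi; simp [hq, hj]; ring_nf
      · subst hj; simp [hq, hi]
      · simp [hi, hj]
  obtain ⟨y, hy, e⟩ := key (Finset.univ.filter (· ≠ p))
  convert hy using 1
  apply sl_ext
  ext i j
  rw [dil_apply, e]
  by_cases hi : i = p <;> by_cases hj : j = p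
  · simp [hi, hj]; linear_combination (x.1 p p) * h
  · simp [hi, hj]; ring
  · simp [hi, hj]; ring
  · simp [hi, hj]; linear_combination (-x.1 i j) * h

theorem elm_mul_elm_same {i j k : Fin m} (hij : i ≠ j) (hik : i ≠ k) (a b c : S)
    (h : (Pi.single j b + Pi.single k c) ⬝ᵥ (Pi.single i a) = 0) :
    rankOne (Pi.single i a) (Pi.single j b + Pi.single k c) h =
      elm i j (a * b) * elm i k (a * c) := by
  have aux : ∀ {j : Fin m} (_ : i ≠ j) (b : S) (h), rankOne (Pi.single i a) (Pi.single j b) h =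
      elm i j (a * b) := by
    intro j hij b h
    rw [elm_eq_rankOne hij]
    apply sl_ext
    rw [coe_rankOne, coe_rankOne]
    congr 1
    ext k l
    simp only [vecMulVec_apply, Pi.single_apply]
    split_ifs <;> simp
  rw [rankOne_add_right _ _ _ (by simp [hij.symm]) (by simp [hik.symm]), aux hij, aux hik]

theorem rankOne_mem_of_ne {N : Subgroup (SL m S)} {p : Fin m} {X : S}
    (h1 : ∀ k j, k ≠ j → j ≠ p → ∀ f, elm k j f ∈ N)
    (h2 : ∀ k, k ≠ p → ∀ f, elm k p (X * f) ∈ N) {q : Fin m} (hq : q ≠ p) {v w : Fin m → S}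
    (hv : v q = 1) (f : S) (h : w ⬝ᵥ v = 0) (h' : w ⬝ᵥ ((X * f) • v) = 0) :
    rankOne ((X * f) • v) w h' ∈ N := by
  have hc : col q v ∈ N := col_mem N q v fun k hk => h1 k q hk hq _
  have hr : row q ((X * f) • w) ∈ N := row_mem N q _ fun k hk => by
    by_cases hkp : k = p
    · subst hkp
      have := h2 q hq (f * w k)
      rwa [← mul_assoc] at this
    · exact h1 q k hk.symm hkp _
  have e : rankOne ((X * f) • v) w h' * col q v = col q v * row q ((X * f) • w) := by
    apply sl_ext
    ext i j
    rw [mul_col_apply, col_mul_apply]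
    have e1 : ∀ i j, (rankOne ((X * f) • v) w h').1 i j =
        (1 : Matrix (Fin m) (Fin m) S) i j + X * f * v i * w j := fun i j => by
      rw [coe_rankOne]; simp [vecMulVec_apply, mul_assoc]
    have e2 : ∀ i j, (row q ((X * f) • w)).1 i j =
        (1 : Matrix (Fin m) (Fin m) S) i j + if i = q then (if j = q then 0 else X * f * w j) else 0 :=
      fun i j => by
        rw [row, coe_rankOne, Matrix.add_apply, vecMulVec_apply, Function.update_apply,
          Pi.single_apply]
        split_ifs <;> simp
    have e3 : ∑ k, (rankOne ((X * f) • v) w h').1 i k * Function.update v q 0 k =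
        (if i = q then 0 else v i) + X * f * v i * (- w q) := by
      have : ∀ k, (rankOne ((X * f) • v) w h').1 i k * Function.update v q 0 k =
          (1 : Matrix (Fin m) (Fin m) S) i k * Function.update v q 0 k +
          X * f * v i * (w k * v k) - (if k = q then X * f * v i * w k * v k else 0) := fun k => by
        rw [e1, Function.update_apply]
        split_ifs <;> ring
      rw [Finset.sum_congr rfl fun k _ => this k, Finset.sum_sub_distrib, Finset.sum_add_distrib,
        ← Finset.mul_sum, Finset.sum_ite_eq' Finset.univ q, if_pos (Finset.mem_univ q), hv]
      have hw : ∑ k, w k * v k = 0 := h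
      rw [hw]
      simp only [one_apply, ite_mul, one_mul, zero_mul, Finset.sum_ite_eq, Finset.mem_univ, if_true]
      rw [Function.update_apply]
      ring
    rw [e3, e1, e2, e2]
    by_cases hi : i = q
    · subst hi
      rw [hv]
      by_cases hj : j = i
      · subst hj; simp
      · simp [hj, Ne.symm hj]
    · by_cases hj : j = q
      · subst hj
        simp [hi]
      · simp [hi, hj, Ne.symm hj]; ring
  rw [eq_mul_inv_of_mul_eq e]
  exact mul_mem (mul_mem hc hr) (inv_mem hc)

theorem rankOne_mem_of_eq (hm : 3 ≤ m) {N : Subgroup (SL m S)} {p : Fin m} {X : S}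
    (h1 : ∀ k j, k ≠ j → j ≠ p → ∀ f, elm k j f ∈ N)
    (h2 : ∀ k, k ≠ p → ∀ f, elm k p (X * f) ∈ N) {v w : Fin m → S}
    (hv : v p = 1) (f : S) (h : w ⬝ᵥ v = 0) (h' : w ⬝ᵥ ((X * f) • v) = 0) :
    rankOne ((X * f) • v) w h' ∈ N := by
  have hw : w = ∑ j ∈ Finset.univ.filter (· ≠ p), w j • (Pi.single j 1 - v j • Pi.single p 1) := by
    have e := sum_single_filter_ne p w
    have e' : ∑ j ∈ Finset.univ.filter (· ≠ p), w j * v j = - w p := by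
      have : ∑ j, w j * v j = 0 := h
      rw [← Finset.sum_filter_add_sum_filter_not _ (· ≠ p)] at this
      simp only [not_not, Finset.sum_filter (· = p), Finset.sum_ite_eq', Finset.mem_univ,
        if_true, hv] at this
      linear_combination this
    ext i
    simp only [smul_sub, Finset.sum_sub_distrib, Pi.sub_apply, Finset.sum_apply, Pi.smul_apply,
      smul_eq_mul, Pi.single_apply, mul_ite, mul_one, mul_zero]
    by_cases hi : i = p
    · subst hi
      simp only [if_true, e']
      rw [Finset.sum_eq_zero fun j hj => if_neg (Finset.mem_filter.1 hj).2.symm]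
      ring
    · simp [hi]
  have key : ∀ j ≠ p, ∀ h'', rankOne ((X * f) • v) (w j • (Pi.single j 1 - v j • Pi.single p 1)) h''
      ∈ N := by
    intro j hj h''
    obtain ⟨l, hlj, hlp⟩ := exists_third hm j p
    set u : Fin m → S := w j • (Pi.single j 1 - v j • Pi.single p 1) with hu
    have hu' : u = Pi.single j (w j) + Pi.single p (- (w j * v j)) := by
      rw [hu]
      ext i
      simp only [Pi.smul_apply, Pi.sub_apply, Pi.add_apply, Pi.single_apply, smul_eq_mul]
      split_ifs <;> ring
    have hul : u l = 0 := by simp [hu', hlj, hlp]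
    have huv : u ⬝ᵥ v = 0 := by
      rw [hu', add_dotProduct, single_dotProduct, single_dotProduct, hv]; ring
    have e1 : u ⬝ᵥ (v + Pi.single l (1 - v l)) = 0 := by
      rw [dotProduct_add, huv, dotProduct_single, hul]; ring
    have e1' : u ⬝ᵥ ((X * f) • (v + Pi.single l (1 - v l))) = 0 := by
      rw [dotProduct_smul, e1, smul_zero]
    have e2 : (Pi.single j (w j) + Pi.single p (- (w j * v j))) ⬝ᵥ
        (Pi.single l (X * (f * (v l - 1)))) = 0 := by
      rw [← hu', dotProduct_single, hul, zero_mul]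
    have a := rankOne_mem_of_ne h1 h2 hlp (by simp) f e1 e1'
    have b : elm l j (X * (f * (v l - 1)) * w j) * elm l p (X * (f * (v l - 1)) * - (w j * v j))
        ∈ N := mul_mem (h1 l j hlj hj _) (by rw [mul_assoc X]; exact h2 l hlp _)
    rw [← elm_mul_elm_same hlj hlp _ _ _ e2] at b
    have := mul_mem a b
    convert this using 1
    apply sl_ext
    rw [coe_mul, coe_rankOne, coe_rankOne, coe_rankOne, ← hu', add_mul, mul_add, mul_add]
    have z : vecMulVec ((X * f) • (v + Pi.single l (1 - v l))) u *
        vecMulVec (Pi.single l (X * (f * (v l - 1)))) u = 0 := by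
      rw [vecMulVec_mul_vecMulVec, dotProduct_single, hul]; simp
    rw [z, mul_one, one_mul, mul_one, add_zero, add_assoc, ← add_vecMulVec]
    congr 2
    ext i
    simp only [Pi.smul_apply, Pi.add_apply, Pi.single_apply, smul_eq_mul]
    split_ifs <;> ring
  have h0 : ∀ j ∈ Finset.univ.filter (· ≠ p),
      (w j • (Pi.single j 1 - v j • Pi.single p 1) : Fin m → S) ⬝ᵥ ((X * f) • v) = 0 := by
    intro j hj
    rw [smul_dotProduct, sub_dotProduct, smul_dotProduct, single_dotProduct, single_dotProduct]
    simp [hv]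
    ring
  have := rankOne_sum_right_mem N (Finset.univ.filter (· ≠ p)) ((X * f) • v) _ h0
    (fun j hj => key j (Finset.mem_filter.1 hj).2 _) (by rw [← hw]; exact h')
  convert this using 2

theorem rankOne_mem_of_isUnit (hm : 3 ≤ m) {N : Subgroup (SL m S)} {p : Fin m} {X : S}
    (h1 : ∀ k j, k ≠ j → j ≠ p → ∀ f, elm k j f ∈ N)
    (h2 : ∀ k, k ≠ p → ∀ f, elm k p (X * f) ∈ N) {v w : Fin m → S} {q : Fin m}
    (hv : IsUnit (v q)) (f : S) (h : w ⬝ᵥ v = 0) (h' : w ⬝ᵥ ((X * f) • v) = 0) :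
    rankOne ((X * f) • v) w h' ∈ N := by
  obtain ⟨c, hc⟩ := hv.exists_left_inv
  have hc' : (c • v) q = 1 := hc
  have e : w ⬝ᵥ (c • v) = 0 := by rw [dotProduct_smul, h, smul_zero]
  have e1 : (X * (f * v q)) • (c • v) = (X * f) • v := by
    rw [smul_smul]
    congr 1
    linear_combination (X * f) * hc
  have e' : w ⬝ᵥ ((X * (f * v q)) • (c • v)) = 0 := by rw [e1, h']
  have : rankOne ((X * (f * v q)) • (c • v)) w e' ∈ N := by
    by_cases hq : q = p
    · subst hq
      exact rankOne_mem_of_eq hm h1 h2 hc' _ e e'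
    · exact rankOne_mem_of_ne h1 h2 hq hc' _ e e'
  convert this using 2
  exact e1.symm

end Torus

section Frame

open Polynomial

variable {m : ℕ}

theorem conj_elm_mem {S : Type*} [CommRing S] (hm : 3 ≤ m) {N : Subgroup (SL m S)} {p : Fin m}
    {X : S} (h1 : ∀ k j, k ≠ j → j ≠ p → ∀ f, elm k j f ∈ N)
    (h2 : ∀ k, k ≠ p → ∀ f, elm k p (X * f) ∈ N) (D : SL m S) {q i j : Fin m} (hij : i ≠ j)
    (hD : IsUnit (D.1 q i)) (f : S) : D * elm i j (X * f) * D⁻¹ ∈ N := by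
  have e : D.1 *ᵥ Pi.single i (X * f) = (X * f) • (D.1 *ᵥ Pi.single i 1) := by
    ext k; simp [mul_comm]
  have h : (Pi.single j 1 ᵥ* (D⁻¹ : SL m S).1) ⬝ᵥ (D.1 *ᵥ Pi.single i 1) = 0 := by
    rw [← dotProduct_mulVec, mulVec_mulVec, ← coe_mul, inv_mul_cancel, coe_one, one_mulVec]
    simp [hij]
  have h' : (Pi.single j 1 ᵥ* (D⁻¹ : SL m S).1) ⬝ᵥ ((X * f) • (D.1 *ᵥ Pi.single i 1)) = 0 := by
    rw [dotProduct_smul, h, smul_zero]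
  have := rankOne_mem_of_isUnit hm h1 h2 (q := q) (by simpa using hD) f h h'
  rw [elm_eq_rankOne hij, conj_rankOne _ _ _ _ (by rw [e, h'])]
  convert this using 2

theorem exists_isUnit_entry {R : Type*} [CommRing R] [IsLocalRing R] (d : SL m R) (i : Fin m) :
    ∃ q, IsUnit (d.1 q i) := by
  by_contra! h
  have e : ((d⁻¹ * d : SL m R).1 i i) = 1 := by rw [inv_mul_cancel, coe_one, one_apply_eq]
  rw [coe_mul, Matrix.mul_apply] at e
  have : (1 : R) ∈ IsLocalRing.maximalIdeal R := by
    rw [← e]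
    exact Ideal.sum_mem _ fun q _ => Ideal.mul_mem_left _ _ (h q)
  exact (IsLocalRing.maximalIdeal R).ne_top_iff_one.1 (Ideal.IsPrime.ne_top') this

theorem row_add {S : Type*} [CommRing S] (p : Fin m) (v w : Fin m → S) :
    row p (v + w) = row p v * row p w := by
  rw [row, row, row, ← rankOne_add_right _ _ _ (by simp) (by simp) (by simp)]
  congr 1
  ext k
  simp only [Function.update_apply, Pi.add_apply]
  split_ifs <;> simp

/-- An extension `Λ` of `R[X]`, together with a subring `L` of elements without pole at infinity
and an ideal `I` lifting the maximal ideal of `R`, in which `X` is invertible. -/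
structure MonicFrame (R Λ : Type*) [CommRing R] [IsLocalRing R] [CommRing Λ] where
  π : R[X] →+* Λ
  s : Λ
  L : Subring Λ
  I : Ideal Λ
  X_mul_s : π X * s = 1
  s_mem : s ∈ L
  C_mem : ∀ r, π (C r) ∈ L
  exists_inv : ∀ x ∈ L, x ∈ I → ∃ v ∈ L, (1 + x) * v = 1
  decomp : ∀ x ∈ L, ∃ r, ∃ l ∈ L, x = π (C r) + s * l
  decomp_I : ∀ x ∈ L, x ∈ I → ∃ r ∈ IsLocalRing.maximalIdeal R, ∃ l ∈ L, l ∈ I ∧ x = π (C r) + s * l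
  pow_mul_mem : ∀ x, ∃ n : ℕ, s ^ n * x ∈ L
  eq_C : ∀ p, π p ∈ L → ∃ r, p = C r
  coeff_mem : ∀ p, π p ∈ I → ∀ n, p.coeff n ∈ IsLocalRing.maximalIdeal R
  C_mem_I : ∀ r ∈ IsLocalRing.maximalIdeal R, π (C r) ∈ I
  one_notMem : (1 : Λ) ∉ I
  mem_or_unit : ∀ l, l ∈ I ∨ ∃ u v, u * v = 1 ∧ l - u ∈ I

namespace MonicFrame

variable {R Λ : Type*} [CommRing R] [IsLocalRing R] [CommRing Λ] (F : MonicFrame R Λ)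

theorem s_mul_X : F.s * F.π X = 1 := by rw [mul_comm, F.X_mul_s]

/-- The elementary group of the image of `R[X]`. -/
def EP (m : ℕ) : Subgroup (SL m Λ) := El m (F.π.range : Set Λ)

def A (m : ℕ) : Subgroup (SL m Λ) := F.EP m ⊓ principal m F.I

def Y (m : ℕ) : Subgroup (SL m Λ) := SLsub m F.L ⊓ principal m F.I

/-- The products of an elementary matrix over `R[X]` and a matrix over `L`, both congruent
to `1`. -/
def M (m : ℕ) : Set (SL m Λ) := {x | ∃ a ∈ F.A m, ∃ y ∈ F.Y m, x = a * y}

/-- Conjugation by the diagonal matrix with entry `X` at `p`. -/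
noncomputable def σ (p : Fin m) : SL m Λ →* SL m Λ := dil (F.π X) F.s F.X_mul_s p

/-- Conjugation by the diagonal matrix with entry `X⁻¹` at `p`. -/
noncomputable def σ' (p : Fin m) : SL m Λ →* SL m Λ := dil F.s (F.π X) F.s_mul_X p

theorem σ'_σ (p : Fin m) (x : SL m Λ) : F.σ' p (F.σ p x) = x := dil_dil _ _ _ _ p x

theorem σ_σ' (p : Fin m) (x : SL m Λ) : F.σ p (F.σ' p x) = x := dil_dil _ _ _ _ p x

theorem π_mem_EP (i j : Fin m) (f : R[X]) : elm i j (F.π f) ∈ F.EP m :=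
  elm_mem_El (J := (F.π.range : Set Λ)) ⟨f, rfl⟩ i j

theorem map_mem_EP {x : SL m R[X]} (hx : x ∈ El m (Set.univ : Set R[X])) :
    mapSL F.π x ∈ F.EP m := by
  rw [EP, RingHom.coe_range, ← Set.image_univ, ← map_El]
  exact Subgroup.mem_map_of_mem _ hx

theorem σ_elm_mem {p k j : Fin m} (hj : j ≠ p) (f : R[X]) : F.σ p (elm k j (F.π f)) ∈ F.EP m := by
  rw [σ, dil_elm, if_neg hj, mul_one]
  split_ifs
  · rw [← map_mul]; exact F.π_mem_EP _ _ _
  · rw [one_mul]; exact F.π_mem_EP _ _ _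

theorem σ_vanishing (hm : 3 ≤ m) (p : Fin m) {x : SL m R[X]} (hx : x ∈ vanishing m R) :
    F.σ p (mapSL F.π x) ∈ F.EP m := by
  have : vanishing m R ≤ (F.EP m).comap ((F.σ p).comp (mapSL F.π)) := by
    rw [vanishing, Subgroup.closure_le]
    rintro _ ⟨d, hd, i, j, f, hij, rfl⟩
    obtain ⟨q, hq⟩ := exists_isUnit_entry d i
    refine conj_elm_mem hm (p := p) (X := X) ?_ ?_ (mapSL C d) hij (q := q) ?_ f
    · intro k j hkj hj f
      rw [Subgroup.mem_comap, MonoidHom.comp_apply, map_elm]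
      exact F.σ_elm_mem hj f
    · intro k hk f
      rw [Subgroup.mem_comap, MonoidHom.comp_apply, map_elm, σ, dil_elm, if_neg hk, if_pos rfl,
        one_mul, map_mul]
      have : F.π X * F.π f * F.s = F.π f := by linear_combination F.π f * F.X_mul_s
      rw [this]
      exact F.π_mem_EP _ _ _
    · rw [mapSL_apply]; exact hq.map C
  exact this hx

theorem σ_principal (p : Fin m) {x : SL m Λ} (hx : x ∈ principal m F.I) :
    F.σ p x ∈ principal m F.I := by
  rw [σ, dil]
  exact torusConj_mem_principal hx

theorem elm_mem_Y {a : Λ} (ha : a ∈ F.L) (ha' : a ∈ F.I) (i j : Fin m) : elm i j a ∈ F.Y m :=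
  ⟨elm_mem_SLsub ha i j, elm_mem_principal ha' i j⟩

theorem σ_Y (p : Fin m) {y : SL m Λ} (hy : y ∈ F.Y m) :
    ∃ a ∈ F.A m, ∃ y' ∈ F.Y m, F.σ p y = a * y' := by
  have hz : y⁻¹ ∈ F.Y m := inv_mem hy
  set z := y⁻¹ with hzdef
  have hzL := mem_SLsub.1 hz.1
  have hx1 : z.1 p p - 1 ∈ F.I := sub_one_mem_of_mem_principal hz.2 p
  obtain ⟨v, hvL, hv⟩ := F.exists_inv (z.1 p p - 1) (sub_mem (hzL p p) (one_mem _)) hx1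
  rw [add_sub_cancel] at hv
  have hl : ∀ j, ∃ r ∈ IsLocalRing.maximalIdeal R, ∃ l ∈ F.L, l ∈ F.I ∧
      (j ≠ p → - v * z.1 p j = F.π (C r) + F.s * l) := by
    intro j
    by_cases hj : j = p
    · exact ⟨0, zero_mem _, 0, zero_mem _, zero_mem _, fun h => (h hj).elim⟩
    · have h1 : z.1 p j ∈ F.I := mem_of_mem_principal hz.2 (Ne.symm hj)
      obtain ⟨r, hr, l, hl, hl', e⟩ := F.decomp_I (- v * z.1 p j)
        (mul_mem (neg_mem hvL) (hzL p j)) (F.I.mul_mem_left _ h1)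
      exact ⟨r, hr, l, hl, hl', fun _ => e⟩
  choose r hr l hlL hlI e using hl
  set w := z * row p (fun j => F.π (C (r j)) + F.s * l j) with hw
  have hrow : row p (fun j => F.π (C (r j)) + F.s * l j) ∈ F.Y m :=
    row_mem _ p _ fun k _ => F.elm_mem_Y (add_mem (F.C_mem _) (mul_mem F.s_mem (hlL k)))
      (add_mem (F.C_mem_I _ (hr k)) (F.I.mul_mem_left _ (hlI k))) p k
  have hwY : w ∈ F.Y m := mul_mem hz hrow
  have hwp : ∀ j, j ≠ p → w.1 p j = 0 := by
    intro j hj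
    rw [hw, mul_row_apply, if_neg hj, ← e j hj]
    linear_combination (- z.1 p j) * hv
  have hσw : F.σ p w ∈ F.Y m := by
    refine ⟨mem_SLsub.2 fun i j => ?_, F.σ_principal p hwY.2⟩
    have := mem_SLsub.1 hwY.1 i j
    rw [σ, dil_apply]
    by_cases hi : i = p <;> by_cases hj : j = p
    · rw [if_pos hi, if_pos hj]
      have e1 : F.π X * w.1 i j * F.s = w.1 i j := by linear_combination (w.1 i j) * F.X_mul_s
      rwa [e1]
    · subst hi
      rw [hwp j hj]; simp
    · rw [if_neg hi, if_pos hj, one_mul]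
      exact mul_mem this F.s_mem
    · rwa [if_neg hi, if_neg hj, one_mul, mul_one]
  have hr1 : F.σ p (row p fun j => F.π (C (r j))) ∈ F.A m := by
    refine row_mem ((F.A m).comap (F.σ p)) p _ fun k hk => ?_
    rw [Subgroup.mem_comap]
    refine ⟨F.σ_elm_mem hk _, F.σ_principal p (elm_mem_principal (F.C_mem_I _ (hr k)) _ _)⟩
  have hr2 : F.σ p (row p fun j => F.s * l j) ∈ F.Y m := by
    refine row_mem ((F.Y m).comap (F.σ p)) p _ fun k hk => ?_
    rw [Subgroup.mem_comap, σ, dil_elm, if_pos rfl, if_neg hk, mul_one, ← mul_assoc, F.X_mul_s,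
      one_mul]
    exact F.elm_mem_Y (hlL k) (hlI k) p k
  refine ⟨_, hr1, _, mul_mem hr2 (inv_mem hσw), ?_⟩
  have : y = (row p fun j => F.π (C (r j))) * (row p fun j => F.s * l j) * w⁻¹ := by
    rw [← row_add, hw, _root_.mul_inv_rev, hzdef, inv_inv]
    symm
    exact mul_inv_cancel_left _ _
  rw [this, map_mul, map_mul, map_inv, mul_assoc]

theorem σ_A (hm : 3 ≤ m) (p : Fin m) {a : SL m Λ} (ha : a ∈ F.A m) :
    ∃ q, F.σ p q ∈ F.A m ∧ ∃ y ∈ F.Y m, a = q * y := by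
  obtain ⟨b, hb, hba⟩ := exists_lift_of_mem_El_range F.π ha.1
  set a0 := mapSL (evalRingHom (0 : R)) b with ha0
  have ha0E : a0 ∈ El m (Set.univ : Set R) := map_mem_El _ hb
  have hv := mul_inv_eval_mem_vanishing hb
  rw [← ha0] at hv
  have ha0m : a0 ∈ principal m (IsLocalRing.maximalIdeal R) := by
    rw [mem_principal]
    intro i j
    have h1 := mem_principal.1 ha.2 i j
    rw [← hba, mapSL_apply] at h1
    have h2 : F.π (b.1 i j) - (1 : Matrix (Fin m) (Fin m) Λ) i j =
        F.π (b.1 i j - (1 : Matrix (Fin m) (Fin m) R[X]) i j) := by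
      rw [map_sub, one_apply, one_apply, apply_ite F.π, map_one, map_zero]
    rw [h2] at h1
    have h3 := F.coeff_mem _ h1 0
    rw [ha0, mapSL_apply]
    convert h3 using 1
    rw [coeff_zero_eq_eval_zero, eval_sub, coe_evalRingHom, one_apply, one_apply]
    split_ifs <;> simp
  set z := a0⁻¹ with hz
  have hzE : z ∈ El m (Set.univ : Set R) := inv_mem ha0E
  have hzm : z ∈ principal m (IsLocalRing.maximalIdeal R) := inv_mem ha0m
  obtain ⟨v, hv'⟩ : ∃ v, z.1 p p * v = 1 := by
    have := sub_one_mem_of_mem_principal hzm p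
    have hu : IsUnit (z.1 p p) := by
      by_contra h
      have h1 := sub_mem ((IsLocalRing.mem_maximalIdeal _).2 h) this
      rw [sub_sub_cancel] at h1
      exact (IsLocalRing.maximalIdeal R).ne_top_iff_one.1 (Ideal.IsPrime.ne_top') h1
    exact hu.exists_right_inv
  set c := col p (fun i => - z.1 i p * v) with hc
  set u := row p (fun j => - v * z.1 p j) with hu
  set x := c * z * u with hx
  have hcE : c ∈ El m (Set.univ : Set R) :=
    col_mem _ _ _ fun k _ => elm_mem_El (Set.mem_univ _) _ _
  have huE : u ∈ El m (Set.univ : Set R) :=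
    row_mem _ _ _ fun k _ => elm_mem_El (Set.mem_univ _) _ _
  have hcz : ∀ i, i ≠ p → (c * z).1 i p = 0 := fun i hi => by
    rw [hc, col_mul_apply, if_neg hi]
    linear_combination (- z.1 i p) * hv'
  have hcp : ∀ j, (c * z).1 p j = z.1 p j := fun j => by
    rw [hc, col_mul_apply, if_pos rfl, add_zero]
  have hxc : ∀ i, i ≠ p → x.1 i p = 0 := fun i hi => by
    rw [hx, hu, mul_row_apply, if_pos rfl, add_zero, hcz i hi]
  have hxr : ∀ j, j ≠ p → x.1 p j = 0 := fun j hj => by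
    rw [hx, hu, mul_row_apply, if_neg hj, hcp, hcp]
    linear_combination (- z.1 p j) * hv'
  have hσx : F.σ p (mapSL (F.π.comp C) x) = mapSL (F.π.comp C) x := by
    apply sl_ext
    ext i j
    rw [σ, dil_apply, mapSL_apply]
    by_cases hi : i = p <;> by_cases hj : j = p
    · rw [if_pos hi, if_pos hj]
      linear_combination ((F.π.comp C) (x.1 i j)) * F.X_mul_s
    · subst hi
      rw [hxr j hj]; simp
    · subst hj
      rw [hxc i hi]; simp
    · simp [hi, hj]
  have hE : ∀ {d : SL m R}, d ∈ El m (Set.univ : Set R) → mapSL (F.π.comp C) d ∈ F.EP m := by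
    intro d hd
    rw [← mapSL_comp]
    exact F.map_mem_EP (map_mem_El _ hd)
  have hy : mapSL (F.π.comp C) c ∈ F.Y m := by
    refine col_mem ((F.Y m).comap (mapSL (F.π.comp C))) p _ fun k hk => ?_
    rw [Subgroup.mem_comap, map_elm]
    refine F.elm_mem_Y (F.C_mem _) (F.C_mem_I _ ?_) _ _
    exact Ideal.mul_mem_right _ _ (neg_mem (mem_of_mem_principal hzm hk))
  have ha0' : a0 = u * x⁻¹ * c := by
    rw [hx, hz]; group
  have e : a = mapSL F.π (b * (mapSL C a0)⁻¹) * mapSL (F.π.comp C) u *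
      (mapSL (F.π.comp C) x)⁻¹ * mapSL (F.π.comp C) c := by
    have e1 : mapSL (F.π.comp C) a0 = mapSL (F.π.comp C) u * (mapSL (F.π.comp C) x)⁻¹ *
        mapSL (F.π.comp C) c := by rw [ha0', map_mul, map_mul, map_inv]
    rw [mul_assoc _ (mapSL (F.π.comp C) u), mul_assoc _ (mapSL (F.π.comp C) u * _), ← e1,
      ← mapSL_comp C F.π, ← map_mul, inv_mul_cancel_right, hba]
  refine ⟨_, Subgroup.mem_inf.2 ⟨?_, ?_⟩, _, hy, e⟩
  · rw [map_mul, map_mul, map_inv, hσx]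
    refine mul_mem (mul_mem (F.σ_vanishing hm p hv) ?_) (inv_mem (hE ?_))
    · refine row_mem ((F.EP m).comap ((F.σ p).comp (mapSL (F.π.comp C)))) p _ fun k hk => ?_
      rw [Subgroup.mem_comap, MonoidHom.comp_apply, map_elm]
      exact F.σ_elm_mem hk _
    · exact mul_mem (mul_mem hcE hzE) huE
  · refine F.σ_principal p ?_
    have := mul_mem (show _ ∈ principal m F.I from ha.2) (inv_mem (show _ ∈ principal m F.I from hy.2))
    rw [e] at this
    rwa [mul_inv_cancel_right] at this

theorem σ_M (hm : 3 ≤ m) (p : Fin m) {x : SL m Λ} (hx : x ∈ F.M m) : F.σ p x ∈ F.M m := by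
  obtain ⟨a, ha, y, hy, rfl⟩ := hx
  obtain ⟨q, hq, y1, hy1, rfl⟩ := F.σ_A hm p ha
  obtain ⟨a', ha', y', hy', e⟩ := F.σ_Y p (mul_mem hy1 hy)
  exact ⟨F.σ p q * a', mul_mem hq ha', y', hy', by rw [mul_assoc q, map_mul, e, mul_assoc]⟩

theorem σ'_M (hm : 3 ≤ m) (p : Fin m) {x : SL m Λ} (hx : x ∈ F.M m) : F.σ' p x ∈ F.M m :=
  dil_symm_mem (fun p _ hx => F.σ_M hm p hx) p hx

theorem mem_A {x : SL m Λ} : x ∈ F.A m ↔ x ∈ F.EP m ∧ x ∈ principal m F.I := Iff.rfl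

theorem mem_Y {x : SL m Λ} : x ∈ F.Y m ↔ x ∈ SLsub m F.L ∧ x ∈ principal m F.I := Iff.rfl

theorem σ_mem_M (hm : 3 ≤ m) (p : Fin m) {x : SL m Λ} : F.σ p x ∈ F.M m ↔ x ∈ F.M m :=
  ⟨fun h => by simpa only [σ'_σ] using F.σ'_M hm p h, F.σ_M hm p⟩

theorem σ'_mem_M (hm : 3 ≤ m) (p : Fin m) {x : SL m Λ} : F.σ' p x ∈ F.M m ↔ x ∈ F.M m :=
  ⟨fun h => by simpa only [σ_σ'] using F.σ_M hm p h, F.σ'_M hm p⟩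

theorem pow_mul_mem_of_le {x : Λ} {n n' : ℕ} (h : n ≤ n') (hx : F.s ^ n * x ∈ F.L) :
    F.s ^ n' * x ∈ F.L := by
  obtain ⟨d, rfl⟩ := Nat.exists_eq_add_of_le h
  rw [pow_add, mul_comm (F.s ^ n), mul_assoc]
  exact mul_mem (pow_mem F.s_mem _) hx

theorem exists_conj_mem_SLsub (b : SL m Λ) {i j : Fin m} (hij : i ≠ j) :
    ∃ N : ℕ, ∀ l ∈ F.L, b * elm i j (F.s ^ N * l) * b⁻¹ ∈ SLsub m F.L := by
  choose n hn using fun q : Fin m × Fin m => F.pow_mul_mem (b.1 q.1 i * (b⁻¹ : SL m Λ).1 j q.2)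
  refine ⟨Finset.univ.sup n, fun l hl => mem_SLsub.2 fun k k' => ?_⟩
  have h0 : (Pi.single j 1 ᵥ* (b⁻¹ : SL m Λ).1) ⬝ᵥ
      (b.1 *ᵥ Pi.single i (F.s ^ Finset.univ.sup n * l)) = 0 := by
    rw [← dotProduct_mulVec, mulVec_mulVec, ← coe_mul, inv_mul_cancel, coe_one, one_mulVec]
    simp [hij]
  rw [elm_eq_rankOne hij, conj_rankOne _ _ _ _ h0, coe_rankOne, Matrix.add_apply]
  have h1 := F.pow_mul_mem_of_le (Finset.le_sup (f := n) (Finset.mem_univ (k, k'))) (hn (k, k'))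
  refine add_mem ?_ ?_
  · rw [one_apply]
    split_ifs
    · exact one_mem _
    · exact zero_mem _
  · have : vecMulVec (b.1 *ᵥ Pi.single i (F.s ^ Finset.univ.sup n * l))
        (Pi.single j 1 ᵥ* (b⁻¹ : SL m Λ).1) k k' =
        F.s ^ Finset.univ.sup n * (b.1 k i * (b⁻¹ : SL m Λ).1 j k') * l := by
      simp [vecMulVec_apply]
      ring
    rw [this]
    exact mul_mem h1 hl

theorem exists_eq_mul_elm {G : Subgroup (SL m Λ)} (hσ : ∀ p, ∀ x ∈ G, F.σ p x ∈ G)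
    (hσ' : ∀ p, ∀ x ∈ G, F.σ' p x ∈ G) {i j : Fin m} (hij : i ≠ j) {T : Set Λ} {J : Set R}
    (dec : ∀ x ∈ T, ∃ r ∈ J, ∃ l ∈ T, x = F.π (C r) + F.s * l)
    (hG : ∀ r ∈ J, elm i j (F.π (C r)) ∈ G) {a : Λ} {n : ℕ} (ha : F.s ^ n * a ∈ T) (N : ℕ) :
    ∃ l ∈ T, ∃ g ∈ G, elm i j a = g * elm i j (F.s ^ N * l) := by
  have h1 : ∀ n : ℕ, ∀ a, elm i j a ∈ G → elm i j (F.s ^ n * a) ∈ G := by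
    intro n a ha
    induction n with
    | zero => simpa using ha
    | succ n ih =>
      have := hσ' i _ ih
      rwa [σ', dil_elm, if_pos rfl, if_neg hij.symm, mul_one, ← mul_assoc, ← pow_succ'] at this
  have h2 : ∀ n : ℕ, ∀ a, elm i j a ∈ G → elm i j (F.π X ^ n * a) ∈ G := by
    intro n a ha
    induction n with
    | zero => simpa using ha
    | succ n ih =>
      have := hσ i _ ih
      rwa [σ, dil_elm, if_pos rfl, if_neg hij.symm, mul_one, ← mul_assoc, ← pow_succ'] at this
  have h3 : ∀ x ∈ T, ∀ K : ℕ, ∃ l ∈ T, elm i j (x - F.s ^ K * l) ∈ G := by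
    intro x hx K
    induction K with
    | zero => exact ⟨x, hx, by simp [one_mem]⟩
    | succ K ih =>
      obtain ⟨l, hl, h⟩ := ih
      obtain ⟨r, hr, l', hl', rfl⟩ := dec l hl
      refine ⟨l', hl', ?_⟩
      have := mul_mem h (h1 K _ (hG r hr))
      rw [← elm_add] at this
      convert this using 2
      ring
  obtain ⟨l, hl, h⟩ := h3 _ ha (n + N)
  refine ⟨l, hl, _, h2 n _ h, ?_⟩
  rw [← elm_add]
  congr 1
  have e : F.π X ^ n * F.s ^ n = 1 := by rw [← mul_pow, F.X_mul_s, one_pow]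
  linear_combination (F.s ^ N * l - a) * e

/-- The left stabilizer of `M`. -/
def St (m : ℕ) : Subgroup (SL m Λ) where
  carrier := {g | ∀ x, x ∈ F.M m ↔ g * x ∈ F.M m}
  one_mem' x := by rw [one_mul]
  mul_mem' {a b} ha hb x := by rw [mul_assoc, ← ha, ← hb]
  inv_mem' {a} ha x := by rw [ha (a⁻¹ * x), mul_inv_cancel_left]

theorem mem_St_of_forall {G : Subgroup (SL m Λ)} (h : ∀ g ∈ G, ∀ x ∈ F.M m, g * x ∈ F.M m)
    {g : SL m Λ} (hg : g ∈ G) : g ∈ F.St m := fun x =>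
  ⟨h g hg x, fun hx => by simpa using h g⁻¹ (inv_mem hg) _ hx⟩

theorem A_le_St : F.A m ≤ F.St m := fun _ => F.mem_St_of_forall fun g hg x hx => by
  obtain ⟨a, ha, y, hy, rfl⟩ := hx
  exact ⟨g * a, mul_mem hg ha, y, hy, (mul_assoc _ _ _).symm⟩

theorem σ_St (hm : 3 ≤ m) (p : Fin m) {g : SL m Λ} (hg : g ∈ F.St m) : F.σ p g ∈ F.St m := fun x => by
  rw [← F.σ'_mem_M hm p, hg, ← F.σ_mem_M hm p, map_mul, σ_σ']

theorem σ'_St (hm : 3 ≤ m) (p : Fin m) {g : SL m Λ} (hg : g ∈ F.St m) : F.σ' p g ∈ F.St m :=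
  fun x => by rw [← F.σ_mem_M hm p, hg, ← F.σ'_mem_M hm p, map_mul, σ'_σ]

theorem elm_mem_St (hm : 3 ≤ m) {i j : Fin m} (hij : i ≠ j) {a : Λ} (ha : a ∈ F.I) :
    elm i j a ∈ F.St m := by
  have key : ∀ a ∈ F.I, ∀ x ∈ F.M m, elm i j a * x ∈ F.M m := by
    rintro a ha _ ⟨b, hb, y, hy, rfl⟩
    obtain ⟨N, hN⟩ := F.exists_conj_mem_SLsub b⁻¹ hij
    obtain ⟨n, hn⟩ := F.pow_mul_mem a
    obtain ⟨l, hl, g, hg, e⟩ := F.exists_eq_mul_elm (fun p _ => F.σ_St hm p)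
      (fun p _ => F.σ'_St hm p) hij (T := {x | x ∈ F.L ∧ x ∈ F.I})
      (J := (IsLocalRing.maximalIdeal R : Set R))
      (fun x hx => by
        obtain ⟨r, hr, l, hl, hl', e⟩ := F.decomp_I x hx.1 hx.2
        exact ⟨r, hr, l, ⟨hl, hl'⟩, e⟩)
      (fun r hr => F.A_le_St ⟨F.π_mem_EP _ _ _, elm_mem_principal (F.C_mem_I r hr) _ _⟩)
      (n := n) (a := a) ⟨hn, F.I.mul_mem_left _ ha⟩ N
    rw [e, mul_assoc, ← hg]
    refine ⟨b, hb, b⁻¹ * elm i j (F.s ^ N * l) * b⁻¹⁻¹ * y, mul_mem ⟨hN l hl.1, ?_⟩ hy, by group⟩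
    exact Subgroup.Normal.conj_mem inferInstance _
      (elm_mem_principal (F.I.mul_mem_left _ hl.2) _ _) _
  refine fun x => ⟨key a ha x, fun hx => ?_⟩
  have := key (-a) (neg_mem ha) _ hx
  rwa [elm_neg, inv_mul_cancel_left] at this

theorem conj_M {e x : SL m Λ} (he : e ∈ F.EP m) (heL : e ∈ SLsub m F.L) (hx : x ∈ F.M m) :
    e * x * e⁻¹ ∈ F.M m := by
  obtain ⟨a, ha, y, hy, rfl⟩ := hx
  rw [mem_A] at ha
  rw [mem_Y] at hy
  exact ⟨e * a * e⁻¹, F.mem_A.2 ⟨mul_mem (mul_mem he ha.1) (inv_mem he),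
      Subgroup.Normal.conj_mem inferInstance _ ha.2 _⟩,
    e * y * e⁻¹, F.mem_Y.2 ⟨mul_mem (mul_mem heL hy.1) (inv_mem heL),
      Subgroup.Normal.conj_mem inferInstance _ hy.2 _⟩, by group⟩

theorem conj_mem_M {e x : SL m Λ} (he : e ∈ F.EP m) (heL : e ∈ SLsub m F.L) :
    x ∈ F.M m ↔ e * x * e⁻¹ ∈ F.M m :=
  ⟨F.conj_M he heL, fun hx => by
    have := F.conj_M (inv_mem he) (inv_mem heL) hx
    convert this using 1
    group⟩

theorem elm_C_mem (i j : Fin m) (r : R) :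
    elm i j (F.π (C r)) ∈ F.EP m ∧ elm i j (F.π (C r)) ∈ SLsub m F.L :=
  ⟨F.π_mem_EP _ _ _, elm_mem_SLsub (F.C_mem r) _ _⟩

theorem Y_le_St (hm : 3 ≤ m) : F.Y m ≤ F.St m := by
  intro y hy
  refine gauss False (fun i j hij a _ ha => F.elm_mem_St hm hij ha) ?_ ?_ hy False.elim
  · intro i j hij x hx z
    have h1 := F.elm_C_mem i j 1
    rw [map_one, map_one] at h1
    rw [F.conj_mem_M (inv_mem h1.1) (inv_mem h1.2), hx, F.conj_mem_M h1.1 h1.2]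
    convert Iff.rfl using 2
    group
  · intro z hz _ i
    obtain ⟨v, hv, e⟩ := F.exists_inv (z.1 i i - 1) (sub_mem (mem_SLsub.1 hz.1 i i) (one_mem _))
      (sub_one_mem_of_mem_principal hz.2 i)
    exact ⟨v, hv, by linear_combination e⟩

theorem mem_St (hm : 3 ≤ m) {x : SL m Λ} : x ∈ F.St m ↔ x ∈ F.M m := by
  constructor
  · intro hx
    have := (hx 1).1 ⟨1, one_mem _, 1, one_mem _, by rw [mul_one]⟩
    rwa [mul_one] at this
  · rintro ⟨a, ha, y, hy, rfl⟩
    exact mul_mem (F.A_le_St ha) (F.Y_le_St hm hy)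

theorem St_le_principal (hm : 3 ≤ m) : F.St m ≤ principal m F.I := by
  intro x hx
  obtain ⟨a, ha, y, hy, rfl⟩ := (F.mem_St hm).1 hx
  exact mul_mem (show a ∈ principal m F.I from ha.2) hy.2

/-- The normalizer of `M`. -/
def Nrm (m : ℕ) : Subgroup (SL m Λ) where
  carrier := {g | ∀ x, x ∈ F.M m ↔ g * x * g⁻¹ ∈ F.M m}
  one_mem' x := by simp
  mul_mem' {a b} ha hb x := by
    rw [hb, ha]
    convert Iff.rfl using 2
    group
  inv_mem' {a} ha x := by
    rw [ha (a⁻¹ * x * a⁻¹⁻¹)]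
    convert Iff.rfl using 2
    group

theorem σ_Nrm (hm : 3 ≤ m) (p : Fin m) {g : SL m Λ} (hg : g ∈ F.Nrm m) : F.σ p g ∈ F.Nrm m :=
  fun x => by rw [← F.σ'_mem_M hm p, hg, ← F.σ_mem_M hm p, map_mul, map_mul, map_inv, σ_σ']

theorem σ'_Nrm (hm : 3 ≤ m) (p : Fin m) {g : SL m Λ} (hg : g ∈ F.Nrm m) : F.σ' p g ∈ F.Nrm m :=
  fun x => by rw [← F.σ_mem_M hm p, hg, ← F.σ'_mem_M hm p, map_mul, map_mul, map_inv, σ'_σ]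

theorem elm_mem_Nrm (hm : 3 ≤ m) {i j : Fin m} (hij : i ≠ j) (a : Λ) : elm i j a ∈ F.Nrm m := by
  have key : ∀ a, ∀ x ∈ F.M m, elm i j a * x * (elm i j a)⁻¹ ∈ F.M m := by
    rintro a _ ⟨b, hb, y, hy, rfl⟩
    obtain ⟨N, hN⟩ := F.exists_conj_mem_SLsub b⁻¹ hij
    obtain ⟨n, hn⟩ := F.pow_mul_mem a
    obtain ⟨l, hl, g, hg, e⟩ := F.exists_eq_mul_elm (fun p _ => F.σ_Nrm hm p)
      (fun p _ => F.σ'_Nrm hm p) hij (T := F.L) (J := Set.univ)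
      (fun x hx => by
        obtain ⟨r, l, hl, e⟩ := F.decomp x hx
        exact ⟨r, trivial, l, hl, e⟩)
      (fun r _ x => F.conj_mem_M (F.elm_C_mem i j r).1 (F.elm_C_mem i j r).2) hn N
    set u := elm i j (F.s ^ N * l) with hu
    have huL : u ∈ SLsub m F.L := elm_mem_SLsub (mul_mem (pow_mem F.s_mem _) hl) _ _
    have h1 : u * (b * y) * u⁻¹ ∈ F.M m := by
      refine ⟨b, hb, (b⁻¹ * u * b⁻¹⁻¹ * u⁻¹) * (u * y * u⁻¹), mul_mem (F.mem_Y.2 ⟨?_, ?_⟩) (F.mem_Y.2 ⟨?_, ?_⟩),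
        by group⟩
      · exact mul_mem (hN l hl) (inv_mem huL)
      · have hb2 : b⁻¹ ∈ principal m F.I := inv_mem (show b ∈ principal m F.I from hb.2)
        have := Subgroup.Normal.conj_mem inferInstance _ (inv_mem hb2) u
        have := mul_mem hb2 this
        convert this using 1
        group
      · exact mul_mem (mul_mem huL (F.mem_Y.1 hy).1) (inv_mem huL)
      · exact Subgroup.Normal.conj_mem inferInstance _ hy.2 _
    rw [hg] at h1
    rw [e]
    convert h1 using 1
    group
  refine fun x => ⟨key a x, fun hx => ?_⟩
  have := key (-a) _ hx
  rw [elm_neg] at this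
  convert this using 1
  group

theorem mem_M (hm : 3 ≤ m) {x : SL m Λ} (hx : x ∈ El m (Set.univ : Set Λ))
    (hxI : x ∈ principal m F.I) : x ∈ F.M m := by
  rw [← F.mem_St hm]
  refine mem_of_mem_principal_of_mem_El F.one_notMem F.mem_or_unit (F.St_le_principal hm)
    (fun i j hij a ha => F.elm_mem_St hm hij ha) ?_ hx hxI
  intro e he x hx
  have : El m (Set.univ : Set Λ) ≤ F.Nrm m := El_le fun i j hij a _ => F.elm_mem_Nrm hm hij a
  rw [F.mem_St hm] at hx ⊢
  exact (this he x).1 hx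

theorem mem_I_of_coeff_mem {p : R[X]} (h : ∀ n, p.coeff n ∈ IsLocalRing.maximalIdeal R) :
    F.π p ∈ F.I := by
  rw [p.as_sum_range_C_mul_X_pow, map_sum]
  refine Ideal.sum_mem _ fun n _ => ?_
  rw [map_mul]
  exact F.I.mul_mem_right _ (F.C_mem_I _ (h n))

theorem mem_El_of_map_mem (hm : 3 ≤ m) {α : SL m R[X]}
    (h : mapSL F.π α ∈ El m (Set.univ : Set Λ)) : α ∈ El m (Set.univ : Set R[X]) := by
  let q : R[X] →+* (IsLocalRing.ResidueField R)[X] := mapRingHom (IsLocalRing.residue R)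
  have hq : Function.Surjective q := map_surjective _ IsLocalRing.residue_surjective
  obtain ⟨β, hβ, e⟩ := exists_lift_of_mem_El_range q (x := mapSL q α) (by
    rw [RingHom.coe_range, hq.range_eq]
    exact mem_El_of_euclidean _)
  set γ := β⁻¹ * α with hγ
  suffices hγE : γ ∈ El m (Set.univ : Set R[X]) by
    have := mul_mem hβ hγE
    rwa [hγ, mul_inv_cancel_left] at this
  have hγ1 : mapSL q γ = 1 := by rw [hγ, map_mul, map_inv, e, inv_mul_cancel]
  have hπγ : mapSL F.π γ ∈ principal m F.I := by
    rw [mem_principal]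
    intro i j
    have h2 : (mapSL F.π γ).1 i j - (1 : Matrix (Fin m) (Fin m) Λ) i j =
        F.π (γ.1 i j - (1 : Matrix (Fin m) (Fin m) R[X]) i j) := by
      rw [mapSL_apply, map_sub, one_apply, one_apply, apply_ite F.π, map_one, map_zero]
    rw [h2]
    refine F.mem_I_of_coeff_mem fun n => ?_
    have h3 : q (γ.1 i j - (1 : Matrix (Fin m) (Fin m) R[X]) i j) = 0 := by
      have := mapSL_apply q γ i j
      rw [hγ1, coe_one] at this
      rw [map_sub, ← this, one_apply, one_apply, apply_ite q, map_one, map_zero, sub_self]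
    rw [← IsLocalRing.residue_eq_zero_iff, ← coeff_map]
    change (q _).coeff n = 0
    rw [h3, coeff_zero]
  have hπE : mapSL F.π γ ∈ El m (Set.univ : Set Λ) := by
    rw [hγ, map_mul, map_inv]
    exact mul_mem (inv_mem (map_mem_El _ hβ)) h
  obtain ⟨a, ha, y, hy, hay⟩ := F.mem_M hm hπE hπγ
  obtain ⟨b, hb, hba⟩ := exists_lift_of_mem_El_range F.π ha.1
  have hδ : mapSL F.π (b⁻¹ * γ) = y := by
    rw [map_mul, map_inv, hba, hay, inv_mul_cancel_left]
  set δ := b⁻¹ * γ with hδdef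
  have hC : ∀ i j, ∃ r, δ.1 i j = C r := fun i j => F.eq_C _ (by
    rw [← mapSL_apply, hδ]; exact mem_SLsub.1 hy.1 i j)
  have hδC : δ = mapSL C (mapSL (evalRingHom 0) δ) := by
    apply sl_ext
    ext1 i j
    obtain ⟨r, hr⟩ := hC i j
    rw [mapSL_apply, mapSL_apply, hr]
    simp
  have hδ0 : mapSL (evalRingHom 0) δ ∈ principal m (IsLocalRing.maximalIdeal R) := by
    rw [mem_principal]
    intro i j
    have h1 := mem_principal.1 hy.2 i j
    rw [← hδ, mapSL_apply] at h1
    have h2 : F.π (δ.1 i j) - (1 : Matrix (Fin m) (Fin m) Λ) i j =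
        F.π (δ.1 i j - (1 : Matrix (Fin m) (Fin m) R[X]) i j) := by
      rw [map_sub, one_apply, one_apply, apply_ite F.π, map_one, map_zero]
    rw [h2] at h1
    have h3 := F.coeff_mem _ h1 0
    rw [mapSL_apply]
    convert h3 using 1
    rw [coeff_zero_eq_eval_zero, eval_sub, coe_evalRingHom, one_apply, one_apply]
    split_ifs <;> simp
  have hδE : mapSL (evalRingHom 0) δ ∈ El m (Set.univ : Set R) := by
    refine gauss (T := ⊤) (I := IsLocalRing.maximalIdeal R) False
      (fun i j _ a _ _ => elm_mem_El (Set.mem_univ a) i j)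
      (fun i j _ x hx => conj_elm_one_mem_El i j x hx) ?_
      ⟨mem_SLsub.2 fun _ _ => trivial, hδ0⟩ False.elim
    intro z hz _ i
    have := sub_one_mem_of_mem_principal hz.2 i
    have hu : IsUnit (z.1 i i) := by
      by_contra h
      have h1 := sub_mem ((IsLocalRing.mem_maximalIdeal _).2 h) this
      rw [sub_sub_cancel] at h1
      exact (IsLocalRing.maximalIdeal R).ne_top_iff_one.1 (Ideal.IsPrime.ne_top') h1
    obtain ⟨v, hv⟩ := hu.exists_left_inv
    exact ⟨v, trivial, hv⟩
  have : b * δ ∈ El m (Set.univ : Set R[X]) := by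
    rw [hδC]
    exact mul_mem hb (map_mem_El _ hδE)
  rwa [hδdef, mul_inv_cancel_left] at this

end MonicFrame

end Frame

section Monics

open Polynomial

/-- The monic polynomials. -/
def monics (R : Type*) [CommRing R] : Submonoid R[X] where
  carrier := {p | p.Monic}
  one_mem' := monic_one
  mul_mem' hp hq := Monic.mul hp hq

variable (R : Type*) [CommRing R]

/-- The fractions of polynomials with monic denominator. -/
abbrev MonicLoc := Localization (monics R)

theorem algebraMap_monicLoc_injective : Function.Injective (algebraMap R[X] (MonicLoc R)) :=
  IsLocalization.injective _ (M := monics R) fun _ hp => Monic.mem_nonZeroDivisors hp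

variable {R}

theorem monicLoc_exists (x : MonicLoc R) : ∃ p q : R[X], q.Monic ∧
    x * algebraMap R[X] (MonicLoc R) q = algebraMap R[X] (MonicLoc R) p := by
  obtain ⟨⟨p, q⟩, h⟩ := IsLocalization.surj (monics R) x
  exact ⟨p, q, q.2, h⟩

theorem isUnit_algebraMap_monic {q : R[X]} (hq : q.Monic) :
    IsUnit (algebraMap R[X] (MonicLoc R) q) :=
  IsLocalization.map_units _ (⟨q, hq⟩ : monics R)

theorem monicLoc_cancel {q : R[X]} (hq : q.Monic) {x y : MonicLoc R}
    (h : x * algebraMap R[X] (MonicLoc R) q = y * algebraMap R[X] (MonicLoc R) q) : x = y :=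
  (isUnit_algebraMap_monic hq).mul_left_injective h

/-- The fractions without pole at infinity. -/
def finiteAtInfty (R : Type*) [CommRing R] : Subring (MonicLoc R) where
  carrier := {x | ∃ p q : R[X], q.Monic ∧ p.natDegree ≤ q.natDegree ∧
    x * algebraMap R[X] (MonicLoc R) q = algebraMap R[X] (MonicLoc R) p}
  zero_mem' := ⟨0, 1, monic_one, by simp, by simp⟩
  one_mem' := ⟨1, 1, monic_one, le_rfl, by simp⟩
  neg_mem' := by
    rintro x ⟨p, q, hq, hd, e⟩
    exact ⟨-p, q, hq, by rwa [natDegree_neg], by rw [map_neg, ← e]; ring⟩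
  add_mem' := by
    rintro x x' ⟨p, q, hq, hd, e⟩ ⟨p', q', hq', hd', e'⟩
    refine ⟨p * q' + p' * q, q * q', hq.mul hq', ?_, ?_⟩
    · rw [hq.natDegree_mul hq']
      refine natDegree_add_le_of_degree_le (natDegree_mul_le.trans (by omega))
        (natDegree_mul_le.trans (by omega))
    · simp only [map_add, map_mul, ← e, ← e']
      ring
  mul_mem' := by
    rintro x x' ⟨p, q, hq, hd, e⟩ ⟨p', q', hq', hd', e'⟩
    refine ⟨p * p', q * q', hq.mul hq', ?_, ?_⟩
    · rw [hq.natDegree_mul hq']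
      exact natDegree_mul_le.trans (by omega)
    · simp only [map_mul, ← e, ← e']
      ring

variable [IsLocalRing R]

theorem isUnit_residue (q : monics R) : IsUnit (((algebraMap (IsLocalRing.ResidueField R)[X]
    (FractionRing (IsLocalRing.ResidueField R)[X])).comp
    (mapRingHom (IsLocalRing.residue R))) q) := by
  rw [isUnit_iff_ne_zero, RingHom.comp_apply, Ne, FaithfulSMul.algebraMap_eq_zero_iff]
  exact (Monic.map _ q.2).ne_zero

/-- Reduction modulo the maximal ideal. -/
noncomputable def reduction (R : Type*) [CommRing R] [IsLocalRing R] :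
    MonicLoc R →+* FractionRing (IsLocalRing.ResidueField R)[X] :=
  IsLocalization.lift isUnit_residue

theorem reduction_algebraMap (p : R[X]) : reduction R (algebraMap R[X] (MonicLoc R) p) =
    algebraMap _ _ (p.map (IsLocalRing.residue R)) := IsLocalization.lift_eq _ p

theorem algebraMap_mem_ker {p : R[X]} : algebraMap R[X] (MonicLoc R) p ∈ RingHom.ker (reduction R) ↔
    ∀ n, p.coeff n ∈ IsLocalRing.maximalIdeal R := by
  rw [RingHom.mem_ker, reduction_algebraMap, FaithfulSMul.algebraMap_eq_zero_iff, Polynomial.ext_iff]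
  simp only [coeff_map, coeff_zero, IsLocalRing.residue_eq_zero_iff]

theorem exists_decomp {x : MonicLoc R} (hx : x ∈ finiteAtInfty R) :
    ∃ r : R, ∃ l ∈ finiteAtInfty R,
      x = algebraMap R[X] (MonicLoc R) (C r) + IsLocalization.mk' (MonicLoc R) 1
        (⟨X, monic_X⟩ : monics R) * l ∧
      (x ∈ RingHom.ker (reduction R) → r ∈ IsLocalRing.maximalIdeal R) := by
  obtain ⟨p, q, hq, hd, e⟩ := hx
  have hX : algebraMap R[X] (MonicLoc R) X *
      IsLocalization.mk' (MonicLoc R) 1 (⟨X, monic_X⟩ : monics R) = 1 := by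
    rw [mul_comm, IsLocalization.mk'_spec (MonicLoc R) 1 (⟨X, monic_X⟩ : monics R), map_one]
  set s := IsLocalization.mk' (MonicLoc R) 1 (⟨X, monic_X⟩ : monics R)
  set r := p.coeff q.natDegree with hr
  refine ⟨r, algebraMap R[X] (MonicLoc R) X * (x - algebraMap R[X] (MonicLoc R) (C r)),
    ⟨X * (p - C r * q), q, hq, ?_, ?_⟩, ?_, ?_⟩
  · rw [natDegree_le_iff_coeff_eq_zero]
    intro n hn
    obtain ⟨k, rfl⟩ := Nat.exists_eq_succ_of_ne_zero (by omega : n ≠ 0)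
    rw [coeff_X_mul, coeff_sub, coeff_C_mul]
    rcases Nat.lt_or_eq_of_le (Nat.lt_succ_iff.1 hn) with h | h
    · rw [coeff_eq_zero_of_natDegree_lt h, coeff_eq_zero_of_natDegree_lt (hd.trans_lt h)]
      simp
    · rw [← h, hq.coeff_natDegree, hr]
      simp
  · simp only [map_mul, map_sub, ← e]
    ring
  · linear_combination (algebraMap R[X] (MonicLoc R) (C r) - x) * hX
  · intro hx
    have : algebraMap R[X] (MonicLoc R) p ∈ RingHom.ker (reduction R) := by
      rw [← e]; exact Ideal.mul_mem_right _ _ hx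
    exact algebraMap_mem_ker.1 this _

theorem exists_inv_of_mem_finiteAtInfty {x : MonicLoc R} (hx : x ∈ finiteAtInfty R)
    (hxI : x ∈ RingHom.ker (reduction R)) : ∃ v ∈ finiteAtInfty R, (1 + x) * v = 1 := by
  obtain ⟨p, q, hq, hd, e⟩ := hx
  have h0 : algebraMap R[X] (MonicLoc R) p ∈ RingHom.ker (reduction R) := by
    rw [← e]; exact Ideal.mul_mem_right _ _ hxI
  have h1 := algebraMap_mem_ker.1 h0 q.natDegree
  have hu : IsUnit (1 + p.coeff q.natDegree) := by
    by_contra h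
    have := sub_mem ((IsLocalRing.mem_maximalIdeal _).2 h) h1
    rw [add_sub_cancel_right] at this
    exact (IsLocalRing.maximalIdeal R).ne_top_iff_one.1 (Ideal.IsPrime.ne_top') this
  obtain ⟨c, hc⟩ := hu.exists_left_inv
  have hle : (C c * (p + q)).natDegree ≤ q.natDegree :=
    (natDegree_C_mul_le _ _).trans (natDegree_add_le_of_degree_le hd le_rfl)
  have hco : (C c * (p + q)).coeff q.natDegree = 1 := by
    rw [coeff_C_mul, coeff_add, hq.coeff_natDegree, add_comm, hc]
  have hmon : (C c * (p + q)).Monic := monic_of_natDegree_le_of_coeff_eq_one _ hle hco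
  have hnt : Nontrivial R := inferInstance
  have hdeg : q.natDegree ≤ (C c * (p + q)).natDegree :=
    le_natDegree_of_ne_zero (by rw [hco]; exact one_ne_zero)
  set w := IsLocalization.mk' (MonicLoc R) (C c * q) (⟨_, hmon⟩ : monics R) with hw
  have hws : w * algebraMap R[X] (MonicLoc R) (C c * (p + q)) =
    algebraMap R[X] (MonicLoc R) (C c * q) :=
      IsLocalization.mk'_spec (MonicLoc R) (C c * q) (⟨_, hmon⟩ : monics R)
  refine ⟨w, ⟨C c * q, C c * (p + q), hmon, (natDegree_C_mul_le _ _).trans hdeg, hws⟩, ?_⟩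
  refine monicLoc_cancel hmon (monicLoc_cancel hq ?_)
  rw [mul_assoc (1 + x), hws]
  simp only [map_mul, map_add, ← e]
  ring

theorem mem_ker_reduction_or_isUnit (x : MonicLoc R) : x ∈ RingHom.ker (reduction R) ∨
    ∃ u v, u * v = 1 ∧ x - u ∈ RingHom.ker (reduction R) := by
  obtain ⟨p, q, hq, e⟩ := monicLoc_exists x
  by_cases h : p.map (IsLocalRing.residue R) = 0
  · left
    rw [RingHom.mem_ker]
    have h1 := congrArg (reduction R) e
    rw [map_mul, reduction_algebraMap p, h, map_zero] at h1
    exact (mul_eq_zero.1 h1).resolve_right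
      ((isUnit_algebraMap_monic hq).map (reduction R)).ne_zero
  · right
    set P := p.map (IsLocalRing.residue R) with hP
    obtain ⟨c, hc⟩ := IsLocalRing.residue_surjective P.leadingCoeff
    have hcu : IsUnit c := by
      by_contra hcn
      have := (IsLocalRing.residue_eq_zero_iff c).2 ((IsLocalRing.mem_maximalIdeal _).2 hcn)
      rw [hc, leadingCoeff_eq_zero] at this
      exact h this
    have hQ : (P * C P.leadingCoeff⁻¹).Monic := monic_mul_leadingCoeff_inv h
    obtain ⟨f, hf, -, hfm⟩ := lifts_and_natDegree_eq_and_monic (f := IsLocalRing.residue R)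
      (p := P * C P.leadingCoeff⁻¹) (by
        rw [mem_lifts]
        exact map_surjective _ IsLocalRing.residue_surjective _) hQ
    have hu : IsUnit (algebraMap R[X] (MonicLoc R) (C c * f)) := by
      rw [map_mul]
      exact ((hcu.map C).map _).mul (isUnit_algebraMap_monic hfm)
    obtain ⟨v, hv⟩ := hu.exists_right_inv
    obtain ⟨w, hw⟩ := (isUnit_algebraMap_monic hq).exists_right_inv
    refine ⟨algebraMap R[X] (MonicLoc R) (C c * f) * w, algebraMap R[X] (MonicLoc R) q * v, ?_, ?_⟩
    · linear_combination (algebraMap R[X] (MonicLoc R) q * w) * hv + hw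
    · have h2 : x - algebraMap R[X] (MonicLoc R) (C c * f) * w =
          algebraMap R[X] (MonicLoc R) (p - C c * f) * w := by
        rw [map_sub, ← e]
        linear_combination (-x) * hw
      rw [h2]
      refine Ideal.mul_mem_right _ _ ?_
      rw [RingHom.mem_ker, reduction_algebraMap, Polynomial.map_sub, Polynomial.map_mul, hf, map_C,
        hc, ← hP, mul_comm P, ← mul_assoc, ← C_mul, mul_inv_cancel₀, C_1, one_mul, sub_self,
        map_zero]
      exact leadingCoeff_ne_zero.2 h

/-- The frame given by the localization of `R[X]` at the monic polynomials. -/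
noncomputable def monicFrame (R : Type*) [CommRing R] [IsLocalRing R] :
    MonicFrame R (MonicLoc R) where
  π := algebraMap R[X] (MonicLoc R)
  s := IsLocalization.mk' (MonicLoc R) 1 (⟨X, monic_X⟩ : monics R)
  L := finiteAtInfty R
  I := RingHom.ker (reduction R)
  X_mul_s := by
    rw [mul_comm, IsLocalization.mk'_spec (MonicLoc R) 1 (⟨X, monic_X⟩ : monics R), map_one]
  s_mem := ⟨1, X, monic_X, by simp, by
    rw [IsLocalization.mk'_spec (MonicLoc R) 1 (⟨X, monic_X⟩ : monics R)]⟩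
  C_mem r := ⟨C r, 1, monic_one, by simp, by simp⟩
  exists_inv _ hx hxI := exists_inv_of_mem_finiteAtInfty hx hxI
  decomp x hx := by
    obtain ⟨r, l, hl, e, -⟩ := exists_decomp hx
    exact ⟨r, l, hl, e⟩
  decomp_I x hx hxI := by
    obtain ⟨r, l, hl, e, h⟩ := exists_decomp hx
    refine ⟨r, h hxI, l, hl, ?_, e⟩
    have h1 : l = algebraMap R[X] (MonicLoc R) X * (x - algebraMap R[X] (MonicLoc R) (C r)) := by
      have := IsLocalization.mk'_spec (MonicLoc R) 1 (⟨X, monic_X⟩ : monics R)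
      rw [map_one] at this
      rw [e]
      linear_combination (-l) * this
    rw [h1]
    refine Ideal.mul_mem_left _ _ (sub_mem hxI (algebraMap_mem_ker.2 fun n => ?_))
    rw [coeff_C]
    split_ifs
    · exact h hxI
    · exact zero_mem _
  pow_mul_mem x := by
    obtain ⟨p, q, hq, e⟩ := monicLoc_exists x
    refine ⟨p.natDegree, p, X ^ p.natDegree * q, (monic_X_pow _).mul hq, ?_, ?_⟩
    · rw [(monic_X_pow _).natDegree_mul hq, natDegree_X_pow]
      exact Nat.le_add_right _ _
    · have := IsLocalization.mk'_spec (MonicLoc R) 1 (⟨X, monic_X⟩ : monics R)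
      rw [map_one] at this
      have h1 := congrArg (· ^ p.natDegree) this
      simp only [mul_pow, one_pow] at h1
      rw [map_mul, map_pow, ← e]
      linear_combination (x * algebraMap R[X] (MonicLoc R) q) * h1
  eq_C p := by
    rintro ⟨p', q, hq, hd, e⟩
    rw [← map_mul] at e
    have e := algebraMap_monicLoc_injective R e
    by_cases hp : p = 0
    · exact ⟨0, by rw [hp, C_0]⟩
    · have h1 := hq.natDegree_mul' hp
      rw [mul_comm, e] at h1
      exact ⟨_, eq_C_of_natDegree_le_zero (by omega)⟩
  coeff_mem _ h := algebraMap_mem_ker.1 h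
  C_mem_I r hr := algebraMap_mem_ker.2 fun n => by
    rw [coeff_C]
    split_ifs
    · exact hr
    · exact zero_mem _
  one_notMem h := by
    rw [RingHom.mem_ker, map_one] at h
    exact one_ne_zero h
  mem_or_unit := mem_ker_reduction_or_isUnit

end Monics

section ZeroUnits

open Polynomial

variable {m : ℕ}

/-- The images in `B[X]` of the polynomials over `k` that do not vanish at `0`. -/
noncomputable def zeroUnits {k B : Type*} [Field k] [CommRing B] (κ : k →+* B) : Submonoid B[X] :=
  (Submonoid.comap (evalRingHom (0 : k)) (nonZeroDivisors k)).map (mapRingHom κ)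

theorem mem_zeroUnits {k B : Type*} [Field k] [CommRing B] {κ : k →+* B} {p : B[X]} :
    p ∈ zeroUnits κ ↔ ∃ f : k[X], f.eval 0 ≠ 0 ∧ f.map κ = p := by
  simp [zeroUnits]

theorem isUnit_map_of_ne_zero {k B S : Type*} [Field k] [CommRing B] [CommRing S] {κ : k →+* B}
    {g : B[X] →+* S} (hg : ∀ q : B[X], q.Monic → IsUnit (g q)) {f : k[X]} (hf : f ≠ 0) :
    IsUnit (g (f.map κ)) := by
  have hu : IsUnit (C f.leadingCoeff : k[X]) :=
    (isUnit_iff_ne_zero.2 (leadingCoeff_ne_zero.2 hf)).map C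
  have h1 : f = C f.leadingCoeff * (f * C f.leadingCoeff⁻¹) := by
    rw [mul_left_comm, ← C_mul, mul_inv_cancel₀ (leadingCoeff_ne_zero.2 hf), C_1, mul_one]
  rw [h1, Polynomial.map_mul, map_mul]
  exact ((hu.map (mapRingHom κ)).map g).mul
    (hg _ ((monic_mul_leadingCoeff_inv hf).map κ))

/-- A matrix over `B[X]` that becomes elementary after inverting the polynomials over `k` not
vanishing at `0` is elementary. -/
theorem mem_El_of_map_zeroUnits (hm : 3 ≤ m) {k B : Type*} [Field k] [CommRing B] (κ : k →+* B)
    {α : SL m B[X]}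
    (h : mapSL (algebraMap B[X] (Localization (zeroUnits κ))) α ∈
      El m (Set.univ : Set (Localization (zeroUnits κ)))) :
    α ∈ El m (Set.univ : Set B[X]) := by
  have lift {S : Type _} [CommRing S] (g : B[X] →+* S)
      (hg : ∀ y : zeroUnits κ, IsUnit (g y)) : mapSL g α ∈ El m (Set.univ : Set S) := by
    have := map_mem_El (IsLocalization.lift (S := Localization (zeroUnits κ)) hg) h
    rwa [mapSL_comp, IsLocalization.lift_comp] at this
  refine mem_El_of_local hm (lift _ ?_) fun M _ => ?_
  · rintro ⟨y, hy⟩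
    obtain ⟨f, hf, rfl⟩ := mem_zeroUnits.1 hy
    have : evalRingHom 0 (f.map κ) = κ (f.eval 0) := by
      simp [← coeff_zero_eq_eval_zero]
    simp only [this]
    exact (isUnit_iff_ne_zero.2 hf).map κ
  · refine (monicFrame (Localization.AtPrime M)).mem_El_of_map_mem hm ?_
    rw [mapSL_comp]
    refine lift _ ?_
    rintro ⟨y, hy⟩
    obtain ⟨f, hf, rfl⟩ := mem_zeroUnits.1 hy
    refine isUnit_map_of_ne_zero (fun q hq => ?_) (f := f) (by rintro rfl; simp at hf)
    exact isUnit_algebraMap_monic (hq.map _)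

end ZeroUnits

section Subrings

variable {m : ℕ} {Ω : Type*} [CommRing Ω]

/-- The elements of `Ω` that can be brought into `Λ` by a multiplier in `D`. -/
def fracSubring (Λ : Subring Ω) (D : Submonoid Ω) (hD : D ≤ Λ.toSubmonoid) : Subring Ω where
  carrier := {x | ∃ d ∈ D, d * x ∈ Λ}
  zero_mem' := ⟨1, one_mem _, by simp⟩
  one_mem' := ⟨1, one_mem _, by simp⟩
  neg_mem' := by
    rintro x ⟨d, hd, h⟩
    exact ⟨d, hd, by rw [mul_neg]; exact neg_mem h⟩
  add_mem' := by
    rintro x y ⟨d, hd, h⟩ ⟨d', hd', h'⟩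
    refine ⟨d * d', mul_mem hd hd', ?_⟩
    rw [show d * d' * (x + y) = d' * (d * x) + d * (d' * y) by ring]
    exact add_mem (mul_mem (hD hd') h) (mul_mem (hD hd) h')
  mul_mem' := by
    rintro x y ⟨d, hd, h⟩ ⟨d', hd', h'⟩
    refine ⟨d * d', mul_mem hd hd', ?_⟩
    rw [show d * d' * (x * y) = (d * x) * (d' * y) by ring]
    exact mul_mem h h'

theorem le_fracSubring {Λ : Subring Ω} {D : Submonoid Ω} (hD : D ≤ Λ.toSubmonoid) :
    Λ ≤ fracSubring Λ D hD := fun x hx => ⟨1, one_mem _, by rwa [one_mul]⟩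

theorem exists_mul_of_split_subring (hm : 3 ≤ m) {T₁ T₂ U : Subring Ω} {t : Ω} (hU : t ∈ U)
    (ht : t ∈ T₂) (dens : ∀ x ∈ U, ∃ n : ℕ, t ^ n * x ∈ T₂)
    (split : ∀ (M : ℕ), ∀ x ∈ U, ∃ y ∈ T₁, ∃ z ∈ T₂, z ∈ U ∧ y ∈ U ∧ x = y + t ^ M * z)
    {g : SL m Ω} (hg : g ∈ El m (U : Set Ω)) :
    ∃ a ∈ El m (T₁ : Set Ω), ∃ b ∈ El m (T₂ : Set Ω), g = a * b := by
  obtain ⟨h, hh, rfl⟩ := exists_lift_of_mem_El_range U.subtype (by simpa using hg)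
  have : ∃ a ∈ El m (T₁.comap U.subtype : Set U), ∃ b ∈ El m (T₂.comap U.subtype : Set U),
      h = a * b := by
    refine exists_mul_of_split (S := U) (T₁ := T₁.comap U.subtype) (T₂ := T₂.comap U.subtype)
      (X := ⟨t, hU⟩) hm ht (fun x => dens x x.2) (fun M x => ?_) hh
    obtain ⟨y, hy, z, hz, hzU, hyU, e⟩ := split M x x.2
    exact ⟨⟨y, hyU⟩, hy, ⟨z, hzU⟩, hz, Subtype.ext e⟩
  obtain ⟨a, ha, b, hb, rfl⟩ := this
  have key (T : Subring Ω) {a : SL m U} (ha : a ∈ El m (T.comap U.subtype : Set U)) :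
      mapSL U.subtype a ∈ El m (T : Set Ω) := by
    have : mapSL U.subtype a ∈ (El m (T.comap U.subtype : Set U)).map (mapSL U.subtype) :=
      ⟨a, ha, rfl⟩
    rw [map_El] at this
    refine El_mono ?_ this
    rintro _ ⟨x, hx, rfl⟩
    exact hx
  exact ⟨_, key _ ha, _, key _ hb, map_mul _ _ _⟩

theorem El_le_SLsub (T : Subring Ω) : El m (T : Set Ω) ≤ SLsub m T :=
  El_le fun i j _ _ ha => elm_mem_SLsub ha i j

open Polynomial

variable {k : Type*} [Field k] {B T U : Subring Ω} {κ : k →+* B} {t : Ω}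

theorem map_zeroUnits_le : (zeroUnits κ).map (eval₂RingHom B.subtype t) ≤
    (eval₂RingHom B.subtype t).range.toSubmonoid := by
  rintro _ ⟨p, -, rfl⟩
  exact ⟨p, rfl⟩

theorem exists_bezout_X_pow {f : k[X]} (hf : f.eval 0 ≠ 0) (n : ℕ) :
    ∃ u v : k[X], u * f + v * X ^ n = 1 := by
  have h : IsCoprime (X : k[X]) f := by
    refine (irreducible_X.coprime_iff_not_dvd).2 fun h => hf ?_
    rwa [X_dvd_iff, coeff_zero_eq_eval_zero] at h
  obtain ⟨v, u, e⟩ := h.pow_left (m := n)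
  exact ⟨u, v, by rw [← e, add_comm]⟩

/-- Let `T` consist of Laurent polynomials in `t` over `B` and `U` of fractions with numerator
in `T` and denominator a polynomial in `t` over `k`. Then a matrix over `T` that is elementary
over `U` is elementary over `T`. -/
theorem mem_El_of_mem_El_frac (hm : 3 ≤ m) (hBT : B ≤ T) (ht : t ∈ T) {t' : Ω} (ht' : t' ∈ T)
    (htt' : t' * t = 1) (hTU : T ≤ U)
    (hinj : Function.Injective (eval₂RingHom B.subtype t))
    (hT : ∀ x ∈ T, ∃ n : ℕ, t ^ n * x ∈ (eval₂RingHom B.subtype t).range)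
    (hunit : ∀ f : k[X], f ≠ 0 → IsUnit (eval₂RingHom B.subtype t (f.map κ)))
    (hU : ∀ x ∈ U, ∃ f : k[X], f ≠ 0 ∧ eval₂RingHom B.subtype t (f.map κ) * x ∈ T)
    {g : SL m Ω} (hg : g ∈ El m (U : Set Ω)) (hgT : g ∈ SLsub m T) : g ∈ El m (T : Set Ω) := by
  set ev := eval₂RingHom B.subtype t with hev
  have evX : ev X = t := by simp [hev]
  have evT (p : B[X]) : ev p ∈ T := by
    induction p using Polynomial.induction_on' with
    | add p q hp hq => rw [map_add]; exact add_mem hp hq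
    | monomial n a =>
      rw [← C_mul_X_pow_eq_monomial, map_mul, map_pow, evX]
      exact mul_mem (hBT (by simp [hev])) (pow_mem ht _)
  set T₂ := fracSubring ev.range ((zeroUnits κ).map ev) map_zeroUnits_le with hT₂
  have range_le : ev.range ≤ T₂ := le_fracSubring _
  have evU (p : B[X]) : ev p ∈ U := hTU (evT p)
  have hU' (x) (hx : x ∈ U) : ∃ f : k[X], f.eval 0 ≠ 0 ∧ ev (f.map κ) * x ∈ T := by
    obtain ⟨f, hf, h⟩ := hU x hx
    obtain ⟨q, hq, hdvd⟩ := exists_eq_pow_rootMultiplicity_mul_and_not_dvd f hf 0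
    refine ⟨q, fun h0 => hdvd (dvd_iff_isRoot.2 h0), ?_⟩
    rw [C_0, sub_zero] at hq
    set n := f.rootMultiplicity 0
    have e : ev (q.map κ) * x = t' ^ n * (ev (f.map κ) * x) := by
      rw [hq, Polynomial.map_mul, Polynomial.map_pow, map_X, map_mul, map_pow, evX]
      have : t' ^ n * t ^ n = 1 := by rw [← mul_pow, htt', one_pow]
      linear_combination (-(ev (q.map κ) * x)) * this
    rw [e]
    exact mul_mem (pow_mem ht' _) h
  have memT₂ {x : Ω} {f : k[X]} (hf : f.eval 0 ≠ 0) (h : ev (f.map κ) * x ∈ ev.range) : x ∈ T₂ :=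
    ⟨_, ⟨_, mem_zeroUnits.2 ⟨f, hf, rfl⟩, rfl⟩, h⟩
  have dens (x) (hx : x ∈ U) : ∃ f : k[X], f.eval 0 ≠ 0 ∧ ev (f.map κ) * x ∈ T ∧
      ∃ n : ℕ, t ^ n * x ∈ T₂ := by
    obtain ⟨f, hf, h⟩ := hU' x hx
    obtain ⟨n, hn⟩ := hT _ h
    refine ⟨f, hf, h, n, memT₂ hf ?_⟩
    rwa [mul_left_comm]
  have ev_bezout {u v f : k[X]} {n : ℕ} (e : u * f + v * X ^ n = 1) :
      ev (u.map κ) * ev (f.map κ) + ev (v.map κ) * t ^ n = 1 := by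
    have := congrArg (fun p => ev (mapRingHom κ p)) e
    simpa only [map_add, map_mul, map_pow, coe_mapRingHom, map_X, evX, map_one] using this
  have hXr : t ∈ ev.range := ⟨X, evX⟩
  have : ∃ a ∈ El m (T : Set Ω), ∃ b ∈ El m (T₂ : Set Ω), g = a * b := by
    refine exists_mul_of_split_subring hm (hTU ht) (range_le hXr)
      (fun x hx => (dens x hx).choose_spec.2.2) (fun M x hx => ?_) hg
    obtain ⟨f, hf, h, n, hn⟩ := dens x hx
    obtain ⟨u, v, e⟩ := exists_bezout_X_pow hf (n + M)
    refine ⟨ev (u.map κ) * (ev (f.map κ) * x), mul_mem (evT _) h, ev (v.map κ) * (t ^ n * x),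
      mul_mem (range_le ⟨_, rfl⟩) hn, mul_mem (evU _) (mul_mem (pow_mem (hTU ht) _) hx),
      mul_mem (evU _) (mul_mem (evU _) hx), ?_⟩
    linear_combination (-x) * ev_bezout e
  obtain ⟨a, ha, b, hb, rfl⟩ := this
  have hbT : b ∈ SLsub m T := by
    have := mul_mem (inv_mem (El_le_SLsub T ha)) hgT
    rwa [inv_mul_cancel_left] at this
  have hbr : b ∈ SLsub m ev.range := by
    rw [mem_SLsub] at hbT ⊢
    intro i j
    obtain ⟨_, ⟨p, hp, rfl⟩, h⟩ := (mem_SLsub.1 (El_le_SLsub T₂ hb)) i j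
    obtain ⟨f, hf, rfl⟩ := mem_zeroUnits.1 hp
    obtain ⟨n, hn⟩ := hT _ (hbT i j)
    obtain ⟨u, v, e⟩ := exists_bezout_X_pow hf n
    have : b.1 i j = ev (u.map κ) * (ev (f.map κ) * b.1 i j) +
        ev (v.map κ) * (t ^ n * b.1 i j) := by
      linear_combination (-(b.1 i j)) * ev_bezout e
    rw [this]
    exact add_mem (mul_mem ⟨_, rfl⟩ h) (mul_mem ⟨_, rfl⟩ hn)
  obtain ⟨α, rfl⟩ : ∃ α : SL m B[X], mapSL ev α = b := by
    obtain ⟨β, rfl⟩ := hbr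
    refine ⟨mapSL ((RingEquiv.ofLeftInverse (Function.leftInverse_invFun hinj)).symm :
      ev.range →+* B[X]) β, ?_⟩
    rw [mapSL_comp]
    congr 2
    ext x
    exact congrArg Subtype.val
      ((RingEquiv.ofLeftInverse (Function.leftInverse_invFun hinj)).apply_symm_apply x)
  have hunits : ∀ y : zeroUnits κ, IsUnit (ev y) := by
    rintro ⟨y, hy⟩
    obtain ⟨f, hf, rfl⟩ := mem_zeroUnits.1 hy
    exact hunit f (by rintro rfl; simp at hf)
  set l := IsLocalization.lift (S := Localization (zeroUnits κ)) hunits with hl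
  have lalg (p : B[X]) : l (algebraMap _ _ p) = ev p := IsLocalization.lift_eq _ _
  have linj : Function.Injective l := by
    refine (IsLocalization.lift_injective_iff _).2 fun x y => ⟨fun h => ?_, fun h => ?_⟩
    · rw [← lalg, ← lalg, h]
    · rw [hinj h]
  have hα : α ∈ El m (Set.univ : Set B[X]) := by
    refine mem_El_of_map_zeroUnits hm κ ?_
    have hle : (T₂ : Set Ω) ⊆ l.range := by
      rintro x ⟨_, ⟨p, hp, rfl⟩, q, hq⟩
      refine ⟨IsLocalization.mk' _ q (⟨p, hp⟩ : zeroUnits κ), ?_⟩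
      refine (hunits ⟨p, hp⟩).mul_left_cancel ?_
      rw [← lalg, ← map_mul, mul_comm, IsLocalization.mk'_spec]
      rw [lalg, lalg, hq]
    obtain ⟨y, hy, e⟩ := exists_lift_of_mem_El_range l (El_mono hle hb)
    have : mapSL l (mapSL (algebraMap _ _) α) = mapSL l y := by
      rw [e, mapSL_comp, hl, IsLocalization.lift_comp]
    rwa [map_injective linj this]
  refine mul_mem ha ?_
  have h1 : mapSL ev α ∈ (El m Set.univ).map (mapSL ev) := ⟨α, hα, rfl⟩
  rw [map_El] at h1
  refine El_mono ?_ h1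
  rintro _ ⟨p, -, rfl⟩
  exact evT p

end Subrings

section Laurent

open Polynomial

/-- Laurent polynomials over `A` in variables indexed by `ι`. -/
abbrev Laur (A ι : Type*) [CommRing A] := AddMonoidAlgebra A (ι →₀ ℤ)

variable {A ι : Type*} [CommRing A]

/-- The variable with index `i`. -/
noncomputable def tvar (A : Type*) [CommRing A] (i : ι) : Laur A ι :=
  AddMonoidAlgebra.single (Finsupp.single i 1) 1

/-- The grading of Laurent polynomials by the degree in one variable, as a coaction. -/
noncomputable def coact (A : Type*) [CommRing A] (i : ι) :
    Laur A ι →+* LaurentPolynomial (Laur A ι) :=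
  AddMonoidAlgebra.liftNCRingHom
    (LaurentPolynomial.C.comp AddMonoidAlgebra.singleZeroRingHom)
    { toFun a := LaurentPolynomial.C (AddMonoidAlgebra.single a.toAdd 1) *
        LaurentPolynomial.T (a.toAdd i)
      map_one' := by
        rw [toAdd_one, Finsupp.coe_zero, Pi.zero_apply, LaurentPolynomial.T_zero,
          ← AddMonoidAlgebra.one_def, map_one, mul_one]
      map_mul' a b := by
        rw [toAdd_mul, Finsupp.add_apply, LaurentPolynomial.T_add,
          show (AddMonoidAlgebra.single (a.toAdd + b.toAdd) 1 : Laur A ι) =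
            AddMonoidAlgebra.single a.toAdd 1 * AddMonoidAlgebra.single b.toAdd 1 by
            rw [AddMonoidAlgebra.single_mul_single, mul_one], map_mul]
        ring }
    (fun _ _ => Commute.all _ _)

theorem coact_single (i : ι) (a : ι →₀ ℤ) (r : A) :
    coact A i (AddMonoidAlgebra.single a r) =
      LaurentPolynomial.C (AddMonoidAlgebra.single a r) * LaurentPolynomial.T (a i) := by
  rw [coact, AddMonoidAlgebra.liftNCRingHom_single]
  simp only [RingHom.comp_apply, MonoidHom.coe_mk, OneHom.coe_mk, toAdd_ofAdd]
  rw [← mul_assoc, ← map_mul]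
  congr 2
  exact (AddMonoidAlgebra.single_mul_single _ _ _ _).trans (by rw [zero_add, mul_one])

/-- The Laurent polynomials not involving the variable with index `i`. -/
noncomputable def laurWithout (A : Type*) [CommRing A] (i : ι) : Subring (Laur A ι) :=
  RingHom.eqLocus (coact A i) LaurentPolynomial.C

theorem single_mem_laurWithout {i : ι} {a : ι →₀ ℤ} (ha : a i = 0) (r : A) :
    AddMonoidAlgebra.single a r ∈ laurWithout A i := by
  change coact A i _ = LaurentPolynomial.C _
  rw [coact_single, ha, LaurentPolynomial.T_zero, mul_one]

theorem isUnit_single (a : ι →₀ ℤ) : IsUnit (AddMonoidAlgebra.single a 1 : Laur A ι) :=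
  .of_mul_eq_one (AddMonoidAlgebra.single (-a) 1) (by
    rw [AddMonoidAlgebra.single_mul_single, add_neg_cancel, mul_one, AddMonoidAlgebra.one_def])

theorem isUnit_tvar (i : ι) : IsUnit (tvar A i) := isUnit_single _

theorem eval₂_tvar_injective (i : ι) :
    Function.Injective (eval₂RingHom (laurWithout A i).subtype (tvar A i)) := by
  have key : (coact A i).comp (eval₂RingHom (laurWithout A i).subtype (tvar A i)) =
      (toLaurent.comp (scaleVar (tvar A i))).comp (mapRingHom (laurWithout A i).subtype) := by
    apply ringHom_ext'
    · refine RingHom.ext fun r => ?_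
      simp only [RingHom.comp_apply, coe_eval₂RingHom, eval₂_C, coe_mapRingHom, map_C, scaleVar_C,
        toLaurent_C]
      exact r.2
    · simp only [RingHom.comp_apply, coe_eval₂RingHom, eval₂_X, coe_mapRingHom, map_X, scaleVar_X,
        map_mul, toLaurent_C, toLaurent_X]
      rw [tvar, coact_single, Finsupp.single_eq_same]
  refine (injective_iff_map_eq_zero _).2 fun p hp => ?_
  have h1 := congrArg (fun φ => φ p) key
  simp only [RingHom.comp_apply] at h1
  rw [hp, map_zero] at h1
  have h2 := toLaurent_eq_zero.1 h1.symm
  ext n : 1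
  have h3 := congrArg (fun q => q.coeff n) h2
  simp only [coeff_scaleVar, coeff_zero, coe_mapRingHom, coeff_map] at h3
  rw [((isUnit_tvar i).pow n).mul_right_eq_zero] at h3
  exact Subtype.ext h3

theorem tvar_pow (i : ι) (n : ℕ) : tvar A i ^ n =
    AddMonoidAlgebra.single (Finsupp.single i (n : ℤ)) 1 := by
  rw [tvar, AddMonoidAlgebra.single_pow, one_pow, Finsupp.smul_single, nsmul_eq_mul, mul_one]

theorem exists_tvar_pow_mul_mem (i : ι) (x : Laur A ι) : ∃ n : ℕ,
    tvar A i ^ n * x ∈ (eval₂RingHom (laurWithout A i).subtype (tvar A i)).range := by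
  have ht : tvar A i ∈ (eval₂RingHom (laurWithout A i).subtype (tvar A i)).range :=
    ⟨X, by simp⟩
  induction x using AddMonoidAlgebra.induction_linear with
  | zero => exact ⟨0, by rw [mul_zero]; exact zero_mem _⟩
  | add x y hx hy =>
    obtain ⟨n, hn⟩ := hx
    obtain ⟨l, hl⟩ := hy
    refine ⟨n + l, ?_⟩
    rw [show tvar A i ^ (n + l) * (x + y) = tvar A i ^ l * (tvar A i ^ n * x) +
      tvar A i ^ n * (tvar A i ^ l * y) by ring]
    exact add_mem (mul_mem (pow_mem ht _) hn) (mul_mem (pow_mem ht _) hl)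
  | single a r =>
    refine ⟨(-(a i)).toNat, ?_⟩
    have e : tvar A i ^ (-(a i)).toNat * AddMonoidAlgebra.single a r =
        AddMonoidAlgebra.single (a - Finsupp.single i (a i)) r * tvar A i ^ (a i).toNat := by
      rw [tvar_pow, tvar_pow, AddMonoidAlgebra.single_mul_single,
        AddMonoidAlgebra.single_mul_single, mul_one, one_mul]
      congr 1
      have : ((a i).toNat : ℤ) = a i + (-(a i)).toNat := by omega
      rw [this, Finsupp.single_add]
      abel
    rw [e]
    have h0 : (a - Finsupp.single i (a i)) i = 0 := by simp
    exact mul_mem ⟨C ⟨_, single_mem_laurWithout h0 r⟩, by simp⟩ (pow_mem ht _)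

variable (A) in
/-- The map from polynomials over `k` to Laurent polynomials over a `k`-algebra `A`. -/
noncomputable def polyToLaur {k : Type*} [CommRing k] [Algebra k A] : MvPolynomial ι k →+* Laur A ι :=
  MvPolynomial.eval₂Hom (AddMonoidAlgebra.singleZeroRingHom.comp (algebraMap k A)) (tvar A)

variable {k : Type*} [CommRing k] [Algebra k A]

theorem polyToLaur_C (c : k) : polyToLaur A (MvPolynomial.C c : MvPolynomial ι k) =
    AddMonoidAlgebra.single 0 (algebraMap k A c) := by
  simp [polyToLaur]

theorem polyToLaur_X (i : ι) : polyToLaur A (MvPolynomial.X i : MvPolynomial ι k) = tvar A i := by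
  simp [polyToLaur]

theorem polyToLaur_mem_laurWithout {i : ι} {s : Set ι} (hi : i ∉ s) {f : MvPolynomial ι k}
    (hf : f ∈ MvPolynomial.supported k s) : polyToLaur A f ∈ laurWithout A i := by
  induction hf using Algebra.adjoin_induction with
  | mem x hx =>
    obtain ⟨j, hj, rfl⟩ := hx
    rw [polyToLaur_X]
    refine single_mem_laurWithout ?_ 1
    rw [Finsupp.single_eq_of_ne]
    rintro rfl
    exact hi hj
  | algebraMap r =>
    rw [MvPolynomial.algebraMap_eq, polyToLaur_C]
    exact single_mem_laurWithout (by simp) _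
  | add x y _ _ hx hy => rw [map_add]; exact add_mem hx hy
  | mul x y _ _ hx hy => rw [map_mul]; exact mul_mem hx hy

theorem exists_polynomial_of_mem_supported_insert {i : ι} {s : Set ι} {f : MvPolynomial ι k}
    (hf : f ∈ MvPolynomial.supported k (insert i s)) :
    ∃ p : (MvPolynomial.supported k s)[X],
      eval₂RingHom (MvPolynomial.supported k s).val.toRingHom (MvPolynomial.X i) p = f := by
  induction hf using Algebra.adjoin_induction with
  | mem x hx =>
    obtain ⟨j, rfl | hj, rfl⟩ := hx
    · exact ⟨X, by simp⟩
    · exact ⟨C ⟨_, Algebra.subset_adjoin ⟨j, hj, rfl⟩⟩, by simp⟩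
  | algebraMap r => exact ⟨C (algebraMap _ _ r), by simp⟩
  | add x y _ _ hx hy =>
    obtain ⟨p, rfl⟩ := hx
    obtain ⟨q, rfl⟩ := hy
    exact ⟨p + q, map_add _ _ _⟩
  | mul x y _ _ hx hy =>
    obtain ⟨p, rfl⟩ := hx
    obtain ⟨q, rfl⟩ := hy
    exact ⟨p * q, map_mul _ _ _⟩

end Laurent

section Chain

open Polynomial

variable {A ι k Ω : Type*} [CommRing A] [Field k] [Algebra k A] [CommRing Ω] (ψ : Laur A ι →+* Ω)

variable (k) in
/-- The images of the nonzero polynomials over `k` in the variables in `s`. -/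
noncomputable def denoms (s : Set ι) : Submonoid Ω :=
  (nonZeroDivisors (MvPolynomial ι k) ⊓ (MvPolynomial.supported k s).toSubmonoid).map
    (ψ.comp (polyToLaur A))

variable {ψ}

theorem mem_denoms {s : Set ι} {x : Ω} : x ∈ denoms k ψ s ↔
    ∃ f ∈ MvPolynomial.supported k s, f ≠ 0 ∧ ψ (polyToLaur A f) = x := by
  constructor
  · rintro ⟨f, ⟨hf, hf'⟩, rfl⟩
    exact ⟨f, hf', nonZeroDivisors.ne_zero hf, rfl⟩
  · rintro ⟨f, hf, hf', rfl⟩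
    exact ⟨f, ⟨mem_nonZeroDivisors_of_ne_zero hf', hf⟩, rfl⟩

theorem denoms_le_range (s : Set ι) : denoms k ψ s ≤ ψ.range.toSubmonoid := by
  rintro _ ⟨f, -, rfl⟩
  exact ⟨_, rfl⟩

theorem denoms_le_map {i : ι} {s : Set ι} (hi : i ∉ s) :
    denoms k ψ s ≤ ((laurWithout A i).map ψ).toSubmonoid := by
  rintro _ ⟨f, ⟨-, hf⟩, rfl⟩
  exact ⟨_, polyToLaur_mem_laurWithout hi hf, rfl⟩

variable (k ψ) in
/-- The fractions whose denominator only involves the variables in `s`. -/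
noncomputable def fracs (s : Set ι) : Subring Ω := fracSubring ψ.range (denoms k ψ s) (denoms_le_range s)

variable (k ψ) in
/-- The fractions whose numerator does not involve the variable with index `i` and whose
denominator only involves the variables in `s`. -/
noncomputable def fracsWithout {i : ι} {s : Set ι} (hi : i ∉ s) : Subring Ω :=
  fracSubring ((laurWithout A i).map ψ) (denoms k ψ s) (denoms_le_map hi)

theorem fracs_mono {s s' : Set ι} (h : s ⊆ s') : fracs k ψ s ≤ fracs k ψ s' := by
  rintro x ⟨_, ⟨f, ⟨hf, hf'⟩, rfl⟩, hx⟩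
  exact ⟨_, ⟨f, ⟨hf, MvPolynomial.supported_mono h hf'⟩, rfl⟩, hx⟩

theorem range_le_fracs (s : Set ι) : ψ.range ≤ fracs k ψ s := le_fracSubring _

theorem fracsWithout_le {i : ι} {s : Set ι} (hi : i ∉ s) : fracsWithout k ψ hi ≤ fracs k ψ s := by
  rintro x ⟨d, hd, y, -, h⟩
  exact ⟨d, hd, y, h⟩

variable {i : ι} {s : Set ι} (hi : i ∉ s)

variable (k ψ) in
/-- The inclusion of the Laurent polynomials not involving the variable with index `i`. -/
noncomputable def numer : laurWithout A i →+* fracsWithout k ψ hi :=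
  (ψ.comp (laurWithout A i).subtype).codRestrict _ fun x =>
    le_fracSubring _ ⟨x, x.2, rfl⟩

variable (k ψ) in
/-- The inclusion of the polynomials in the variables in `s`. -/
noncomputable def polyNumer : MvPolynomial.supported k s →+* fracsWithout k ψ hi :=
  ((ψ.comp (polyToLaur A)).comp (MvPolynomial.supported k s).val.toRingHom).codRestrict _ fun x =>
    le_fracSubring _ ⟨_, polyToLaur_mem_laurWithout hi x.2, rfl⟩

theorem eval₂_numer (p : (laurWithout A i)[X]) :
    eval₂RingHom (fracsWithout k ψ hi).subtype (ψ (tvar A i)) (p.map (numer k ψ hi)) =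
      ψ (eval₂RingHom (laurWithout A i).subtype (tvar A i) p) := by
  rw [coe_eval₂RingHom, coe_eval₂RingHom, eval₂_map, hom_eval₂]
  rfl

theorem eval₂_polyNumer (p : (MvPolynomial.supported k s)[X]) :
    eval₂RingHom (fracsWithout k ψ hi).subtype (ψ (tvar A i)) (p.map (polyNumer k ψ hi)) =
      ψ (polyToLaur A (eval₂RingHom (MvPolynomial.supported k s).val.toRingHom
        (MvPolynomial.X i) p)) := by
  rw [coe_eval₂RingHom, coe_eval₂RingHom, eval₂_map, hom_eval₂, hom_eval₂, polyToLaur_X]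
  rfl

theorem eval₂_fracsWithout_injective (hψ : Function.Injective ψ)
    (hunit : ∀ f : MvPolynomial ι k, f ≠ 0 → IsUnit (ψ (polyToLaur A f))) :
    Function.Injective (eval₂RingHom (fracsWithout k ψ hi).subtype (ψ (tvar A i))) := by
  refine (injective_iff_map_eq_zero _).2 fun p hp => ?_
  obtain ⟨x, hx, q, hq⟩ := exists_smul_mem_range_map (numer k ψ hi)
    (Submonoid.comap ((numer k ψ hi : laurWithout A i →* fracsWithout k ψ hi))
      (IsUnit.submonoid (fracsWithout k ψ hi))) (by
    rintro ⟨x, d, hd, y, hy, h⟩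
    obtain ⟨f, hf, hf0, rfl⟩ := mem_denoms.1 hd
    refine ⟨⟨_, polyToLaur_mem_laurWithout hi hf⟩, ?_, ⟨y, hy⟩, Subtype.ext h.symm⟩
    obtain ⟨v, hv⟩ := (hunit f hf0).exists_right_inv
    refine IsUnit.of_mul_eq_one ⟨v, _, hd, 1, Subring.one_mem _, ?_⟩ (Subtype.ext hv)
    rw [map_one, hv]) p
  have h1 := congrArg (eval₂RingHom (fracsWithout k ψ hi).subtype (ψ (tvar A i))) hq
  rw [map_mul, hp, mul_zero, coe_mapRingHom, eval₂_numer] at h1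
  have h2 := eval₂_tvar_injective i (hψ (h1.trans (map_zero ψ).symm) |>.trans (map_zero _).symm)
  rw [h2, map_zero] at hq
  exact ((IsUnit.map C hx).mul_right_eq_zero).1 hq.symm

theorem exists_tvar_pow_mul_mem_fracs
    (hunit : ∀ f : MvPolynomial ι k, f ≠ 0 → IsUnit (ψ (polyToLaur A f))) {x : Ω}
    (hx : x ∈ fracs k ψ s) : ∃ n : ℕ, ψ (tvar A i) ^ n * x ∈
      (eval₂RingHom (fracsWithout k ψ hi).subtype (ψ (tvar A i))).range := by
  obtain ⟨d, hd, y, hy⟩ := hx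
  obtain ⟨n, p, hp⟩ := exists_tvar_pow_mul_mem i y
  obtain ⟨f, hf, hf0, rfl⟩ := mem_denoms.1 hd
  obtain ⟨v, hv⟩ := (hunit f hf0).exists_right_inv
  have hvm : v ∈ fracsWithout k ψ hi := ⟨_, hd, 1, Subring.one_mem _, by rw [map_one, hv]⟩
  refine ⟨n, C ⟨v, hvm⟩ * p.map (numer k ψ hi), ?_⟩
  rw [map_mul, eval₂_numer, hp, map_mul, map_pow, hy]
  simp only [coe_eval₂RingHom, eval₂_C, Subring.subtype_apply]
  linear_combination (ψ (tvar A i) ^ n * x) * hv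

variable {m : ℕ}

include hi in
theorem mem_El_fracs_of_insert [Nontrivial Ω] (hm : 3 ≤ m) (hψ : Function.Injective ψ)
    (hunit : ∀ f : MvPolynomial ι k, f ≠ 0 → IsUnit (ψ (polyToLaur A f))) {g : SL m Ω}
    (hg : g ∈ El m (fracs k ψ (insert i s) : Set Ω)) (hg' : g ∈ SLsub m ψ.range) :
    g ∈ El m (fracs k ψ s : Set Ω) := by
  have hinj := eval₂_fracsWithout_injective hi hψ hunit
  have hκ (y : nonZeroDivisors (MvPolynomial.supported k s)) : IsUnit (polyNumer k ψ hi y) := by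
    have hy : (y : MvPolynomial ι k) ≠ 0 := fun h =>
      nonZeroDivisors.ne_zero y.2 (Subtype.ext h)
    obtain ⟨v, hv⟩ := (hunit _ hy).exists_right_inv
    exact IsUnit.of_mul_eq_one ⟨v, _, mem_denoms.2 ⟨_, y.1.2, hy, rfl⟩, 1, Subring.one_mem _, by
      rw [map_one, hv]⟩ (Subtype.ext hv)
  set κ : FractionRing (MvPolynomial.supported k s) →+* fracsWithout k ψ hi :=
    IsLocalization.lift hκ with hκdef
  have κalg (p : (MvPolynomial.supported k s)[X]) :
      (p.map (algebraMap _ (FractionRing (MvPolynomial.supported k s)))).map κ =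
        p.map (polyNumer k ψ hi) := by
    rw [Polynomial.map_map, hκdef, IsLocalization.lift_comp]
  have κinj : Function.Injective κ := κ.injective
  obtain ⟨t', ht'⟩ := (isUnit_tvar (A := A) i).exists_left_inv
  refine mem_El_of_mem_El_frac (κ := κ) hm (fracsWithout_le hi) (t := ψ (tvar A i))
    (range_le_fracs s ⟨_, rfl⟩) (range_le_fracs s ⟨t', rfl⟩) (by rw [← map_mul, ht', map_one])
    (fracs_mono (Set.subset_insert _ _)) hinj (fun x hx => exists_tvar_pow_mul_mem_fracs hi hunit hx)
    ?_ ?_ hg ?_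
  · intro f hf
    obtain ⟨x, hx, q, hq⟩ := exists_smul_mem_range_map
      (algebraMap _ (FractionRing (MvPolynomial.supported k s)))
      (nonZeroDivisors (MvPolynomial.supported k s)) (fun x => by
        obtain ⟨⟨y, d⟩, h⟩ := IsLocalization.surj (nonZeroDivisors (MvPolynomial.supported k s)) x
        exact ⟨d, d.2, y, by rw [mul_comm]; exact h⟩) f
    have e := κalg q
    rw [← coe_mapRingHom (algebraMap _ _), hq, Polynomial.map_mul, map_C] at e
    have e1 := congrArg (eval₂RingHom (fracsWithout k ψ hi).subtype (ψ (tvar A i))) e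
    rw [map_mul, eval₂_polyNumer] at e1
    refine isUnit_of_mul_isUnit_right (e1 ▸ hunit _ fun h0 => ?_)
    rw [h0, map_zero, map_zero, ← map_mul] at e1
    have e2 := hinj (e1.trans (map_zero _).symm)
    rw [← map_C, ← Polynomial.map_mul, Polynomial.map_eq_zero_iff κinj, mul_eq_zero, C_eq_zero,
      map_eq_zero_iff _ (IsFractionRing.injective _ _)] at e2
    exact e2.elim (nonZeroDivisors.ne_zero hx) hf
  · rintro x ⟨d, hd, hx⟩
    obtain ⟨f, hf, hf0, rfl⟩ := mem_denoms.1 hd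
    obtain ⟨p, rfl⟩ := exists_polynomial_of_mem_supported_insert hf
    refine ⟨p.map (algebraMap _ _), ?_, ?_⟩
    · intro h0
      have := κalg p
      rw [h0, Polynomial.map_zero] at this
      have h1 := eval₂_polyNumer (ψ := ψ) hi p
      rw [← this, map_zero] at h1
      exact (hunit _ hf0).ne_zero h1.symm
    · rw [κalg, eval₂_polyNumer]
      exact range_le_fracs s hx
  · rw [mem_SLsub] at hg' ⊢
    exact fun a b => range_le_fracs s (hg' a b)

theorem fracs_empty_le : fracs k ψ ∅ ≤ ψ.range := by
  rintro x ⟨d, hd, y, hx⟩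
  obtain ⟨f, hf, hf0, rfl⟩ := mem_denoms.1 hd
  rw [MvPolynomial.supported_empty, Algebra.mem_bot] at hf
  obtain ⟨c, rfl⟩ := hf
  have hc : c ≠ 0 := by rintro rfl; exact hf0 (map_zero _)
  refine ⟨polyToLaur A (MvPolynomial.C c⁻¹) * y, ?_⟩
  rw [map_mul, hx, MvPolynomial.algebraMap_eq, ← mul_assoc, ← map_mul, ← map_mul,
    ← MvPolynomial.C_mul, inv_mul_cancel₀ hc, MvPolynomial.C_1, map_one, map_one, one_mul]

/-- If `Ω` consists of fractions of Laurent polynomials over `A` with denominators the nonzero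
polynomials over `k`, then a matrix of Laurent polynomials that is elementary over `Ω` is
elementary. -/
theorem mem_El_of_map_laur [Finite ι] (hm : 3 ≤ m) (hψ : Function.Injective ψ)
    (hunit : ∀ f : MvPolynomial ι k, f ≠ 0 → IsUnit (ψ (polyToLaur A f)))
    (hfrac : ∀ x : Ω, ∃ f : MvPolynomial ι k, f ≠ 0 ∧ ψ (polyToLaur A f) * x ∈ ψ.range)
    {g : SL m (Laur A ι)} (hg : mapSL ψ g ∈ El m (Set.univ : Set Ω)) :
    g ∈ El m (Set.univ : Set (Laur A ι)) := by
  have hrange : mapSL ψ g ∈ El m (ψ.range : Set Ω) → g ∈ El m (Set.univ : Set (Laur A ι)) := by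
    intro h
    obtain ⟨y, hy, e⟩ := exists_lift_of_mem_El_range ψ h
    rwa [← map_injective hψ e]
  rcases subsingleton_or_nontrivial Ω with hΩ | hΩ
  · exact hrange (by
      rw [show mapSL ψ g = 1 from sl_ext (Subsingleton.elim _ _)]
      exact one_mem _)
  have hgr : mapSL ψ g ∈ SLsub m ψ.range := mem_SLsub.2 fun a b => ⟨_, rfl⟩
  have key (s : Set ι) (hs : s.Finite) : mapSL ψ g ∈ El m (fracs k ψ s : Set Ω) →
      mapSL ψ g ∈ El m (ψ.range : Set Ω) := by
    induction s, hs using Set.Finite.induction_on with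
    | empty => exact fun h => El_mono fracs_empty_le h
    | insert hi _ ih => exact fun h => ih (mem_El_fracs_of_insert hi hm hψ hunit h hgr)
  refine hrange (key Set.univ Set.finite_univ (El_mono (fun x _ => ?_) hg))
  obtain ⟨f, hf, hx⟩ := hfrac x
  exact ⟨_, mem_denoms.2 ⟨f, by rw [MvPolynomial.supported_univ]; trivial, hf, rfl⟩, hx⟩

end Chain

section Tensor

theorem polyToLaur_monomial {A ι : Type*} [CommRing A] (b : ι →₀ ℕ) (r : A) :
    polyToLaur A (MvPolynomial.monomial b r) = AddMonoidAlgebra.single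
      (Finsupp.mapRange.addMonoidHom (Nat.castAddMonoidHom ℤ) b) r := by
  induction b using Finsupp.induction_linear generalizing r with
  | zero =>
    rw [← MvPolynomial.C_apply, polyToLaur_C, map_zero]
    rfl
  | add f g hf hg =>
    rw [show MvPolynomial.monomial (f + g) r =
      MvPolynomial.monomial f 1 * MvPolynomial.monomial g r by
        rw [MvPolynomial.monomial_mul, one_mul], map_mul, hf, hg,
      AddMonoidAlgebra.single_mul_single, one_mul, map_add]
  | single i n =>
    rw [← MvPolynomial.C_mul_X_pow_eq_monomial, map_mul, map_pow, polyToLaur_C, polyToLaur_X,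
      tvar_pow, AddMonoidAlgebra.single_mul_single, zero_add, mul_one,
      Finsupp.mapRange.addMonoidHom_apply, Finsupp.mapRange_single]
    rfl

theorem exists_isUnit_mul_mem_range {A ι : Type*} [CommRing A] (x : Laur A ι) :
    ∃ a : ι →₀ ℤ, ∃ f : MvPolynomial ι A,
      AddMonoidAlgebra.single a 1 * x = polyToLaur A f := by
  suffices ∃ (b : ι →₀ ℕ) (f : MvPolynomial ι A),
      polyToLaur A (MvPolynomial.monomial b (1 : A)) * x = polyToLaur A f by
    obtain ⟨b, f, h⟩ := this
    exact ⟨_, f, by rw [← h, polyToLaur_monomial]⟩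
  induction x using AddMonoidAlgebra.induction_linear with
  | zero => exact ⟨0, 0, by rw [mul_zero, map_zero]⟩
  | add x y hx hy =>
    obtain ⟨b, f, hf⟩ := hx
    obtain ⟨c, g, hg⟩ := hy
    refine ⟨b + c, MvPolynomial.monomial c 1 * f + MvPolynomial.monomial b 1 * g, ?_⟩
    rw [show MvPolynomial.monomial (b + c) (1 : A) =
      MvPolynomial.monomial b 1 * MvPolynomial.monomial c 1 by
        rw [MvPolynomial.monomial_mul, one_mul], map_add, map_mul, map_mul, map_mul, ← hf, ← hg]
    ring
  | single a r =>
    refine ⟨a.mapRange (fun z => (-z).toNat) rfl,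
      MvPolynomial.monomial (a.mapRange Int.toNat rfl) r, ?_⟩
    rw [polyToLaur_monomial, polyToLaur_monomial, AddMonoidAlgebra.single_mul_single, one_mul]
    congr 1
    ext i
    simp only [Finsupp.mapRange.addMonoidHom_apply, Finsupp.add_apply, Finsupp.mapRange_apply,
      Nat.coe_castAddMonoidHom]
    omega

variable {k A ι Kt : Type*} [Field k] [CommRing A] [Algebra k A] [Field Kt]
  [Algebra (MvPolynomial ι k) Kt] [Algebra k Kt] [IsScalarTower k (MvPolynomial ι k) Kt]
  {φ : Laur A ι →+* A ⊗[k] Kt}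

theorem map_polyToLaur (hφA : ∀ a : A, φ (AddMonoidAlgebra.single 0 a) = a ⊗ₜ[k] 1)
    (hφt : ∀ i, φ (tvar A i) = 1 ⊗ₜ[k] algebraMap (MvPolynomial ι k) Kt (MvPolynomial.X i))
    (f : MvPolynomial ι k) : φ (polyToLaur A f) = 1 ⊗ₜ[k] algebraMap (MvPolynomial ι k) Kt f := by
  have : φ.comp (polyToLaur A) = (Algebra.TensorProduct.includeRight : Kt →ₐ[k] A ⊗[k] Kt).toRingHom.comp
      (algebraMap (MvPolynomial ι k) Kt) := by
    refine MvPolynomial.ringHom_ext (fun c => ?_) fun i => ?_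
    · simp only [RingHom.comp_apply, polyToLaur_C, hφA]
      rw [← MvPolynomial.algebraMap_eq, ← IsScalarTower.algebraMap_apply]
      simp only [AlgHom.toRingHom_eq_coe, RingHom.coe_coe,
        Algebra.TensorProduct.includeRight_apply]
      rw [Algebra.algebraMap_eq_smul_one, Algebra.algebraMap_eq_smul_one, TensorProduct.smul_tmul]
    · simp only [RingHom.comp_apply, polyToLaur_X, hφt]
      rfl
  exact congrArg (fun h => h f) this

theorem injective_of_isFractionRing [IsFractionRing (MvPolynomial ι k) Kt]
    (hφA : ∀ a : A, φ (AddMonoidAlgebra.single 0 a) = a ⊗ₜ[k] 1)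
    (hφt : ∀ i, φ (tvar A i) = 1 ⊗ₜ[k] algebraMap (MvPolynomial ι k) Kt (MvPolynomial.X i)) :
    Function.Injective φ := by
  have key : φ.comp (polyToLaur A) = (Algebra.TensorProduct.map (AlgHom.id k A)
      (IsScalarTower.toAlgHom k (MvPolynomial ι k) Kt)).toRingHom.comp
      (MvPolynomial.algebraTensorAlgEquiv k A).symm.toAlgHom.toRingHom := by
    refine MvPolynomial.ringHom_ext (fun c => ?_) fun i => ?_
    · simp only [RingHom.comp_apply, polyToLaur_C, Algebra.algebraMap_self, RingHom.id_apply, hφA]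
      change _ = Algebra.TensorProduct.map _ _
        ((MvPolynomial.algebraTensorAlgEquiv k A).symm (MvPolynomial.C c))
      rw [MvPolynomial.C_apply, MvPolynomial.algebraTensorAlgEquiv_symm_monomial,
        Algebra.TensorProduct.map_tmul, ← MvPolynomial.C_apply, MvPolynomial.C_1, map_one,
        AlgHom.id_apply]
    · simp [polyToLaur_X, hφt]
  have h1 : Function.Injective (Algebra.TensorProduct.map (AlgHom.id k A)
      (IsScalarTower.toAlgHom k (MvPolynomial ι k) Kt)) :=
    Module.Flat.lTensor_preserves_injective_linearMap (M := A)
      (IsScalarTower.toAlgHom k (MvPolynomial ι k) Kt).toLinearMap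
      (IsFractionRing.injective (MvPolynomial ι k) Kt)
  refine (injective_iff_map_eq_zero _).2 fun x hx => ?_
  obtain ⟨a, f, hf⟩ := exists_isUnit_mul_mem_range x
  have h2 := congrArg (fun h => h f) key
  simp only [RingHom.comp_apply] at h2
  rw [← hf, map_mul, hx, mul_zero] at h2
  have h3 := h1 (h2.symm.trans (map_zero _).symm)
  have h4 : f = 0 := (MvPolynomial.algebraTensorAlgEquiv k A).symm.injective (h3.trans (map_zero _).symm)
  rw [h4, map_zero] at hf
  exact (isUnit_single a).mul_right_eq_zero.1 hf

theorem exists_mul_mem_range [IsFractionRing (MvPolynomial ι k) Kt]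
    (hφA : ∀ a : A, φ (AddMonoidAlgebra.single 0 a) = a ⊗ₜ[k] 1)
    (hφt : ∀ i, φ (tvar A i) = 1 ⊗ₜ[k] algebraMap (MvPolynomial ι k) Kt (MvPolynomial.X i))
    (x : A ⊗[k] Kt) :
    ∃ f : MvPolynomial ι k, f ≠ 0 ∧ φ (polyToLaur A f) * x ∈ φ.range := by
  induction x using TensorProduct.induction_on with
  | zero => exact ⟨1, one_ne_zero, by rw [mul_zero]; exact zero_mem _⟩
  | tmul a y =>
    obtain ⟨p, q, hq, rfl⟩ := IsFractionRing.div_surjective (A := MvPolynomial ι k) y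
    have hq0 := nonZeroDivisors.ne_zero hq
    refine ⟨q, hq0, AddMonoidAlgebra.single 0 a * polyToLaur A p, ?_⟩
    rw [map_mul, hφA, map_polyToLaur hφA hφt, map_polyToLaur hφA hφt,
      Algebra.TensorProduct.tmul_mul_tmul, Algebra.TensorProduct.tmul_mul_tmul, one_mul, one_mul,
      mul_one, mul_div_cancel₀]
    exact (map_ne_zero_iff _ (IsFractionRing.injective _ _)).2 hq0
  | add x y hx hy =>
    obtain ⟨f, hf, hx⟩ := hx
    obtain ⟨g, hg, hy⟩ := hy
    refine ⟨f * g, mul_ne_zero hf hg, ?_⟩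
    rw [show φ (polyToLaur A (f * g)) * (x + y) =
      φ (polyToLaur A g) * (φ (polyToLaur A f) * x) +
      φ (polyToLaur A f) * (φ (polyToLaur A g) * y) by rw [map_mul, map_mul]; ring]
    exact add_mem (mul_mem ⟨_, rfl⟩ hx) (mul_mem ⟨_, rfl⟩ hy)

end Tensor

end ElemGroup

/-- Lemma 4.3 of the paper, for `SL_m` (`m ≥ 3`): the natural map
`K1^{SL_m}(A[t₁^{±1},…,tₙ^{±1}]) → K1^{SL_m}(A ⊗_k k(t₁,…,tₙ))` is injective:
if `g ∈ SL_m(A[t₁^{±1},…,tₙ^{±1}])` has `φ(g) ∈ E_m(A ⊗_k k(t₁,…,tₙ))`, then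
`g` is elementary, where `φ` sends `a ↦ a ⊗ 1` and `tᵢ ↦ 1 ⊗ tᵢ`. -/
theorem k1_laurent_to_ratFunc_injective
    (k : Type*) [Field k] (A : Type*) [CommRing A] [Algebra k A]
    (m : ℕ) (hm : 3 ≤ m) (n : ℕ)
    -- `Kt` is (a model of) the rational function field `k(t₁,…,tₙ)`
    (Kt : Type*) [Field Kt] [Algebra (MvPolynomial (Fin n) k) Kt]
    [IsFractionRing (MvPolynomial (Fin n) k) Kt]
    [Algebra k Kt] [IsScalarTower k (MvPolynomial (Fin n) k) Kt]
    (φ : AddMonoidAlgebra A (Fin n →₀ ℤ) →+* A ⊗[k] Kt)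
    -- `φ` sends `a ∈ A` to `a ⊗ 1`
    (hφA : ∀ a : A, φ (AddMonoidAlgebra.single 0 a) = a ⊗ₜ[k] 1)
    -- `φ` sends `tᵢ` to `1 ⊗ tᵢ`
    (hφt : ∀ i : Fin n,
      φ (AddMonoidAlgebra.single (Finsupp.single i (1 : ℤ)) (1 : A))
        = (1 : A) ⊗ₜ[k] algebraMap (MvPolynomial (Fin n) k) Kt (MvPolynomial.X i))
    (g : SpecialLinearGroup (Fin m) (AddMonoidAlgebra A (Fin n →₀ ℤ)))
    (h : SpecialLinearGroup.map φ g ∈ ElemSubgroup m (A ⊗[k] Kt)) :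
    g ∈ ElemSubgroup m (AddMonoidAlgebra A (Fin n →₀ ℤ)) := by
  rw [ElemGroup.elemSubgroup_eq] at h ⊢
  refine ElemGroup.mem_El_of_map_laur (k := k) hm
    (ElemGroup.injective_of_isFractionRing hφA hφt) (fun f hf => ?_)
    (ElemGroup.exists_mul_mem_range hφA hφt) h
  rw [ElemGroup.map_polyToLaur hφA hφt]
  refine IsUnit.map (Algebra.TensorProduct.includeRight : Kt →ₐ[k] A ⊗[k] Kt)
    (isUnit_iff_ne_zero.2 ?_)
  exact (map_ne_zero_iff _ (IsFractionRing.injective _ _)).2 hf
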